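/- Let A=(C,m) be a 3-dimensional toric idealistic cluster and let Z(s) be its local topological zeta function. If s_0 is a pole of Z(s) and s_0 = −a/b with a, b coprime positive integers and b ≥ 2, then Σ_{i: 1 ≤ i ≤ r, b | N_i} χ_i ≠ 0. (Via A'Campo's formula this is the monodromy conjecture for surfaces general with respect to a 3-dimensional toric idealistic cluster: every pole s_0 of the topological zeta function yields an eigenvalue e^{2πi·s_0} of the local monodromy, the case b = 1 being trivial since 1 is always an eigenvalue.) -/

import Mathlib

open Finset

/-!
Common framework: 3-dimensional toric constellations and toric idealistic clusters.
The edge labels `1, 2, 3` of the paper are encoded as `0, 1, 2 : Fin 3`.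
-/

/-- A 3-dimensional toric constellation: a finite rooted tree on nodes `0, …, r−1`
(node `0` the root, every child having larger index than its parent), each node having
at most three children, the edges from a node to its children carrying pairwise
distinct labels in `Fin 3`.  `label j` is the label of the edge from `parent j` to `j`
(irrelevant for the root). -/
structure ToricConstellation (r : ℕ) where
  parent : Fin r → Fin r
  label : Fin r → Fin 3
  parent_lt : ∀ i : Fin r, 0 < (i : ℕ) → (parent i : ℕ) < (i : ℕ)
  parent_root : ∀ i : Fin r, (i : ℕ) = 0 → parent i = i
  label_distinct : ∀ i j : Fin r, 0 < (i : ℕ) → 0 < (j : ℕ) → i ≠ j →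
    parent i = parent j → label i ≠ label j

namespace ToricConstellation

variable {r : ℕ}

/-- The ordered triple of vectors of `ℤ³` attached to a node: the root carries the
standard basis, and the child along the edge labelled `a` of a node with cone
`(u₁,u₂,u₃)` carries the triple obtained by replacing `u_a` with `u₁+u₂+u₃`. -/
def cone (C : ToricConstellation r) (i : Fin r) : Fin 3 → (Fin 3 → ℤ) :=
  if h : 0 < (i : ℕ) then
    Function.update (cone C (C.parent i)) (C.label i) (∑ a, cone C (C.parent i) a)
  else fun a => Pi.single a 1
termination_by (i : ℕ)
decreasing_by all_goals exact C.parent_lt i h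

/-- `v(Q) = u₁ + u₂ + u₃`, the sum of the cone vectors of a node. -/
def v (C : ToricConstellation r) (i : Fin r) : Fin 3 → ℤ := ∑ a, cone C i a

/-- `Prox C j i` means `j → i`, i.e. `Q_j` is proximate to `Q_i`:
`j ≠ i` and `v(Q_i)` is an entry of `cone(Q_j)`. -/
def Prox (C : ToricConstellation r) (j i : Fin r) : Prop :=
  j ≠ i ∧ ∃ a : Fin 3, cone C j a = v C i

instance (C : ToricConstellation r) (j i : Fin r) : Decidable (C.Prox j i) := by
  unfold Prox; infer_instance

/-- `inChain C i a b j = true` iff `j = Q_i(a, b^t)` for some `t ≥ 0`, i.e. `j` is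
reached from `i` by one edge labelled `a` followed by `t` edges labelled `b`. -/
def inChain (C : ToricConstellation r) (i : Fin r) (a b : Fin 3) (j : Fin r) : Bool :=
  if h : 0 < (j : ℕ) then
    (decide (C.parent j = i) && decide (C.label j = a)) ||
      (decide (C.label j = b) && inChain C i a b (C.parent j))
  else false
termination_by (j : ℕ)
decreasing_by exact C.parent_lt j h

/-- `LinProx C j i` means `j ↠ i`, i.e. `Q_j` is linearly proximate to `Q_i`. -/
def LinProx (C : ToricConstellation r) (j i : Fin r) : Prop :=
  ∃ a b : Fin 3, a ≠ b ∧ inChain C i a b j = true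

instance (C : ToricConstellation r) (j i : Fin r) : Decidable (C.LinProx j i) := by
  unfold LinProx; infer_instance

/-- `j` is a child of `i`. -/
def IsChild (C : ToricConstellation r) (j i : Fin r) : Prop :=
  0 < (j : ℕ) ∧ C.parent j = i

instance (C : ToricConstellation r) (j i : Fin r) : Decidable (C.IsChild j i) := by
  unfold IsChild; infer_instance

/-- The set `S_i` of labels of the edges on the path from the root to `Q_i`. -/
def labelsUnder (C : ToricConstellation r) (i : Fin r) : Finset (Fin 3) :=
  if h : 0 < (i : ℕ) then insert (C.label i) (labelsUnder C (C.parent i)) else ∅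
termination_by (i : ℕ)
decreasing_by exact C.parent_lt i h

/-- `i` is a weak ancestor of `j` (`i = j` or `i` a strict ancestor of `j`). -/
def anc (C : ToricConstellation r) (i j : Fin r) : Bool :=
  decide (i = j) || (if h : 0 < (j : ℕ) then anc C i (C.parent j) else false)
termination_by (j : ℕ)
decreasing_by exact C.parent_lt j h

/-- The set of nodes weakly above `i` (`i` together with its descendants). -/
def weakAbove (C : ToricConstellation r) (i : Fin r) : Finset (Fin r) :=
  univ.filter (fun j => anc C i j = true)

end ToricConstellation

/-- A 3-dimensional toric cluster: a toric constellation together with a positive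
integer weight for each node. -/
structure ToricCluster (r : ℕ) extends ToricConstellation r where
  m : Fin r → ℤ
  m_pos : ∀ j, 0 < m j

namespace ToricCluster

open ToricConstellation

variable {r : ℕ}

/-- `M_{Q_i}(a,b) := Σ_{t ≥ 0, Q_i(a,b^t) ∈ C} m_{Q_i(a,b^t)}`. -/
def M (A : ToricCluster r) (i : Fin r) (a b : Fin 3) : ℤ :=
  ∑ j ∈ univ.filter (fun j => inChain A.toToricConstellation i a b j = true), A.m j

/-- The cluster is idealistic: the linear proximity inequalities
`M_{Q_i}(a,b) + M_{Q_i}(b,a) ≤ m_{Q_i}` hold. -/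
def Idealistic (A : ToricCluster r) : Prop :=
  ∀ i : Fin r, ∀ a b : Fin 3, a ≠ b → A.M i a b + A.M i b a ≤ A.m i

/-- The set of nodes `j` proximate to `i` (`j → i`). -/
def proxSet (A : ToricCluster r) (i : Fin r) : Finset (Fin r) :=
  univ.filter (fun j => Prox A.toToricConstellation j i)

/-- `B_i`: the set of nodes to which `i` is proximate. -/
def Bset (A : ToricCluster r) (i : Fin r) : Finset (Fin r) :=
  univ.filter (fun j => Prox A.toToricConstellation i j)

/-- `A_i`: the children `k` of `i` for which there is no `l` with `i → l` and `k → l`. -/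
def Aset (A : ToricCluster r) (i : Fin r) : Finset (Fin r) :=
  univ.filter (fun k => IsChild A.toToricConstellation k i ∧
    ¬ ∃ l, Prox A.toToricConstellation i l ∧ Prox A.toToricConstellation k l)

/-- The Euler characteristic `χ_i = χ(E_i°)`. -/
def chi (A : ToricCluster r) (i : Fin r) : ℤ :=
  3 + A.m i * (A.m i - 3)
    - ∑ j ∈ A.proxSet i, A.m j * (A.m j - 1)
    + ∑ j ∈ A.proxSet i,
        (A.m j - ∑ k ∈ (A.proxSet i).filter
          (fun k => LinProx A.toToricConstellation k j), A.m k)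
    + ∑ j ∈ A.Bset i,
        (A.m i - ∑ k ∈ (A.proxSet j).filter
          (fun k => LinProx A.toToricConstellation k i), A.m k)
    - ((A.Aset i).card : ℤ) - 2 * ((A.Bset i).card : ℤ)
    + (((A.Bset i).card.choose 2 : ℕ) : ℤ)

/-- `D_i = m_i² − Σ_{j→i} m_j²`. -/
def D (A : ToricCluster r) (i : Fin r) : ℤ :=
  A.m i ^ 2 - ∑ j ∈ A.proxSet i, A.m j ^ 2

/-- `r_{ab} = m_i − M_{Q_i}(a,b) − M_{Q_i}(b,a)`. -/
def rab (A : ToricCluster r) (i : Fin r) (a b : Fin 3) : ℤ :=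
  A.m i - A.M i a b - A.M i b a

/-- `R_i = r̂_{12} + r̂_{13} + r̂_{23}`, where `r̂_{ab} = r_{ab}` if the remaining third
label does not appear under `Q_i`, and `r̂_{ab} = 0` otherwise.  (Labels `1,2,3` are
encoded as `0,1,2 : Fin 3`.) -/
def R (A : ToricCluster r) (i : Fin r) : ℤ :=
  (if (2 : Fin 3) ∉ labelsUnder A.toToricConstellation i then A.rab i 0 1 else 0)
  + (if (1 : Fin 3) ∉ labelsUnder A.toToricConstellation i then A.rab i 0 2 else 0)
  + (if (0 : Fin 3) ∉ labelsUnder A.toToricConstellation i then A.rab i 1 2 else 0)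

/-- `T_i = 3 − #A_i − 2·#B_i + (#B_i choose 2)`. -/
def T (A : ToricCluster r) (i : Fin r) : ℤ :=
  3 - ((A.Aset i).card : ℤ) - 2 * ((A.Bset i).card : ℤ)
    + (((A.Bset i).card.choose 2 : ℕ) : ℤ)

/-- The nodes to which `i` is proximate, of smaller index: the sums in the recursive
definitions of the numerical data range over the nodes to which `i` is proximate,
which are ancestors of `i` and hence have smaller index (making the recursion
well-founded). -/
def anteSet (A : ToricCluster r) (i : Fin r) : Finset (Fin r) :=
  univ.filter (fun j => (j : ℕ) < (i : ℕ) ∧ Prox A.toToricConstellation i j)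

/-- The numerical datum `N_i := m_i + Σ_{j : i→j} N_j`. -/
def N (A : ToricCluster r) (i : Fin r) : ℤ :=
  A.m i + ∑ j ∈ (A.anteSet i).attach, N A j.1
termination_by (i : ℕ)
decreasing_by
  have hj := j.2
  simp only [anteSet, Finset.mem_filter] at hj
  exact hj.2.1

/-- The numerical datum `ν_i := 3 + Σ_{j : i→j} (ν_j − 1)`. -/
def nu (A : ToricCluster r) (i : Fin r) : ℤ :=
  3 + ∑ j ∈ (A.anteSet i).attach, (nu A j.1 - 1)
termination_by (i : ℕ)
decreasing_by
  have hj := j.2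
  simp only [anteSet, Finset.mem_filter] at hj
  exact hj.2.1

end ToricCluster

namespace ToricCluster

open ToricConstellation

variable {r : ℕ}

/-- `χ_{0,i}`. -/
def chi0 (A : ToricCluster r) (i : Fin r) : ℤ :=
  A.m i * (3 - A.m i) + ∑ j ∈ A.proxSet i, A.m j * (A.m j - 1)
    - ∑ j ∈ A.proxSet i,
        (A.m j - ∑ k ∈ (A.proxSet i).filter
          (fun k => LinProx A.toToricConstellation k j), A.m k)
    - ∑ j ∈ A.Bset i,
        (A.m i - ∑ k ∈ (A.proxSet j).filter
          (fun k => LinProx A.toToricConstellation k i), A.m k)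

/-- `χ_{0,i,j} = m_j − Σ_{k: k→i, k↠j} m_k`, for `j → i`. -/
def chi0pair (A : ToricCluster r) (i j : Fin r) : ℤ :=
  A.m j - ∑ k ∈ (A.proxSet i).filter (fun k => LinProx A.toToricConstellation k j), A.m k

/-- `A_{ij}`: the children `k` of `j` with `k → i`. -/
def Apair (A : ToricCluster r) (i j : Fin r) : Finset (Fin r) :=
  univ.filter (fun k => IsChild A.toToricConstellation k j ∧ Prox A.toToricConstellation k i)

/-- `B_{ij} = {k ≠ i : j → k}`. -/
def Bpair (A : ToricCluster r) (i j : Fin r) : Finset (Fin r) :=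
  univ.filter (fun k => k ≠ i ∧ Prox A.toToricConstellation j k)

/-- `C_{ij}`: children `k` of `j` with `k → i` such that there is `l ≠ i` with
`k → l` and `j → l`. -/
def Cpair (A : ToricCluster r) (i j : Fin r) : Finset (Fin r) :=
  univ.filter (fun k => IsChild A.toToricConstellation k j ∧ Prox A.toToricConstellation k i ∧
    ∃ l, l ≠ i ∧ Prox A.toToricConstellation k l ∧ Prox A.toToricConstellation j l)

/-- `χ_{i,j}`, for `j → i`. -/
def chipair (A : ToricCluster r) (i j : Fin r) : ℤ :=
  2 - A.chi0pair i j - ((A.Apair i j).card : ℤ) - ((A.Bpair i j).card : ℤ)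
    + ((A.Cpair i j).card : ℤ)

/-- `χ_{i,j,k} = 1 − #{l : l→i, l→j, l→k}`, for `i < j < k`, `k → i`, `k → j`. -/
def chitriple (A : ToricCluster r) (i j k : Fin r) : ℤ :=
  1 - ((univ.filter (fun l => Prox A.toToricConstellation l i ∧
        Prox A.toToricConstellation l j ∧ Prox A.toToricConstellation l k)).card : ℤ)

/-- The linear factor `N_i·s + ν_i`, as a rational function in `s`. -/
noncomputable def lin (A : ToricCluster r) (i : Fin r) : RatFunc ℚ :=
  (A.N i : RatFunc ℚ) * RatFunc.X + (A.nu i : RatFunc ℚ)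

/-- The local topological zeta function of the cluster, as a rational function over `ℚ`:
`Z(s) = Σ_i [χ_i/(N_i s+ν_i) + χ_{0,i}/((s+1)(N_i s+ν_i))]
  + Σ_{j→i} [χ_{i,j}/((N_i s+ν_i)(N_j s+ν_j)) + χ_{0,i,j}/((s+1)(N_i s+ν_i)(N_j s+ν_j))]
  + Σ_{i<j<k, k→i, k→j} χ_{i,j,k}/((N_i s+ν_i)(N_j s+ν_j)(N_k s+ν_k))`. -/
noncomputable def Zeta (A : ToricCluster r) : RatFunc ℚ :=
  (∑ i : Fin r,
      ((A.chi i : RatFunc ℚ) / A.lin i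
        + (A.chi0 i : RatFunc ℚ) / ((RatFunc.X + 1) * A.lin i)))
  + (∑ p ∈ (univ ×ˢ univ).filter
        (fun p : Fin r × Fin r => Prox A.toToricConstellation p.2 p.1),
      ((A.chipair p.1 p.2 : RatFunc ℚ) / (A.lin p.1 * A.lin p.2)
        + (A.chi0pair p.1 p.2 : RatFunc ℚ) / ((RatFunc.X + 1) * (A.lin p.1 * A.lin p.2))))
  + (∑ t ∈ (univ : Finset (Fin r × Fin r × Fin r)).filter
        (fun t => t.1 < t.2.1 ∧ t.2.1 < t.2.2 ∧ Prox A.toToricConstellation t.2.2 t.1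
          ∧ Prox A.toToricConstellation t.2.2 t.2.1),
      (A.chitriple t.1 t.2.1 t.2.2 : RatFunc ℚ) / (A.lin t.1 * A.lin t.2.1 * A.lin t.2.2))

/-- The rational function `Z^{(r)}(s)` (here the positive integer is called `d`):
the same sum as `Z(s)`, keeping only the terms not containing the factor `(s+1)` and in
which every occurring index `i` satisfies `d ∣ N_i`. -/
noncomputable def ZetaR (A : ToricCluster r) (d : ℕ) : RatFunc ℚ :=
  (∑ i ∈ univ.filter (fun i : Fin r => (d : ℤ) ∣ A.N i),
      (A.chi i : RatFunc ℚ) / A.lin i)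
  + (∑ p ∈ (univ ×ˢ univ).filter
        (fun p : Fin r × Fin r => Prox A.toToricConstellation p.2 p.1
          ∧ (d : ℤ) ∣ A.N p.1 ∧ (d : ℤ) ∣ A.N p.2),
      (A.chipair p.1 p.2 : RatFunc ℚ) / (A.lin p.1 * A.lin p.2))
  + (∑ t ∈ (univ : Finset (Fin r × Fin r × Fin r)).filter
        (fun t => t.1 < t.2.1 ∧ t.2.1 < t.2.2 ∧ Prox A.toToricConstellation t.2.2 t.1
          ∧ Prox A.toToricConstellation t.2.2 t.2.1
          ∧ (d : ℤ) ∣ A.N t.1 ∧ (d : ℤ) ∣ A.N t.2.1 ∧ (d : ℤ) ∣ A.N t.2.2),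
      (A.chitriple t.1 t.2.1 t.2.2 : RatFunc ℚ) / (A.lin t.1 * A.lin t.2.1 * A.lin t.2.2))

end ToricCluster

/-! ### Binary trees: the part of a tree lying over one corner of a triangle -/

/-- A weighted binary tree. -/
inductive BT where
  | nil : BT
  | node (w : ℤ) (l r : BT) : BT

namespace BT

/-- Total weight along the leftmost path. -/
def left : BT → ℤ
  | nil => 0
  | node w l _ => w + left l

/-- Total weight along the rightmost path. -/
def right : BT → ℤ
  | nil => 0
  | node w _ r => w + right r

/-- Sum of the squared weights. -/
def sq : BT → ℤ
  | nil => 0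
  | node w l r => w ^ 2 + sq l + sq r

/-- Positive weights and the linear proximity inequality at every node. -/
def Ok : BT → Prop
  | nil => True
  | node w l r => 0 < w ∧ right l + left r ≤ w ∧ Ok l ∧ Ok r

/-- Exchange left and right. -/
def flip : BT → BT
  | nil => nil
  | node w l r => node w (flip r) (flip l)

@[simp] theorem left_nil : left nil = 0 := rfl
@[simp] theorem right_nil : right nil = 0 := rfl
@[simp] theorem sq_nil : sq nil = 0 := rfl
@[simp] theorem left_node (w : ℤ) (l r : BT) : left (node w l r) = w + left l := rfl
@[simp] theorem right_node (w : ℤ) (l r : BT) : right (node w l r) = w + right r := rfl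
@[simp] theorem sq_node (w : ℤ) (l r : BT) : sq (node w l r) = w ^ 2 + sq l + sq r := rfl

theorem left_nonneg : ∀ {T : BT}, T.Ok → 0 ≤ T.left
  | nil, _ => le_rfl
  | node w l r, h => by
      have := left_nonneg h.2.2.1
      have := h.1
      simp only [left_node]; omega

theorem right_nonneg : ∀ {T : BT}, T.Ok → 0 ≤ T.right
  | nil, _ => le_rfl
  | node w l r, h => by
      have := right_nonneg h.2.2.2
      have := h.1
      simp only [right_node]; omega

theorem eq_nil_of_left {T : BT} (h : T.Ok) (h0 : T.left ≤ 0) : T = nil := by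
  cases T with
  | nil => rfl
  | node w l r =>
      have := left_nonneg h.2.2.1
      have := h.1
      simp only [left_node] at h0; omega

theorem eq_nil_of_right {T : BT} (h : T.Ok) (h0 : T.right ≤ 0) : T = nil := by
  cases T with
  | nil => rfl
  | node w l r =>
      have := right_nonneg h.2.2.2
      have := h.1
      simp only [right_node] at h0; omega

theorem sq_le : ∀ {T : BT}, T.Ok → T.sq ≤ T.left * T.right
  | nil, _ => le_rfl
  | node w l r, h => by
      have h1 := sq_le h.2.2.1
      have h2 := sq_le h.2.2.2
      have a1 := left_nonneg h.2.2.1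
      have a2 := right_nonneg h.2.2.1
      have a3 := left_nonneg h.2.2.2
      have a4 := right_nonneg h.2.2.2
      have h3 := h.1
      have h4 := h.2.1
      simp only [left_node, right_node, sq_node]
      nlinarith [mul_nonneg a1 (by omega : 0 ≤ w - l.right),
        mul_nonneg a4 (by omega : 0 ≤ w - r.left), mul_nonneg a1 a4]

/-- Trees whose squared weights fill the whole right triangle. -/
theorem full_cases {w : ℤ} {l r : BT} (h : (node w l r).Ok)
    (hf : (node w l r).sq = (node w l r).left * (node w l r).right) :
    (l = nil ∧ r = nil) ∨ (r = nil ∧ l.right = w ∧ l.sq = l.left * l.right) ∨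
      (l = nil ∧ r.left = w ∧ r.sq = r.left * r.right) := by
  have h1 := sq_le h.2.2.1
  have h2 := sq_le h.2.2.2
  have a1 := left_nonneg h.2.2.1
  have a2 := right_nonneg h.2.2.1
  have a3 := left_nonneg h.2.2.2
  have a4 := right_nonneg h.2.2.2
  have h3 := h.1
  have h4 := h.2.1
  simp only [left_node, right_node, sq_node] at hf
  have b1 := mul_nonneg a1 (by omega : 0 ≤ w - l.right)
  have b2 := mul_nonneg a4 (by omega : 0 ≤ w - r.left)
  have b3 := mul_nonneg a1 a4
  have c1 : l.left * (w - l.right) = 0 := by nlinarith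
  have c2 : r.right * (w - r.left) = 0 := by nlinarith
  have c3 : l.left * r.right = 0 := by nlinarith
  have c4 : l.sq = l.left * l.right := by nlinarith
  have c5 : r.sq = r.left * r.right := by nlinarith
  by_cases hl : l.left = 0
  · have hl' := eq_nil_of_left h.2.2.1 hl.le
    by_cases hr : r.right = 0
    · exact Or.inl ⟨hl', eq_nil_of_right h.2.2.2 hr.le⟩
    · refine Or.inr (Or.inr ⟨hl', ?_, c5⟩)
      rcases mul_eq_zero.1 c2 with e | e <;> omega
  · have hr : r.right = 0 := by
      rcases mul_eq_zero.1 c3 with e | e <;> omega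
    refine Or.inr (Or.inl ⟨eq_nil_of_right h.2.2.2 hr.le, ?_, c4⟩)
    rcases mul_eq_zero.1 c1 with e | e <;> omega

/-- A chain of `n` nodes of weight one, each the right child of the preceding one. -/
def chainR : ℕ → BT
  | 0 => nil
  | n + 1 => node 1 nil (chainR n)

/-- A chain of `n` nodes of weight one, each the left child of the preceding one. -/
def chainL : ℕ → BT
  | 0 => nil
  | n + 1 => node 1 (chainL n) nil

theorem flip_flip : ∀ T : BT, T.flip.flip = T
  | nil => rfl
  | node w l r => by simp only [flip, flip_flip l, flip_flip r]

theorem left_flip : ∀ T : BT, T.flip.left = T.right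
  | nil => rfl
  | node w l r => by simp only [flip, left_node, right_node, left_flip r]

theorem right_flip : ∀ T : BT, T.flip.right = T.left
  | nil => rfl
  | node w l r => by simp only [flip, left_node, right_node, right_flip l]

theorem sq_flip : ∀ T : BT, T.flip.sq = T.sq
  | nil => rfl
  | node w l r => by simp only [flip, sq_node, sq_flip l, sq_flip r]; ring

theorem Ok.flip : ∀ {T : BT}, T.Ok → T.flip.Ok
  | nil, _ => trivial
  | node w l r, h => by
      refine ⟨h.1, ?_, h.2.2.2.flip, h.2.2.1.flip⟩
      rw [left_flip, right_flip]; linarith [h.2.1]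

theorem flip_chainR : ∀ n, (chainR n).flip = chainL n
  | 0 => rfl
  | n + 1 => by simp only [chainR, chainL, flip, flip_chainR n]

theorem flip_chainL (n : ℕ) : (chainL n).flip = chainR n := by
  rw [← flip_chainR, flip_flip]

theorem right_chainR : ∀ n, (chainR n).right = n
  | 0 => rfl
  | n + 1 => by simp only [chainR, right_node, right_chainR n]; push_cast; ring

theorem left_chainR_succ (n : ℕ) : (chainR (n + 1)).left = 1 := rfl

theorem left_chainL (n : ℕ) : (chainL n).left = n := by
  rw [← flip_chainR, left_flip, right_chainR]

theorem right_chainL_succ (n : ℕ) : (chainL (n + 1)).right = 1 := rfl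

theorem eq_chainR : ∀ {T : BT}, T.Ok → T.left = 1 → T.sq = T.right →
    ∃ n : ℕ, T = chainR (n + 1)
  | nil, _, h, _ => by simp at h
  | node w l r, h, h1, h2 => by
      have hf : (node w l r).sq = (node w l r).left * (node w l r).right := by
        rw [h1, one_mul, h2]
      have hw := h.1
      have hl0 := left_nonneg h.2.2.1
      simp only [left_node] at h1
      have hl := eq_nil_of_left h.2.2.1 (by omega)
      obtain rfl : w = 1 := by omega
      subst hl
      rcases full_cases h hf with ⟨_, e⟩ | ⟨e, _⟩ | ⟨_, e1, e2⟩
      · exact ⟨0, by rw [e]; rfl⟩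
      · exact ⟨0, by rw [e]; rfl⟩
      · obtain ⟨n, hn⟩ := eq_chainR h.2.2.2 e1 (by rw [e2, e1, one_mul])
        exact ⟨n + 1, by rw [hn]; rfl⟩

theorem eq_chainL {T : BT} (h : T.Ok) (h1 : T.right = 1) (h2 : T.sq = T.left) :
    ∃ n : ℕ, T = chainL (n + 1) := by
  obtain ⟨n, hn⟩ := eq_chainR h.flip (by rw [left_flip, h1]) (by rw [sq_flip, right_flip, h2])
  exact ⟨n, by rw [← flip_chainR, ← hn, flip_flip]⟩

/-- Intercepts `(m, m)`: either one node of weight `m` or a definite loss. -/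
theorem sq_diag {T : BT} (h : T.Ok) {m : ℤ} (hm : 0 < m) (hl : T.left = m) (hr : T.right = m) :
    T = node m nil nil ∨ T.sq ≤ m ^ 2 - m := by
  cases T with
  | nil => simp at hl; omega
  | node w l r =>
      have h1 := sq_le h.2.2.1
      have h2 := sq_le h.2.2.2
      have a1 := left_nonneg h.2.2.1
      have a4 := right_nonneg h.2.2.2
      have h3 := h.1
      have h4 := h.2.1
      simp only [left_node, right_node, sq_node] at hl hr ⊢
      obtain ⟨e1, e2⟩ : l.left = m - w ∧ r.right = m - w := by omega
      by_cases hw : w = m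
      · left
        rw [eq_nil_of_left h.2.2.1 (by omega), eq_nil_of_right h.2.2.2 (by omega), hw]
      · right
        rw [e1] at h1 a1
        rw [e2] at h2
        have : 1 ≤ m - w := by omega
        nlinarith [mul_nonneg a1 (by omega : 0 ≤ w - l.right - r.left)]

/-- Intercepts `(m, m)` with the smallest possible loss. -/
theorem sq_diag_eq {T : BT} (h : T.Ok) {m : ℤ} (hm : 0 < m) (hl : T.left = m) (hr : T.right = m)
    (hs : T.sq = m ^ 2 - m) :
    ∃ p q : ℕ, m = p + q + 3 ∧ T = node (m - 1) (chainR (p + 1)) (chainL (q + 1)) := by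
  cases T with
  | nil => simp at hl; omega
  | node w l r =>
      have h1 := sq_le h.2.2.1
      have h2 := sq_le h.2.2.2
      have a1 := left_nonneg h.2.2.1
      have a4 := right_nonneg h.2.2.2
      have h3 := h.1
      have h4 := h.2.1
      simp only [left_node, right_node, sq_node] at hl hr hs ⊢
      obtain ⟨e1, e2⟩ : l.left = m - w ∧ r.right = m - w := by omega
      have hw : w ≠ m := by
        rintro rfl
        rw [eq_nil_of_left h.2.2.1 (by omega), eq_nil_of_right h.2.2.2 (by omega)] at hs
        simp at hs; omega
      rw [e1] at h1 a1
      rw [e2] at h2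
      have b : 1 ≤ m - w := by omega
      have b0 := mul_nonneg a1 (by omega : 0 ≤ w - l.right - r.left)
      have b1 : (m - w - 1) * m ≤ 0 := by nlinarith
      have b2 : m - w = 1 := by
        by_contra hne
        have : 0 < (m - w - 1) * m := mul_pos (by omega) hm
        omega
      obtain rfl : w = m - 1 := by omega
      rw [b2] at h1 h2 e1 e2 b0
      obtain ⟨p, hp⟩ := eq_chainR h.2.2.1 e1 (by nlinarith)
      obtain ⟨q, hq⟩ := eq_chainL h.2.2.2 e2 (by nlinarith)
      have hp' : l.right = p + 1 := by rw [hp, right_chainR]; push_cast; ring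
      have hq' : r.left = q + 1 := by rw [hq, left_chainL]; push_cast; ring
      refine ⟨p, q, ?_, by rw [hp, hq]⟩
      nlinarith

/-- Full trees with intercepts `(m, m - 1)`. -/
theorem eq_of_full_succ {T : BT} (h : T.Ok) {m : ℤ} (hm : 0 < m) (hl : T.left = m)
    (hr : T.right = m - 1) (hs : T.sq = m * (m - 1)) :
    ∃ p : ℕ, m = p + 2 ∧ T = node (m - 1) (chainR (p + 1)) nil := by
  cases T with
  | nil => simp at hl; omega
  | node w l r =>
      have hf : (node w l r).sq = (node w l r).left * (node w l r).right := by rw [hl, hr, hs]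
      simp only [left_node, right_node] at hl hr
      have hw := h.1
      rcases full_cases h hf with ⟨e1, e2⟩ | ⟨e, e1, e2⟩ | ⟨e, e1, e2⟩
      · subst e1 e2; simp at hl hr; omega
      · subst e
        simp only [right_nil] at hr
        obtain rfl : w = m - 1 := by omega
        obtain ⟨n, rfl⟩ := eq_chainR h.2.2.1 (by omega)
          (by rw [e2]; rw [show l.left = 1 by omega, one_mul])
        rw [right_chainR] at e1
        push_cast at e1
        exact ⟨n, by omega, rfl⟩
      · subst e
        have := right_nonneg h.2.2.2
        simp at hl; omega

end BT

namespace BT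

variable {F : Type} [Field F]

/-- The residue at a corner: the zeta function of a binary tree, with `y`, `z` the linear
factors attached to the two sides. -/
def res (s : F) : BT → F → F → F
  | nil, y, z => 1 / (y * z)
  | node w l r, y, z =>
      -(s / (s + 1)) * ((w - right l - left r : ℤ) : F) / (y + z + w * s)
        + res s l (y + z + w * s) z + res s r y (y + z + w * s)

/-- All linear factors occurring in `res` are nonzero. -/
def NZ (s : F) : BT → F → F → Prop
  | nil, y, z => y ≠ 0 ∧ z ≠ 0
  | node w l r, y, z => y + z + w * s ≠ 0 ∧ NZ s l (y + z + w * s) z ∧ NZ s r y (y + z + w * s)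

theorem NZ.left_ne {s : F} : ∀ {T : BT} {y z : F}, T.NZ s y z → y ≠ 0
  | nil, _, _, h => h.1
  | node _ _ _, _, _, h => h.2.2.left_ne

theorem NZ.right_ne {s : F} : ∀ {T : BT} {y z : F}, T.NZ s y z → z ≠ 0
  | nil, _, _, h => h.2
  | node _ _ _, _, _, h => h.2.1.right_ne

theorem res_flip (s : F) : ∀ (T : BT) (y z : F), T.flip.res s z y = T.res s y z
  | nil, y, z => by simp only [flip, res, mul_comm]
  | node w l r, y, z => by
      simp only [flip, res, right_flip, left_flip]
      rw [add_comm z y, res_flip s l, res_flip s r]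
      rw [show (w - r.left - l.right : ℤ) = w - l.right - r.left by ring]
      ring

theorem NZ.flip {s : F} : ∀ {T : BT} {y z : F}, T.NZ s y z → T.flip.NZ s z y
  | nil, _, _, h => ⟨h.2, h.1⟩
  | node w l r, y, z, h => by
      simp only [BT.flip, NZ, add_comm z y]
      exact ⟨h.1, h.2.2.flip, h.2.1.flip⟩

/-- The residue of a tree filling its whole corner. -/
theorem res_full (s : F) : ∀ (T : BT) (y z : F), T.Ok → T.sq = T.left * T.right → T.NZ s y z →
    ((T.right : F) * y + T.left * z + T.left * T.right * s) * T.res s y z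
      = T.right / z + T.left / y - s / (s + 1) * ((Int.gcd T.left T.right : ℕ) : F) ^ 2
  | nil, y, z, _, _, _ => by simp
  | node w l r, y, z, h, hf, hn => by
      have hy := hn.left_ne
      have hz := hn.right_ne
      have hL := hn.1
      have hw := h.1
      have hgw : ((Int.gcd w w : ℕ) : F) ^ 2 = (w : F) ^ 2 := by
        have e : ((Int.gcd w w : ℕ) : ℤ) = w := by
          rw [Int.gcd_self]; omega
        rw [← Int.cast_natCast, e]
      rcases full_cases h hf with ⟨rfl, rfl⟩ | ⟨rfl, e1, e2⟩ | ⟨rfl, e1, e2⟩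
      · simp only [left_node, right_node, left_nil, right_nil, add_zero, res, hgw, sub_zero]
        generalize s / (s + 1) = σ
        field_simp
        ring
      · have ih := res_full s l _ z h.2.2.1 e2 hn.2.1
        have hg : Int.gcd (w + l.left) w = Int.gcd l.left w := by
          rw [add_comm]; simp
        have hres : (node w l nil).res s y z =
            l.res s (y + z + w * s) z + 1 / (y * (y + z + w * s)) := by
          conv_lhs => rw [res]
          rw [e1]; simp [res]
        rw [hres, right_node, right_nil, add_zero, left_node, hg]
        rw [e1] at ih
        generalize l.res s (y + z + w * s) z = R at ih ⊢
        generalize l.left = P at ih ⊢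
        generalize s / (s + 1) * ((Int.gcd P w : ℕ) : F) ^ 2 = G at ih ⊢
        push_cast
        have e : ((w : F) * y + (w + P) * z + (w + P) * w * s) =
          (w : F) * (y + z + w * s) + P * z + P * w * s := by ring
        rw [e, mul_add, ih]
        field_simp
        ring
      · have ih := res_full s r y _ h.2.2.2 e2 hn.2.2
        have hg : Int.gcd w (w + r.right) = Int.gcd w r.right := by
          rw [add_comm]; simp
        have hres : (node w nil r).res s y z =
            r.res s y (y + z + w * s) + 1 / ((y + z + w * s) * z) := by
          conv_lhs => rw [res]
          rw [e1]; simp [res]; ring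
        rw [hres, right_node, left_node, left_nil, add_zero, hg]
        rw [e1] at ih
        generalize r.res s y (y + z + w * s) = R at ih ⊢
        generalize r.right = P at ih ⊢
        generalize s / (s + 1) * ((Int.gcd w P : ℕ) : F) ^ 2 = G at ih ⊢
        push_cast
        have e : (((w : F) + P) * y + w * z + w * (w + P) * s) =
          P * y + w * (y + z + w * s) + w * P * s := by ring
        rw [e, mul_add, ih]
        field_simp
        ring

/-- The residue of a chain of nodes of weight one. -/
theorem res_chainR (s : F) (hs : s + 1 ≠ 0) : ∀ (n : ℕ) (y z : F), y + s = -1 →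
    (chainR (n + 1)).NZ s y z → (chainR (n + 1)).res s y z = -1 / z
  | 0, y, z, hy, h => by
      have h1 := h.1
      have hy0 := h.left_ne
      have hz := h.right_ne
      simp only [chainR, res, left_nil, right_nil] at h1 ⊢
      obtain rfl : y = -(s + 1) := by linear_combination hy
      have e : -(s + 1) + z + ((1 : ℤ) : F) * s = z - 1 := by push_cast; ring
      rw [e] at h1 ⊢
      push_cast
      have : -1 - s ≠ 0 := by intro h; apply hs; linear_combination -h
      field_simp
      ring
  | n + 1, y, z, hy, h => by
      have h1 := h.1
      have hz := h.right_ne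
      have e : y + z + ((1 : ℤ) : F) * s = z - 1 := by push_cast; linear_combination hy
      have ih := res_chainR s hs n y _ hy h.2.2
      rw [chainR, res, ih]
      rw [e] at h1 ⊢
      rw [left_chainR_succ]
      simp only [res, right_nil]
      push_cast
      field_simp
      ring

theorem res_chainL (s : F) (hs : s + 1 ≠ 0) (n : ℕ) (y z : F) (hz : z + s = -1)
    (h : (chainL (n + 1)).NZ s y z) : (chainL (n + 1)).res s y z = -1 / y := by
  rw [← flip_chainR, res_flip]
  have := h.flip
  rw [flip_chainL] at this
  exact res_chainR s hs n z y hz this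

/-- The residue of a chain of nodes of weight one along a side with linear factor `1`. -/
theorem res_chainR_one (s : F) (hs : s + 1 ≠ 0) : ∀ (n : ℕ) (y : F),
    (chainR (n + 1)).NZ s 1 y → (chainR (n + 1)).res s 1 y = 1 / (y * (s + 1))
  | 0, y, h => by
      have h1 := h.1
      have hy := h.right_ne
      simp only [chainR, res, left_nil, right_nil] at h1 ⊢
      have e : 1 + y + ((1 : ℤ) : F) * s = y + (s + 1) := by push_cast; ring
      rw [e] at h1 ⊢
      push_cast
      field_simp
      ring
  | n + 1, y, h => by
      have h1 := h.1
      have hy := h.right_ne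
      have e : 1 + y + ((1 : ℤ) : F) * s = y + (s + 1) := by push_cast; ring
      have ih := res_chainR_one s hs n _ h.2.2
      rw [chainR, res, ih]
      rw [e] at h1 ⊢
      rw [left_chainR_succ]
      simp only [res, right_nil]
      push_cast
      field_simp
      ring

end BT

/-! ### Weighted ternary trees -/

/-- Three distinct labels. -/
def Tri (a b c : Fin 3) : Prop := a ≠ b ∧ a ≠ c ∧ b ≠ c

namespace Tri

variable {a b c : Fin 3}

theorem swap (t : Tri a b c) : Tri b a c := ⟨t.1.symm, t.2.2, t.2.1⟩
theorem rot (t : Tri a b c) : Tri b c a := ⟨t.2.2, t.1.symm, t.2.1.symm⟩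

theorem sum {M : Type*} [AddCommMonoid M] (t : Tri a b c) (f : Fin 3 → M) :
    ∑ i, f i = f a + f b + f c := by
  have h : (univ : Finset (Fin 3)) = {a, b, c} := by
    revert t; unfold Tri; revert a b c; decide
  rw [h, sum_insert (by simp [t.1, t.2.1]), sum_insert (by simp [t.2.2]), sum_singleton, add_assoc]

theorem prod {M : Type*} [CommMonoid M] (t : Tri a b c) (f : Fin 3 → M) :
    ∏ i, f i = f a * f b * f c := t.sum (M := Additive M) f

theorem eq_or (t : Tri a b c) (x : Fin 3) : x = a ∨ x = b ∨ x = c := by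
  revert t; unfold Tri; revert a b c x; decide

theorem base (a : Fin 3) : Tri a (a + 1) (a + 2) := by
  unfold Tri; revert a; decide

theorem shift (t : Tri a b c) : (b = a + 1 ∧ c = a + 2) ∨ (b = a + 2 ∧ c = a + 1) := by
  revert t; unfold Tri; revert a b c; decide

end Tri

/-- A weighted ternary tree. -/
inductive Tr where
  | nil : Tr
  | node (m : ℤ) (ch : Fin 3 → Tr) : Tr

namespace Tr

/-- Total weight of the path along label `b`, starting at the root. -/
def ln (b : Fin 3) : Tr → ℤ
  | nil => 0
  | node m ch => m + ln b (ch b)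

/-- Sum of the squared weights of the nodes reached without using the label `a`. -/
def sqa (a : Fin 3) : Tr → ℤ
  | nil => 0
  | node m ch => m ^ 2 + ∑ b, if b = a then 0 else sqa a (ch b)

/-- Positive weights and the linear proximity inequalities at every node. -/
def Ok : Tr → Prop
  | nil => True
  | node m ch => 0 < m ∧ (∀ a b, a ≠ b → ln b (ch a) + ln a (ch b) ≤ m) ∧ ∀ a, Ok (ch a)

/-- The binary tree of the nodes reached using only the labels `y`, `z`. -/
def bin (y z : Fin 3) : Tr → BT
  | nil => .nil
  | node m ch => .node m (bin y z (ch y)) (bin y z (ch z))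

/-- Self-intersection number of a node. -/
def dd (m : ℤ) (ch : Fin 3 → Tr) : ℤ := m ^ 2 - ∑ a, sqa a (ch a)

/-- Slack in the linear proximity inequality for the two labels different from `a`. -/
def gap (m : ℤ) (ch : Fin 3 → Tr) (a : Fin 3) : ℤ :=
  m - ln (a + 2) (ch (a + 1)) - ln (a + 1) (ch (a + 2))

variable {a b c : Fin 3} {m : ℤ} {ch : Fin 3 → Tr}

theorem gap_eq (t : Tri a b c) : gap m ch a = m - ln c (ch b) - ln b (ch c) := by
  rcases t.shift with ⟨rfl, rfl⟩ | ⟨rfl, rfl⟩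
  · rfl
  · unfold gap; ring

theorem left_bin (y z : Fin 3) : ∀ T : Tr, (bin y z T).left = ln y T
  | nil => rfl
  | node m ch => by simp only [bin, BT.left, ln, left_bin y z (ch y)]

theorem right_bin (y z : Fin 3) : ∀ T : Tr, (bin y z T).right = ln z T
  | nil => rfl
  | node m ch => by simp only [bin, BT.right, ln, right_bin y z (ch z)]

theorem flip_bin (y z : Fin 3) : ∀ T : Tr, (bin y z T).flip = bin z y T
  | nil => rfl
  | node m ch => by simp only [bin, BT.flip, flip_bin y z (ch y), flip_bin y z (ch z)]

theorem sq_bin (t : Tri a b c) : ∀ T : Tr, (bin b c T).sq = sqa a T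
  | nil => rfl
  | node m ch => by
      simp only [bin, BT.sq, sqa, t.sum, if_pos, if_neg t.1.symm, if_neg t.2.1.symm,
        sq_bin t (ch b), sq_bin t (ch c)]
      ring

theorem Ok.bin {y z : Fin 3} (h : y ≠ z) : ∀ {T : Tr}, T.Ok → (bin y z T).Ok
  | nil, _ => trivial
  | node m ch, hT => by
      refine ⟨hT.1, ?_, (hT.2.2 y).bin h, (hT.2.2 z).bin h⟩
      rw [right_bin, left_bin]
      exact hT.2.1 y z h

theorem bin_eq_nil {y z : Fin 3} {T : Tr} (h : bin y z T = .nil) : T = nil := by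
  cases T with
  | nil => rfl
  | node m ch => simp [Tr.bin] at h

theorem ln_nonneg (b : Fin 3) : ∀ {T : Tr}, T.Ok → 0 ≤ ln b T
  | nil, _ => le_rfl
  | node m ch, h => by
      have := ln_nonneg b (h.2.2 b)
      have := h.1
      simp only [ln]; omega

theorem eq_nil_of_ln {b : Fin 3} {T : Tr} (h : T.Ok) (h0 : ln b T ≤ 0) : T = nil := by
  cases T with
  | nil => rfl
  | node m ch =>
      have := ln_nonneg b (h.2.2 b)
      have := h.1
      simp only [ln] at h0; omega

theorem sqa_le (t : Tri a b c) {T : Tr} (h : T.Ok) : sqa a T ≤ ln b T * ln c T := by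
  have := BT.sq_le (h.bin t.2.2)
  rwa [sq_bin t, left_bin, right_bin] at this

theorem dd_eq (t : Tri a b c) :
    dd m ch = m ^ 2 - sqa a (ch a) - sqa b (ch b) - sqa c (ch c) := by
  rw [dd, t.sum]; ring

/-- The only child of the node is along `c`; it has the same weight and again only a child
along `c`. -/
def Leaf (m : ℤ) (ch : Fin 3 → Tr) (c : Fin 3) : Prop :=
  (∀ x, x ≠ c → ch x = nil) ∧ ∃ ch', ch c = node m ch' ∧ ∀ x, x ≠ c → ch' x = nil

/-- The children along `a` and `c` fill the triangle except for a corner at `b`. -/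
def Wedge (m : ℤ) (ch : Fin 3 → Tr) (a b c : Fin 3) : Prop :=
  Tri a b c ∧ ch b = nil ∧ ln b (ch a) = m ∧ ln b (ch c) = m ∧ ln c (ch a) + ln a (ch c) = m ∧
    0 < ln c (ch a) ∧ 0 < ln a (ch c) ∧
    sqa a (ch a) = ln b (ch a) * ln c (ch a) ∧ sqa c (ch c) = ln a (ch c) * ln b (ch c)

/-- The configurations with self-intersection equal to the gap along `ab`. -/
def Thin (m : ℤ) (ch : Fin 3 → Tr) (a b c : Fin 3) : Prop :=
  ch a = nil ∧
    ((m = 1 ∧ ch b = nil ∧ ch c = nil) ∨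
      (∃ p : ℕ, m = p + 2 ∧ bin a b (ch c) = .node (m - 1) (BT.chainR (p + 1)) .nil ∧
        (ch b = nil ∨ ∃ n, bin c a (ch b) = BT.chainR (n + 1))) ∨
      (∃ p q : ℕ, m = p + q + 3 ∧ ch b = nil ∧
        bin a b (ch c) = .node (m - 1) (BT.chainR (p + 1)) (BT.chainL (q + 1))))

theorem leaf_of_bin (t : Tri a b c) (h1 : ch a = nil) (h2 : ch b = nil)
    (h : bin a b (ch c) = .node m .nil .nil) : Leaf m ch c := by
  refine ⟨fun x hx => ?_, ?_⟩
  · rcases t.eq_or x with rfl | rfl | rfl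
    · exact h1
    · exact h2
    · exact absurd rfl hx
  · cases hc : ch c with
    | nil => rw [hc] at h; simp [Tr.bin] at h
    | node w ch' =>
      rw [hc] at h
      simp only [Tr.bin, BT.node.injEq] at h
      refine ⟨ch', by rw [h.1], fun x hx => ?_⟩
      rcases t.eq_or x with rfl | rfl | rfl
      · exact bin_eq_nil h.2.1
      · exact bin_eq_nil h.2.2
      · exact absurd rfl hx

/-- The self-intersection number as a sum of nonnegative terms. -/
theorem dd_expand (t : Tri a b c) : dd m ch =
    gap m ch c * (m - ln b (ch c)) + ln b (ch c) * (m - ln a (ch c))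
      + ln b (ch a) * (ln a (ch c) - ln b (ch c))
      + ln b (ch a) * (m - ln a (ch c) - ln c (ch a))
      + ln a (ch b) * (m - ln b (ch c) - ln c (ch b))
      + (ln b (ch a) * ln c (ch a) - sqa a (ch a)) + (ln c (ch b) * ln a (ch b) - sqa b (ch b))
      + (ln a (ch c) * ln b (ch c) - sqa c (ch c)) := by
  rw [dd_eq t, gap_eq t.rot.rot]; ring

/-- The inequalities between the six intercepts. -/
theorem bounds (h : (node m ch).Ok) (t : Tri a b c) :
    0 < m ∧ 0 ≤ ln b (ch a) ∧ 0 ≤ ln c (ch a) ∧ 0 ≤ ln a (ch b) ∧ 0 ≤ ln c (ch b) ∧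
    0 ≤ ln a (ch c) ∧ 0 ≤ ln b (ch c) ∧ ln b (ch a) + ln a (ch b) ≤ m ∧
    ln c (ch a) + ln a (ch c) ≤ m ∧ ln c (ch b) + ln b (ch c) ≤ m ∧
    sqa a (ch a) ≤ ln b (ch a) * ln c (ch a) ∧ sqa b (ch b) ≤ ln c (ch b) * ln a (ch b) ∧
    sqa c (ch c) ≤ ln a (ch c) * ln b (ch c) :=
  ⟨h.1, ln_nonneg _ (h.2.2 _), ln_nonneg _ (h.2.2 _), ln_nonneg _ (h.2.2 _), ln_nonneg _ (h.2.2 _),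
    ln_nonneg _ (h.2.2 _), ln_nonneg _ (h.2.2 _), h.2.1 _ _ t.1, h.2.1 _ _ t.2.1,
    h.2.1 _ _ t.2.2, sqa_le t (h.2.2 _), sqa_le t.rot (h.2.2 _), sqa_le t.rot.rot (h.2.2 _)⟩

theorem gap_nonneg (h : (node m ch).Ok) (a : Fin 3) : 0 ≤ gap m ch a := by
  have := h.2.1 (a + 1) (a + 2) (Tri.base a).2.2
  unfold gap; omega

theorem sqa_diag (h : (node m ch).Ok) (t : Tri a b c) (h1 : ln a (ch c) = m)
    (h2 : ln b (ch c) = m) :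
    ch a = nil ∧ ch b = nil ∧ (Leaf m ch c ∨ sqa c (ch c) ≤ m ^ 2 - m) := by
  obtain ⟨hm, -, -, -, -, -, -, -, k2, k3, -⟩ := bounds h t
  have ha : ch a = nil := eq_nil_of_ln (b := c) (h.2.2 a) (by omega)
  have hb : ch b = nil := eq_nil_of_ln (b := c) (h.2.2 b) (by omega)
  refine ⟨ha, hb, ?_⟩
  rcases BT.sq_diag ((h.2.2 c).bin t.1) hm (by rw [left_bin, h1]) (by rw [right_bin, h2]) with e | e
  · exact Or.inl (leaf_of_bin t ha hb e)
  · rw [sq_bin t.rot.rot] at e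
    exact Or.inr e

theorem exists_le (t : Tri a b c) (P : Fin 3 → Fin 3 → Prop)
    (h : ∀ a b, Tri a b c → ln b (ch c) ≤ ln a (ch c) → P a b) : P a b ∨ P b a := by
  rcases le_total (ln b (ch c)) (ln a (ch c)) with e | e
  · exact Or.inl (h a b t e)
  · exact Or.inr (h b a t.swap e)

theorem dd_nonneg (h : (node m ch).Ok) : 0 ≤ dd m ch := by
  have := exists_le (ch := ch) (Tri.base 0) (fun _ _ => 0 ≤ dd m ch) fun a b t e => by
    obtain ⟨hm, k1, k2, k3, k4, k5, k6, k7, k8, k9, k10, k11, k12⟩ := bounds h t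
    rw [dd_expand t]
    have g := gap_nonneg h (0 + 2)
    have e1 := mul_nonneg g (by omega : 0 ≤ m - ln b (ch (0 + 2)))
    have e2 := mul_nonneg k6 (by omega : 0 ≤ m - ln a (ch (0 + 2)))
    have e3 := mul_nonneg k1 (by omega : 0 ≤ ln a (ch (0 + 2)) - ln b (ch (0 + 2)))
    have e4 := mul_nonneg k1 (by omega : 0 ≤ m - ln a (ch (0 + 2)) - ln (0 + 2) (ch a))
    have e5 := mul_nonneg k3 (by omega : 0 ≤ m - ln b (ch (0 + 2)) - ln (0 + 2) (ch b))
    linarith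
  tauto

theorem dd_eq_zero (h : (node m ch).Ok) (h0 : dd m ch = 0) :
    (∃ c, Leaf m ch c) ∨ ∃ a b c, Wedge m ch a b c := by
  have key : ∀ a b c, Tri a b c → ln b (ch c) ≤ ln a (ch c) →
      (∃ c, Leaf m ch c) ∨ ∃ a b c, Wedge m ch a b c := fun a b c t e => by
    have hex := dd_expand (m := m) (ch := ch) t
    have sd := sqa_diag h t
    have sda := sqa_diag h t.rot
    have sdb := sqa_diag h t.rot.rot
    have ga := gap_eq (m := m) (ch := ch) t.rot.rot
    obtain ⟨hm, k1, k2, k3, k4, k5, k6, k7, k8, k9, k10, k11, k12⟩ := bounds h t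
    have g := gap_nonneg h c
    have e1 := mul_nonneg g (by omega : 0 ≤ m - ln b (ch c))
    have e2 := mul_nonneg k6 (by omega : 0 ≤ m - ln a (ch c))
    have e3 := mul_nonneg k1 (by omega : 0 ≤ ln a (ch c) - ln b (ch c))
    have e4 := mul_nonneg k1 (by omega : 0 ≤ m - ln a (ch c) - ln c (ch a))
    have e5 := mul_nonneg k3 (by omega : 0 ≤ m - ln b (ch c) - ln c (ch b))
    have f1 : gap m ch c * (m - ln b (ch c)) = 0 := by linarith
    have f2 : ln b (ch c) * (m - ln a (ch c)) = 0 := by linarith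
    have f3 : ln b (ch a) * (ln a (ch c) - ln b (ch c)) = 0 := by linarith
    have f4 : ln b (ch a) * (m - ln a (ch c) - ln c (ch a)) = 0 := by linarith
    have f5 : ln a (ch b) * (m - ln b (ch c) - ln c (ch b)) = 0 := by linarith
    have f6 : sqa a (ch a) = ln b (ch a) * ln c (ch a) := by linarith
    have f7 : sqa b (ch b) = ln c (ch b) * ln a (ch b) := by linarith
    have f8 : sqa c (ch c) = ln a (ch c) * ln b (ch c) := by linarith
    clear hex h0
    by_cases hq : ln b (ch c) = m
    · have hp : ln a (ch c) = m := by omega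
      rcases (sd hp hq).2.2 with l | l
      · exact Or.inl ⟨c, l⟩
      · rw [f8, hp, hq] at l; exfalso; nlinarith
    · have hg : gap m ch c = 0 := by
        rcases mul_eq_zero.1 f1 with e | e <;> omega
      by_cases hq0 : ln b (ch c) = 0
      · have hc : ch c = nil := eq_nil_of_ln (b := b) (h.2.2 c) (by omega)
        have hp0 : ln a (ch c) = 0 := by rw [hc]; rfl
        by_cases hx : ln b (ch a) = 0
        · have hv : ln c (ch b) = m := by
            rcases mul_eq_zero.1 f5 with e | e <;> omega
          rcases (sdb hv (by omega)).2.2 with l | l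
          · exact Or.inl ⟨b, l⟩
          · rw [f7, hv, show ln a (ch b) = m by omega] at l; exfalso; nlinarith
        · by_cases hy : ln a (ch b) = 0
          · have hv : ln c (ch a) = m := by
              rcases mul_eq_zero.1 f4 with e | e <;> omega
            rcases (sda (by omega) hv).2.2 with l | l
            · exact Or.inl ⟨a, l⟩
            · rw [f6, hv, show ln b (ch a) = m by omega] at l; exfalso; nlinarith
          · refine Or.inr ⟨a, c, b, t.rot.rot.swap, hc, ?_, ?_, by omega, by omega, by omega,
              by rw [f6, mul_comm], by rw [f7, mul_comm]⟩
            · rcases mul_eq_zero.1 f4 with e | e <;> omega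
            · rcases mul_eq_zero.1 f5 with e | e <;> omega
      · have hp : ln a (ch c) = m := by
          rcases mul_eq_zero.1 f2 with e | e <;> omega
        have hx : ln b (ch a) = 0 := by
          rcases mul_eq_zero.1 f3 with e | e <;> omega
        have hv : ln c (ch b) = m - ln b (ch c) := by
          rcases mul_eq_zero.1 f5 with e | e <;> omega
        refine Or.inr ⟨b, a, c, t.swap, eq_nil_of_ln (b := b) (h.2.2 a) (by omega), by omega,
          hp, by omega, by omega, by omega, by rw [f7, mul_comm], by rw [f8, mul_comm]⟩
  have := exists_le (ch := ch) (Tri.base 0) (fun _ _ => _) fun a b t e => key a b _ t e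
  tauto

/-- The least positive self-intersection numbers. -/
theorem gap_le_dd (h : (node m ch).Ok) (hD : 0 < dd m ch) (c : Fin 3) :
    gap m ch c ≤ dd m ch ∧ (dd m ch = gap m ch c → ∃ a b, Tri a b c ∧ Thin m ch a b c) := by
  have := exists_le (ch := ch) (c := c) (Tri.base c).rot
      (fun _ _ => gap m ch c ≤ dd m ch ∧
        (dd m ch = gap m ch c → ∃ a b, Tri a b c ∧ Thin m ch a b c)) fun a b t e => by
    have hex := dd_expand (m := m) (ch := ch) t
    have sd := sqa_diag h t
    have ga := gap_eq (m := m) (ch := ch) t.rot.rot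
    obtain ⟨hm, k1, k2, k3, k4, k5, k6, k7, k8, k9, k10, k11, k12⟩ := bounds h t
    have g := gap_nonneg h c
    have e2 := mul_nonneg k6 (by omega : 0 ≤ m - ln a (ch c))
    have e3 := mul_nonneg k1 (by omega : 0 ≤ ln a (ch c) - ln b (ch c))
    have e4 := mul_nonneg k1 (by omega : 0 ≤ m - ln a (ch c) - ln c (ch a))
    have e5 := mul_nonneg k3 (by omega : 0 ≤ m - ln b (ch c) - ln c (ch b))
    by_cases hq : ln b (ch c) = m
    · have hp : ln a (ch c) = m := by omega
      obtain ⟨na, nb, l⟩ := sd hp hq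
      have hda : dd m ch = m ^ 2 - sqa c (ch c) := by
        rw [dd_eq t, na, nb]; simp [sqa]
      have hga : gap m ch c = m := by rw [ga, na, nb]; simp [ln]
      rcases l with ⟨-, ch', e, e'⟩ | l
      · exfalso
        have : sqa c (ch c) = m ^ 2 := by
          rw [← sq_bin t.rot.rot, e, Tr.bin, e' _ t.2.1, e' _ t.2.2]; simp [Tr.bin]
        omega
      · refine ⟨by omega, fun heq => ⟨a, b, t, na, ?_⟩⟩
        obtain ⟨p, q, e1, e2⟩ := BT.sq_diag_eq ((h.2.2 c).bin t.1) hm (by rw [left_bin, hp])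
          (by rw [right_bin, hq]) (by rw [sq_bin t.rot.rot]; omega)
        exact Or.inr (Or.inr ⟨p, q, e1, nb, e2⟩)
    · have e1 : 0 ≤ gap m ch c * (m - ln b (ch c)) - gap m ch c := by
        have := mul_nonneg g (by omega : 0 ≤ m - ln b (ch c) - 1)
        linarith
      refine ⟨by linarith, fun heq => ⟨a, b, t, ?_⟩⟩
      have f1 : gap m ch c * (m - ln b (ch c) - 1) = 0 := by linarith
      have f2 : ln b (ch c) * (m - ln a (ch c)) = 0 := by linarith
      have f3 : ln b (ch a) * (ln a (ch c) - ln b (ch c)) = 0 := by linarith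
      have f5 : ln a (ch b) * (m - ln b (ch c) - ln c (ch b)) = 0 := by linarith
      have f7 : sqa b (ch b) = ln c (ch b) * ln a (ch b) := by linarith
      have f8 : sqa c (ch c) = ln a (ch c) * ln b (ch c) := by linarith
      have hq' : ln b (ch c) = m - 1 := by
        rcases mul_eq_zero.1 f1 with e | e <;> omega
      by_cases hp : ln a (ch c) = m
      · have na : ch a = nil := eq_nil_of_ln (b := b) (h.2.2 a) (by
          rcases mul_eq_zero.1 f3 with e | e <;> omega)
        refine ⟨na, Or.inr (Or.inl ?_)⟩
        obtain ⟨p, e1, e2⟩ := BT.eq_of_full_succ ((h.2.2 c).bin t.1) hm (by rw [left_bin, hp])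
          (by rw [right_bin, hq']) (by rw [sq_bin t.rot.rot, f8, hp, hq'])
        refine ⟨p, e1, e2, ?_⟩
        rcases mul_eq_zero.1 f5 with e | e
        · exact Or.inl (eq_nil_of_ln (b := a) (h.2.2 b) (by omega))
        · obtain ⟨n, hn⟩ := BT.eq_chainR ((h.2.2 b).bin t.2.1.symm)
            (by rw [left_bin]; omega)
            (by rw [sq_bin t.rot, right_bin, f7, show ln c (ch b) = 1 by omega, one_mul])
          exact Or.inr ⟨n, hn⟩
      · have hq0 : ln b (ch c) = 0 := by
          rcases mul_eq_zero.1 f2 with e | e <;> omega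
        have nc : ch c = nil := eq_nil_of_ln (b := b) (h.2.2 c) (by omega)
        exact ⟨eq_nil_of_ln (b := b) (h.2.2 a) (by omega), Or.inl ⟨by omega,
          eq_nil_of_ln (b := a) (h.2.2 b) (by omega), nc⟩⟩
  rcases this with h | h <;> exact h

end Tr

namespace Tr

section Residue

variable {F : Type} [Field F] {a b c : Fin 3} {m : ℤ} {ch : Fin 3 → Tr} {s : F} {x : Fin 3 → F}

/-- The residue of the zeta function of a node along the vanishing of its own linear factor. -/
def resid (s : F) (x : Fin 3 → F) (m : ℤ) (ch : Fin 3 → Tr) : F :=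
  s / (s + 1) * (dd m ch - ∑ a, (gap m ch a : F) / x a)
    + ∑ a, (bin (a + 1) (a + 2) (ch a)).res s (x (a + 1)) (x (a + 2))

/-- The denominators in `resid` do not vanish. -/
def Good (s : F) (x : Fin 3 → F) (ch : Fin 3 → Tr) : Prop :=
  ∀ a, (bin (a + 1) (a + 2) (ch a)).NZ s (x (a + 1)) (x (a + 2))

theorem Good.nz (h : Good s x ch) (t : Tri a b c) : (bin b c (ch a)).NZ s (x b) (x c) := by
  rcases t.shift with ⟨rfl, rfl⟩ | ⟨rfl, rfl⟩
  · exact h a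
  · rw [← flip_bin]; exact (h a).flip

theorem Good.ne (h : Good s x ch) (a : Fin 3) : x a ≠ 0 :=
  (h.nz (Tri.base a).rot.rot).left_ne

theorem res_bin_comm (s : F) (b c : Fin 3) (T : Tr) (y z : F) :
    (bin b c T).res s y z = (bin c b T).res s z y := by
  rw [← BT.res_flip, flip_bin]

theorem resid_eq (t : Tri a b c) : resid s x m ch =
    s / (s + 1) * (dd m ch - (gap m ch a : F) / x a - (gap m ch b : F) / x b
        - (gap m ch c : F) / x c)
      + (bin b c (ch a)).res s (x b) (x c) + (bin c a (ch b)).res s (x c) (x a)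
      + (bin a b (ch c)).res s (x a) (x b) := by
  have key : ∀ {a b c}, Tri a b c → (bin (a + 1) (a + 2) (ch a)).res s (x (a + 1)) (x (a + 2))
      = (bin b c (ch a)).res s (x b) (x c) := by
    intro a b c t
    rcases t.shift with ⟨rfl, rfl⟩ | ⟨rfl, rfl⟩
    · rfl
    · exact res_bin_comm _ _ _ _ _ _
  rw [resid, t.sum, t.sum, key t, key t.rot, key t.rot.rot]
  ring

theorem dd_leaf (h : Leaf m ch c) (t : Tri a b c) :
    dd m ch = 0 ∧ gap m ch a = 0 ∧ gap m ch b = 0 ∧ gap m ch c = m := by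
  obtain ⟨h1, ch', h2, h3⟩ := h
  refine ⟨?_, ?_, ?_, ?_⟩
  · simp [dd_eq t, h1 _ t.2.1, h1 _ t.2.2, h2, sqa, t.sum, h3 _ t.2.1, h3 _ t.2.2]
  · simp [gap_eq t, h1 _ t.2.2, h2, ln, h3 _ t.2.2]
  · simp [gap_eq t.rot, h1 _ t.2.1, h2, ln, h3 _ t.2.1]
  · simp [gap_eq t.rot.rot, h1 _ t.2.1, h1 _ t.2.2, ln]

theorem resid_leaf (h : Leaf m ch c) (t : Tri a b c) (hx : Good s x ch)
    (hL : x a + x b + x c + m * s = 0) : resid s x m ch = 0 := by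
  obtain ⟨e1, e2, e3, e4⟩ := dd_leaf h t
  have ha := hx.ne a
  have hb := hx.ne b
  have hc := hx.ne c
  obtain ⟨h1, ch', h2, h3⟩ := h
  rw [resid_eq t, e1, e2, e3, e4, h1 _ t.2.1, h1 _ t.2.2, h2]
  simp only [bin, h3 _ t.2.1, h3 _ t.2.2, BT.res, BT.left_nil, BT.right_nil]
  have e : x a + x b + m * s = -x c := by linear_combination hL
  rw [e]
  push_cast
  generalize hσ : s / (s + 1) = σ
  have hL' : (m : F) * s = -(x a + x b + x c) := by linear_combination hL
  field_simp
  ring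

theorem gap_wedge (h : Wedge m ch a b c) (i : Fin 3) : gap m ch i = 0 := by
  obtain ⟨t, nb, h1, h2, h3, -⟩ := h
  have hb : ∀ i, ln i (ch b) = 0 := fun i => by rw [nb]; rfl
  rcases t.eq_or i with rfl | rfl | rfl
  · rw [gap_eq t, hb, h2]; ring
  · rw [gap_eq t.rot]; omega
  · rw [gap_eq t.rot.rot, hb, h1]; ring

theorem dd_wedge (h : Wedge m ch a b c) : dd m ch = 0 := by
  obtain ⟨t, nb, h1, h2, h3, -, -, h4, h5⟩ := h
  rw [dd_eq t, h4, h5, nb, h1, h2, ← h3]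
  simp only [sqa]
  rw [show ln a (ch c) = m - ln c (ch a) by omega]; ring

theorem resid_wedge (hOk : (node m ch).Ok) (h : Wedge m ch a b c) (hx : Good s x ch)
    (hL : x a + x b + x c + m * s = 0)
    (hΔ : ((ln a (ch c) : ℤ) : F) * x c ≠ (ln c (ch a) : ℤ) * x a) : resid s x m ch = 0 := by
  have hg := gap_wedge h
  have hd := dd_wedge h
  obtain ⟨t, nb, h1, h2, h3, p1, p2, h4, h5⟩ := h
  have ha := hx.ne a
  have hb := hx.ne b
  have hc := hx.ne c
  have r1 := BT.res_full s (bin b c (ch a)) (x b) (x c) ((hOk.2.2 a).bin t.2.2)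
    (by rw [sq_bin t, left_bin, right_bin, h4]) (hx.nz t)
  have r2 := BT.res_full s (bin a b (ch c)) (x a) (x b) ((hOk.2.2 c).bin t.1)
    (by rw [sq_bin t.rot.rot, left_bin, right_bin, h5]) (hx.nz t.rot.rot)
  rw [resid_eq t, hd, hg, hg, hg, nb]
  simp only [left_bin, right_bin, h1, h2] at r1 r2
  have hx1 : ln a (ch c) = m - ln c (ch a) := by omega
  have hgcd : Int.gcd (ln a (ch c)) m = Int.gcd m (ln c (ch a)) := by
    rw [hx1, Int.gcd_comm, Int.gcd_self_sub_right]
  rw [hgcd] at r2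
  rw [hx1] at r2 hΔ
  generalize (bin b c (ch a)).res s (x b) (x c) = R1 at *
  generalize (bin a b (ch c)).res s (x a) (x b) = R2 at *
  generalize s / (s + 1) * ((Int.gcd m (ln c (ch a)) : ℕ) : F) ^ 2 = G at *
  generalize ln c (ch a) = n at *
  push_cast at r1 r2 hΔ ⊢
  simp only [bin, BT.res]
  have hΔ' : ((m : F) - n) * x c - n * x a ≠ 0 := sub_ne_zero.2 hΔ
  have q1 : (n * x b + m * x c + m * n * s : F) = (m - n) * x c - n * x a := by
    linear_combination n * hL
  have q2 : (m * x a + (m - n) * x b + (m - n) * m * s : F) = -((m - n) * x c - n * x a) := by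
    linear_combination ((m : F) - n) * hL
  rw [q1] at r1
  rw [q2] at r2
  apply mul_left_cancel₀ hΔ'
  have : ((m - n) * x c - n * x a) * (R1 + 1 / (x c * x a) + R2) = (0 : F) := by
    have e : ((m - n) * x c - n * x a) * (R1 + 1 / (x c * x a) + R2) =
      (n / x c + m / x b - G) - (m / x b + (m - n) / x a - G)
        + ((m - n) * x c - n * x a) * (1 / (x c * x a)) := by
      linear_combination r1 - r2
    rw [e]
    field_simp
    ring
  rw [mul_zero]
  simp only [zero_div, sub_zero, mul_zero, zero_add]
  exact this

theorem resid_thin (hs : s + 1 ≠ 0) (h : Thin m ch a b c) (t : Tri a b c)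
    (hD : dd m ch = gap m ch c) (hx : Good s x ch) (hc : x c = 1)
    (hL : x a + x b + x c + m * s = 0) : resid s x m ch = 0 := by
  have ha := hx.ne a
  have hb := hx.ne b
  have hC := hx.nz t.rot.rot
  have hB := hx.nz t.rot
  have ga := gap_eq (m := m) (ch := ch) t
  have gb := gap_eq (m := m) (ch := ch) t.rot
  have hs' : 1 + s ≠ 0 := by rwa [add_comm]
  have l1 := left_bin a b (ch c)
  have l2 := right_bin a b (ch c)
  have l3 := left_bin c a (ch b)
  rw [hc] at hL hB
  obtain ⟨na, h⟩ := h
  rw [na] at gb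
  have hca : ∀ i, ln i nil = 0 := fun _ => rfl
  rw [resid_eq t, hD, hc, na]
  rcases h with ⟨rfl, nb, nc⟩ | ⟨p, hm, h1, h2⟩ | ⟨p, q, hm, nb, h1⟩
  · rw [nb] at ga
    rw [nc] at ga gb
    rw [nb, nc]
    simp only [hca] at ga gb
    rw [ga, gb]
    simp only [bin, BT.res]
    push_cast at hL ⊢
    rw [show s = -(x a + x b + 1) by linear_combination hL] at hs ⊢
    have : -(x a + x b) ≠ 0 := by intro h; apply hs; linear_combination h
    rw [show -(x a + x b + 1) + 1 = -(x a + x b) by ring]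
    have : x a + x b ≠ 0 := by intro h; apply this; rw [h]; simp
    field_simp
    ring
  · rw [h1] at l1 l2 hC ⊢
    simp only [BT.left_node, BT.left_chainR_succ, BT.right_node, BT.right_nil] at l1 l2
    have hL0 : x a + x b + ((m - 1 : ℤ) : F) * s = -(1 + s) := by
      push_cast; linear_combination hL
    have hC2 := hC.2.1
    rw [hL0] at hC2
    have r1 := BT.res_chainR s hs p _ _ (by ring) hC2
    rw [BT.res, hL0, r1, BT.res, BT.right_chainR, hm]
    have gb0 : gap m ch b = 0 := by rw [gb, hca]; omega
    rw [← hm, gb0]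
    rcases h2 with nb | ⟨n, hn⟩
    · have ga1 : gap m ch a = 1 := by rw [ga, nb, hca]; omega
      rw [ga1, nb]
      simp only [bin, BT.res, BT.left_nil]
      rw [hm]
      push_cast
      field_simp
      ring
    · rw [hn] at l3 hB
      rw [BT.left_chainR_succ] at l3
      have ga1 : gap m ch a = 0 := by rw [ga]; omega
      have r2 := BT.res_chainR_one s hs n _ hB
      rw [ga1, hn, r2]
      simp only [bin, BT.res, BT.left_nil]
      rw [hm]
      push_cast
      field_simp
      ring
  · rw [h1] at l1 l2 hC ⊢
    simp only [BT.left_node, BT.left_chainR_succ, BT.right_node, BT.right_chainL_succ] at l1 l2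
    have hL0 : x a + x b + ((m - 1 : ℤ) : F) * s = -(1 + s) := by
      push_cast; linear_combination hL
    have hC2 := hC.2.1
    have hC3 := hC.2.2
    rw [hL0] at hC2 hC3
    have r1 := BT.res_chainR s hs p _ _ (by ring) hC2
    have r2 := BT.res_chainL s hs q _ _ (by ring) hC3
    have gb0 : gap m ch b = 0 := by rw [gb, hca]; omega
    have ga0 : gap m ch a = 0 := by rw [ga, nb, hca]; omega
    rw [BT.res, hL0, r1, r2, BT.right_chainR, BT.left_chainL, gb0, ga0, nb, hm]
    simp only [bin, BT.res]
    push_cast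
    field_simp
    ring

end Residue

end Tr

/-! ### Regularity of the zeta function at a point -/

/-- The polynomial ring in `s` and the linear factors of the three sides of a cone. -/
abbrev CPoly := MvPolynomial (Option (Fin 3)) ℤ

/-- The point with coordinates `s` and `x`. -/
def cpt {K : Type} (s : K) (x : Fin 3 → K) : Option (Fin 3) → K := fun o => o.elim s x

/-- Evaluation at a point. -/
noncomputable def cev {K : Type} [CommRing K] (s : K) (x : Fin 3 → K) : CPoly →+* K :=
  MvPolynomial.eval₂Hom (Int.castRingHom K) (cpt s x)

open MvPolynomial in
/-- The linear factor of a node as a polynomial. -/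
noncomputable def clin (m : ℤ) : CPoly := ∑ a, X (some a) + (m : CPoly) * X none

/-- The linear factor of a node. -/
def lf {K : Type} [CommRing K] (s : K) (x : Fin 3 → K) (m : ℤ) : K := ∑ a, x a + m * s

open MvPolynomial in
/-- The substitution describing the passage to a child. -/
noncomputable def csub (m : ℤ) (a : Fin 3) : CPoly →+* CPoly :=
  cev (X none) (Function.update (fun i => X (some i)) a (clin m))

/-- The product over the two other indices. -/
def oth {K : Type} [CommRing K] (f : Fin 3 → K) (a : Fin 3) : K := ∏ i, if i = a then 1 else f i

section Eval

variable {K : Type} [CommRing K] (s : K) (x : Fin 3 → K)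

@[simp] theorem cev_some (a : Fin 3) : cev s x (MvPolynomial.X (some a)) = x a := by
  simp [cev, cpt]

@[simp] theorem cev_none : cev s x (MvPolynomial.X none) = s := by
  simp [cev, cpt]

@[simp] theorem cev_clin (m : ℤ) : cev s x (clin m) = lf s x m := by
  simp [clin, lf]

theorem cev_cev (y : CPoly) (z : Fin 3 → CPoly) (f : CPoly) :
    cev s x (cev y z f) = cev (cev s x y) (fun i => cev s x (z i)) f := by
  have : (cev s x).comp (cev y z) = cev (cev s x y) (fun i => cev s x (z i)) := by
    ext o
    · simp
    · rcases o with _ | o <;> simp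
  exact DFunLike.congr_fun this f

@[simp] theorem cev_csub (m : ℤ) (a : Fin 3) (f : CPoly) :
    cev s x (csub m a f) = cev s (Function.update x a (lf s x m)) f := by
  rw [csub, cev_cev, cev_none]
  congr 2
  funext i
  rcases eq_or_ne i a with rfl | h
  · simp
  · simp [h]

theorem lf_eq {a b c : Fin 3} (t : Tri a b c) (m : ℤ) : lf s x m = x a + x b + x c + m * s := by
  rw [lf, t.sum]

theorem oth_eq {a b c : Fin 3} (t : Tri a b c) (f : Fin 3 → K) : oth f a = f b * f c := by
  simp [oth, t.prod, t.1.symm, t.2.1.symm]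

end Eval

namespace Tr

/-- The zeta function of a weighted tree with linear factors `x` on the sides of its cone. -/
def Zt {F : Type} [Field F] (s : F) : (Fin 3 → F) → Tr → F
  | x, nil => 1 / ∏ a, x a
  | x, node m ch => s / (s + 1) * (dd m ch - ∑ a, (gap m ch a : F) / x a) / lf s x m
      + ∑ a, Zt s (Function.update x a (lf s x m)) (ch a)

/-- All linear factors occurring in `Zt` are nonzero. -/
def NZt {F : Type} [Field F] (s : F) : (Fin 3 → F) → Tr → Prop
  | x, nil => ∀ a, x a ≠ 0
  | x, node m ch => ∀ a, NZt s (Function.update x a (lf s x m)) (ch a)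

theorem NZt.ne {F : Type} [Field F] {s : F} : ∀ {T : Tr} {x : Fin 3 → F}, NZt s x T →
    ∀ a, x a ≠ 0
  | nil, _, h, a => h a
  | node m ch, x, h, a => by
      have := (h (a + 1)).ne a
      rwa [Function.update_of_ne (Tri.base a).1] at this

theorem NZt.lf_ne {F : Type} [Field F] {s : F} {m : ℤ} {ch : Fin 3 → Tr} {x : Fin 3 → F}
    (h : NZt s x (node m ch)) : lf s x m ≠ 0 := by
  have := (h 0).ne 0
  rwa [Function.update_self] at this

/-- The zeta function, multiplied by the three side factors, is regular at the point `(s₀, p)`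
of the space of the side factors not labelled outside `S`; moreover its values on the
coordinate hyperplanes are given by `BT.res`. -/
def Claim (s₀ : ℚ) (S : Finset (Fin 3)) (p : Fin 3 → ℚ) (T : Tr) : Prop :=
  ∃ n d : CPoly, cev s₀ p d ≠ 0 ∧
    (∀ (F : Type) [Field F] (s : F) (x : Fin 3 → F), s + 1 ≠ 0 → (∀ c, c ∉ S → x c = 1) →
      NZt s x T → (∏ a, x a) * Zt s x T * cev s x d = cev s x n) ∧
    ∀ (F : Type) [Field F] (s : F) (x : Fin 3 → F), s + 1 ≠ 0 → (∀ c, c ∉ S → x c = 1) →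
      ∀ a b c, Tri a b c → x a = 0 → (bin b c T).NZ s (x b) (x c) →
        cev s x n = x b * x c * (bin b c T).res s (x b) (x c) * cev s x d

theorem claim_nil (s₀ : ℚ) (S : Finset (Fin 3)) (p : Fin 3 → ℚ) : Claim s₀ S p nil := by
  refine ⟨1, 1, by simp, fun F _ s x _ _ h => ?_, fun F _ s x _ _ a b c t _ h => ?_⟩
  · have : (∏ a, x a) ≠ 0 := Finset.prod_ne_zero_iff.2 fun a _ => h a
    rw [Zt]; simp [this]
  · have h1 := h.1
    have h2 := h.2
    simp only [bin, BT.res, map_one]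
    field_simp

/-- The numerator of the zeta function of a node multiplied by its linear factor. -/
noncomputable def cnum (m : ℤ) (ch : Fin 3 → Tr) (n d : Fin 3 → CPoly) : CPoly :=
  .X none * ((dd m ch : CPoly) * ∏ a, .X (some a)
      - ∑ a, (gap m ch a : CPoly) * oth (fun i => .X (some i)) a) * ∏ a, d a
    + (.X none + 1) * ∑ a, .X (some a) * n a * oth d a

section Node

variable {s₀ : ℚ} {S : Finset (Fin 3)} {p : Fin 3 → ℚ} {m : ℤ} {ch : Fin 3 → Tr}
  {F : Type} [Field F] {s : F} {x : Fin 3 → F}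

theorem cev_cnum (t : Tri a b c) (n d : Fin 3 → CPoly) : cev s x (cnum m ch n d) =
    s * (dd m ch * (x a * x b * x c) - (gap m ch a * (x b * x c) + gap m ch b * (x c * x a)
      + gap m ch c * (x a * x b))) * (cev s x (d a) * cev s x (d b) * cev s x (d c))
    + (s + 1) * (x a * cev s x (n a) * (cev s x (d b) * cev s x (d c))
      + x b * cev s x (n b) * (cev s x (d c) * cev s x (d a))
      + x c * cev s x (n c) * (cev s x (d a) * cev s x (d b))) := by
  simp only [cnum, t.sum, t.prod, oth_eq t, oth_eq t.rot, oth_eq t.rot.rot, map_add, map_mul,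
    map_sub, map_intCast, cev_none, cev_some, map_one]

theorem update_tri {K : Type} (t : Tri a b c) (x : Fin 3 → K) (y : K) :
    Function.update x a y a = y ∧ Function.update x a y b = x b ∧ Function.update x a y c = x c :=
  ⟨Function.update_self .., Function.update_of_ne t.1.symm .., Function.update_of_ne t.2.1.symm ..⟩

/-- Data obtained from the children of a node. -/
def NodeData (s₀ : ℚ) (S : Finset (Fin 3)) (p : Fin 3 → ℚ) (m : ℤ) (ch : Fin 3 → Tr)
    (n d : CPoly) : Prop :=
  cev s₀ p d ≠ 0 ∧
  (∀ (F : Type) [Field F] (s : F) (x : Fin 3 → F), s + 1 ≠ 0 → (∀ c, c ∉ S → x c = 1) →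
      NZt s x (node m ch) → (∏ a, x a) * Zt s x (node m ch) * (cev s x d * lf s x m) = cev s x n) ∧
  (∀ (F : Type) [Field F] (s : F) (x : Fin 3 → F), s + 1 ≠ 0 → (∀ c, c ∉ S → x c = 1) →
      ∀ a b c, Tri a b c → x a = 0 → (bin b c (node m ch)).NZ s (x b) (x c) →
        cev s x n = x b * x c * (bin b c (node m ch)).res s (x b) (x c)
          * (cev s x d * lf s x m)) ∧
  (∀ (F : Type) [Field F] (s : F) (x : Fin 3 → F), s + 1 ≠ 0 → (∀ c, c ∉ S → x c = 1) →
      lf s x m = 0 → Good s x ch → resid s x m ch = 0 → cev s x n = 0)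

theorem exists_nodeData (h0 : s₀ + 1 ≠ 0)
    (h : ∀ a, Claim s₀ (insert a S) (Function.update p a (lf s₀ p m)) (ch a)) :
    ∃ n d, NodeData s₀ S p m ch n d := by
  choose n d hd hz hr using h
  have hc : ∀ (F : Type) [Field F] (x : Fin 3 → F) (y : F) (a : Fin 3),
      (∀ c, c ∉ S → x c = 1) → ∀ c, c ∉ insert a S → Function.update x a y c = 1 := by
    intro F _ x y a h c hc
    rw [mem_insert, not_or] at hc
    rw [Function.update_of_ne hc.1, h c hc.2]
  refine ⟨cnum m ch (fun a => csub m a (n a)) (fun a => csub m a (d a)),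
    (.X none + 1) * ∏ a, csub m a (d a), ?_, ?_, ?_, ?_⟩
  · simp only [map_mul, map_add, map_prod, map_one, cev_none, cev_csub]
    exact mul_ne_zero h0 (prod_ne_zero_iff.2 fun a _ => hd a)
  · intro F _ s x hs hx hnz
    have t := Tri.base 0
    have hL := hnz.lf_ne
    have key : ∀ {a b c}, Tri a b c → cev s x (csub m a (n a)) =
        lf s x m * (x b * x c) * Zt s (Function.update x a (lf s x m)) (ch a)
          * cev s x (csub m a (d a)) := by
      intro a b c t
      rw [cev_csub, cev_csub, ← hz a F s _ hs (hc F x _ a hx) (hnz a), t.prod]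
      obtain ⟨e1, e2, e3⟩ := update_tri t x (lf s x m)
      rw [e1, e2, e3]; ring
    rw [cev_cnum t, key t, key t.rot, key t.rot.rot, Zt]
    simp only [map_mul, map_add, map_one, cev_none, t.prod, t.sum]
    have h1 := hnz.ne 0
    have h2 := hnz.ne (0 + 1)
    have h3 := hnz.ne (0 + 2)
    generalize cev s x (csub m _ (d _)) = e1
    generalize cev s x (csub m _ (d _)) = e2
    generalize cev s x (csub m _ (d _)) = e3
    field_simp
  · intro F _ s x hs hx a b c t h0 hnz
    have hL := hnz.1
    have e : x b + x c + m * s = lf s x m := by rw [lf_eq _ _ t, h0, zero_add]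
    obtain ⟨e1, e2, e3⟩ := update_tri t.rot x (lf s x m)
    obtain ⟨f1, f2, f3⟩ := update_tri t.rot.rot x (lf s x m)
    have k1 := hr b F s _ hs (hc F x (lf s x m) b hx) a b c t (by rw [e3, h0])
      (by rw [e1, e2, ← e]; exact hnz.2.1)
    have k2 := hr c F s _ hs (hc F x (lf s x m) c hx) a b c t (by rw [f2, h0])
      (by rw [f1, f3, ← e]; exact hnz.2.2)
    rw [← cev_csub, ← cev_csub, e1, e2] at k1
    rw [← cev_csub, ← cev_csub, f1, f3] at k2
    rw [cev_cnum t, k1, k2, bin, BT.res, left_bin, right_bin, e, h0, gap_eq t]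
    rw [e] at hL
    simp only [map_mul, map_add, map_one, cev_none, t.prod]
    field_simp
    ring
  · intro F _ s x hs hx hL hg hres
    have t := Tri.base 0
    have key : ∀ {a b c}, Tri a b c → cev s x (csub m a (n a)) =
        x b * x c * (bin b c (ch a)).res s (x b) (x c) * cev s x (csub m a (d a)) := by
      intro a b c t
      obtain ⟨e1, e2, e3⟩ := update_tri t x (lf s x m)
      have := hr a F s _ hs (hc F x (lf s x m) a hx) a b c t (by rw [e1, hL])
        (by rw [e2, e3]; exact hg.nz t)
      rw [e2, e3] at this
      rw [cev_csub, cev_csub, this]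
    rw [cev_cnum t, key t, key t.rot, key t.rot.rot]
    rw [resid_eq t] at hres
    have h1 := hg.ne 0
    have h2 := hg.ne (0 + 1)
    have h3 := hg.ne (0 + 2)
    rw [← mul_zero ((s + 1) * (x 0 * x (0 + 1) * x (0 + 2)) * (cev s x (csub m 0 (d 0))
      * cev s x (csub m (0 + 1) (d (0 + 1))) * cev s x (csub m (0 + 2) (d (0 + 2))))), ← hres]
    field_simp
    ring

theorem claim_regular (h0 : s₀ + 1 ≠ 0) (hL : lf s₀ p m ≠ 0)
    (h : ∀ a, Claim s₀ (insert a S) (Function.update p a (lf s₀ p m)) (ch a)) :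
    Claim s₀ S p (node m ch) := by
  obtain ⟨n, d, h1, h2, h3, -⟩ := exists_nodeData h0 h
  refine ⟨n, d * clin m, by simp [h1, hL], ?_, ?_⟩
  · intro F _ s x hs hx hnz
    rw [map_mul, cev_clin, h2 F s x hs hx hnz]
  · intro F _ s x hs hx a b c t hx0 hnz
    rw [map_mul, cev_clin, h3 F s x hs hx a b c t hx0 hnz]

/-- A point of the hyperplane `lf = 0` at which no polynomial vanishes that does not
vanish on all rational points of this hyperplane. -/
def Generic (S : Finset (Fin 3)) (m : ℤ) (s : F) (x : Fin 3 → F) : Prop :=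
  (∀ c, c ∉ S → x c = 1) ∧ lf s x m = 0 ∧
    ∀ f : CPoly, (∃ (σ : ℚ) (q : Fin 3 → ℚ), (∀ c, c ∉ S → q c = 1) ∧ lf σ q m = 0 ∧
      cev σ q f ≠ 0) → cev s x f ≠ 0

end Node

end Tr

theorem cev_cev_map {K L : Type} [CommRing K] [CommRing L] (g : K →+* L) (s : K) (x : Fin 3 → K)
    (f : CPoly) : g (cev s x f) = cev (g s) (fun i => g (x i)) f := by
  have : g.comp (cev s x) = cev (g s) (fun i => g (x i)) := by
    ext o
    · simp
    · rcases o with _ | o <;> simp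
  exact DFunLike.congr_fun this f

theorem lf_map {K L : Type} [CommRing K] [CommRing L] (g : K →+* L) (s : K) (x : Fin 3 → K)
    (m : ℤ) : g (lf s x m) = lf (g s) (fun i => g (x i)) m := by
  simp [lf]

theorem lf_update_sub {K : Type} [CommRing K] (s : K) (x : Fin 3 → K) (m : ℤ) (e : Fin 3) (y : K) :
    lf s (Function.update x e (x e - y)) m = lf s x m - y := by
  have t := Tri.base e
  obtain ⟨h1, h2, h3⟩ := Tr.update_tri t x (x e - y)
  rw [lf_eq _ _ t, lf_eq _ _ t, h1, h2, h3]; ring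

namespace Tr

variable {s₀ : ℚ} {S : Finset (Fin 3)} {p : Fin 3 → ℚ} {m : ℤ} {ch : Fin 3 → Tr}

theorem update_outside {K : Type} {x : Fin 3 → K} {e : Fin 3} (he : e ∈ S) (y : K) (c : Fin 3)
    (hc : c ∉ S) : Function.update x e y c = x c :=
  Function.update_of_ne (by rintro rfl; exact hc he) ..

/-- The rational point of the hyperplane `lf = 0` with `s = 0` and coordinates `-2`, `1`, `1`. -/
theorem lf_negTwo (m : ℤ) (e : Fin 3) : lf (0 : ℚ) (Function.update (fun _ => 1) e (-2)) m = 0 := by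
  obtain ⟨h1, h2, h3⟩ := update_tri (Tri.base e) (fun _ => (1 : ℚ)) (-2)
  rw [lf_eq _ _ (Tri.base e), h1, h2, h3]; norm_num

open MvPolynomial in
theorem claim_singular (h0 : s₀ + 1 ≠ 0) {e : Fin 3} (he : e ∈ S)
    (H : ∀ (F : Type) [Field F] (s : F) (x : Fin 3 → F), s + 1 ≠ 0 → Generic S m s x →
      Good s x ch ∧ resid s x m ch = 0)
    (h : ∀ a, Claim s₀ (insert a S) (Function.update p a (lf s₀ p m)) (ch a)) :
    Claim s₀ S p (node m ch) := by
  obtain ⟨n, d, h1, h2, h3, h4⟩ := exists_nodeData h0 h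
  set y : Fin 3 → CPoly := fun i => if i ∈ S then X (some i) else 1 with hy
  set z : Fin 3 → CPoly := Function.update y e (y e - lf (X none) y m) with hz
  have hz0 : lf (X none) z m = 0 := by rw [hz, lf_update_sub, sub_self]
  have hzc : ∀ c, c ∉ S → z c = 1 := fun c hc => by
    rw [hz, update_outside he _ c hc, hy]; simp [hc]
  have hdvd : lf (X none) y m ∣ cev (X none) y n - cev (X none) z n := by
    rw [← Ideal.mem_span_singleton, ← Ideal.Quotient.eq, cev_cev_map, cev_cev_map]
    congr 2
    funext i
    rcases eq_or_ne i e with rfl | hi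
    · rw [hz, Function.update_self, map_sub, eq_comm, sub_eq_self, Ideal.Quotient.eq_zero_iff_mem]
      exact Ideal.mem_span_singleton_self _
    · rw [hz, Function.update_of_ne hi]
  have hy_eval : ∀ {K : Type} [CommRing K] (s : K) (x : Fin 3 → K), (∀ c, c ∉ S → x c = 1) →
      (fun i => cev s x (y i)) = x := by
    intro K _ s x hx
    funext i
    by_cases hi : i ∈ S
    · simp [hy, hi]
    · simp [hy, hi, hx i hi]
  have hzn : cev (X none) z n = 0 := by
    let g := algebraMap CPoly (FractionRing CPoly)
    have ginj : Function.Injective g := IsFractionRing.injective _ _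
    have hgen : Generic S m (g (X none)) (fun i => g (z i)) := by
      refine ⟨fun c hc => by simp only [hzc c hc, map_one], by rw [← lf_map, hz0, map_zero], ?_⟩
      rintro f ⟨σ, q, hq, hl, hf⟩ h
      rw [← cev_cev_map, map_eq_zero_iff g ginj] at h
      apply hf
      have := cev_cev σ q (X none) z f
      rw [h, map_zero, cev_none] at this
      rw [this]
      have hyq := hy_eval σ q hq
      congr 2
      funext i
      rcases eq_or_ne i e with rfl | hi
      · rw [hz, Function.update_self, map_sub, lf_map, cev_none, hyq, hl, sub_zero]
        exact (congrFun hyq i).symm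
      · rw [hz, Function.update_of_ne hi]; exact (congrFun hyq i).symm
    have hs : g (X none) + 1 ≠ 0 := by
      have := hgen.2.2 (X none + 1) ⟨0, Function.update (fun _ => 1) e (-2), update_outside he _, lf_negTwo m e, by simp⟩
      simpa using this
    obtain ⟨hG, hR⟩ := H _ _ _ hs hgen
    have := h4 _ _ _ hs hgen.1 hgen.2.1 hG hR
    rwa [← cev_cev_map, map_eq_zero_iff g ginj] at this
  rw [hzn, sub_zero] at hdvd
  obtain ⟨n', hn'⟩ := hdvd
  have key : ∀ {K : Type} [CommRing K] (s : K) (x : Fin 3 → K), (∀ c, c ∉ S → x c = 1) →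
      cev s x n = lf s x m * cev s x n' := by
    intro K _ s x hx
    have := congrArg (cev s x) hn'
    rwa [cev_cev, map_mul, lf_map, hy_eval s x hx, cev_none] at this
  refine ⟨n', d, h1, ?_, ?_⟩
  · intro F _ s x hs hx hnz
    apply mul_left_cancel₀ hnz.lf_ne
    rw [← key s x hx, ← h2 F s x hs hx hnz]; ring
  · intro F _ s x hs hx a b c t hx0 hnz
    have hl : lf s x m ≠ 0 := by
      have := hnz.1
      rwa [lf_eq _ _ t, hx0, zero_add]
    apply mul_left_cancel₀ hl
    rw [← key s x hx, h3 F s x hs hx a b c t hx0 hnz]; ring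

section Generic

variable {F : Type} [Field F] {s : F} {x : Fin 3 → F}

theorem Generic.ne (h : Generic S m s x) (f : CPoly) (σ : ℚ) (q : Fin 3 → ℚ)
    (hq : ∀ c, c ∉ S → q c = 1) (hl : lf σ q m = 0) (hf : cev σ q f ≠ 0) : cev s x f ≠ 0 :=
  h.2.2 f ⟨σ, q, hq, hl, hf⟩

/-- Nonvanishing of linear factors deduced from the signs at one point with `s = 0`. -/
theorem Generic.nz (h : Generic S m s x) (q : Fin 3 → ℚ)
    (hq : ∀ c, c ∉ S → q c = 1) (hl : lf 0 q m = 0) (ε : ℚ) (T : BT) : ∀ (f g : CPoly),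
    0 ≤ ε * cev 0 q f → 0 ≤ ε * cev 0 q g → 0 < ε * cev 0 q f + ε * cev 0 q g →
    cev s x f ≠ 0 → cev s x g ≠ 0 → T.NZ s (cev s x f) (cev s x g) := by
  induction T with
  | nil => exact fun f g _ _ _ hf hg => ⟨hf, hg⟩
  | node w l r ihl ihr =>
      intro f g h1 h2 h3 hf hg
      have e : cev s x (f + g + (w : CPoly) * .X none) = cev s x f + cev s x g + w * s := by simp
      have e' : ε * cev 0 q (f + g + (w : CPoly) * .X none) = ε * cev 0 q f + ε * cev 0 q g := by
        simp; ring
      generalize f + g + (w : CPoly) * .X none = u at e e'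
      have e0 : cev s x u ≠ 0 := by
        refine h.ne _ 0 q hq hl fun h0 => ?_
        rw [h0, mul_zero] at e'
        exact h3.ne e'
      have i1 := ihl u g (by rw [e']; exact h3.le) h2 (by rw [e']; linarith) e0 hg
      have i2 := ihr f u h1 (by rw [e']; exact h3.le) (by rw [e']; linarith) hf e0
      rw [e] at i1 i2 e0
      exact ⟨e0, i1, i2⟩

theorem Generic.nz_strict (h : Generic S m s x) (q : Fin 3 → ℚ)
    (hq : ∀ c, c ∉ S → q c = 1) (hl : lf 0 q m = 0) (ε : ℚ) (T : BT) (f g : CPoly)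
    (h1 : 0 < ε * cev 0 q f) (h2 : 0 < ε * cev 0 q g) : T.NZ s (cev s x f) (cev s x g) :=
  h.nz q hq hl ε T f g h1.le h2.le (by linarith)
    (h.ne f 0 q hq hl fun h0 => by simp [h0] at h1)
    (h.ne g 0 q hq hl fun h0 => by simp [h0] at h2)

theorem Generic.nz_of_mem (h : Generic S m s x) {a b c : Fin 3} (t : Tri a b c) (ha : a ∈ S)
    (T : BT) : T.NZ s (x b) (x c) := by
  obtain ⟨-, h2, h3⟩ := update_tri t (fun _ => (1 : ℚ)) (-2)
  have := h.nz_strict _ (update_outside ha _)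
    (lf_negTwo m a) 1 T (.X (some b)) (.X (some c)) (by simp [h2]) (by simp [h3])
  simpa using this

theorem Generic.nz_of_mem_mem (h : Generic S m s x) {a b c : Fin 3} (t : Tri a b c) (hb : b ∈ S)
    (hc : c ∈ S) (T : BT) : T.NZ s (x b) (x c) := by
  obtain ⟨h1, h2, h3⟩ := update_tri t (fun _ => (-1 / 2 : ℚ)) 1
  have := h.nz_strict (Function.update (fun _ => (-1 / 2 : ℚ)) a 1) (fun i hi => ?_)
    (by rw [lf_eq _ _ t, h1, h2, h3]; norm_num) (-1) T (.X (some b)) (.X (some c))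
    (by simp only [cev_some, h2]; norm_num)
    (by simp only [cev_some, h3]; norm_num)
  · simpa using this
  · rcases t.eq_or i with rfl | rfl | rfl
    · exact h1
    · exact absurd hb hi
    · exact absurd hc hi

theorem good_of (h : ∀ a b c, Tri a b c → (bin b c (ch a)).NZ s (x b) (x c) ∨
    (bin c b (ch a)).NZ s (x c) (x b)) : Good s x ch := by
  intro a
  rcases h _ _ _ (Tri.base a) with h | h
  · exact h
  · rw [← flip_bin]; exact h.flip

theorem Generic.good_of_two (h : Generic S m s x) {e f : Fin 3} (hef : e ≠ f) (he : e ∈ S)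
    (hf : f ∈ S) : Good s x ch := by
  refine good_of fun a b c t => Or.inl ?_
  by_cases ha : a ∈ S
  · exact h.nz_of_mem t ha _
  · refine h.nz_of_mem_mem t ?_ ?_ _ <;>
    · rcases t.eq_or e with rfl | rfl | rfl <;> rcases t.eq_or f with rfl | rfl | rfl <;>
        first | assumption | contradiction

theorem Generic.wedge_ne (h : Generic S m s x) {a c : Fin 3} (hac : a ≠ c) (hS : a ∈ S ∨ c ∈ S)
    {u v : ℤ} (hu : 0 < u) (hv : 0 < v) : (u : F) * x c ≠ v * x a := by
  have hu' : (0 : ℚ) < u := by exact_mod_cast hu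
  have hv' : (0 : ℚ) < v := by exact_mod_cast hv
  have key : ∀ e, e ∈ S → (e = a ∨ e = c) → (u : F) * x c ≠ v * x a := by
    intro e he hor
    have := h.ne ((u : CPoly) * .X (some c) - v * .X (some a)) 0 _
      (update_outside he _) (lf_negTwo m e) ?_
    · simp only [map_sub, map_mul, map_intCast, cev_some] at this
      exact sub_ne_zero.1 this
    · simp only [map_sub, map_mul, map_intCast, cev_some]
      rcases hor with rfl | rfl
      · rw [Function.update_self, Function.update_of_ne hac.symm]; linarith
      · rw [Function.update_self, Function.update_of_ne hac]; linarith
  rcases hS with hS | hS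
  · exact key a hS (.inl rfl)
  · exact key c hS (.inr rfl)

/-- Nonvanishing at a corner when only one side factor, `x a`, is free. -/
theorem Generic.nz_of_singleton {a b c : Fin 3} (h : Generic {a} m s x) (t : Tri a b c) {T : BT}
    (hT : T.Ok) (hl : T.left < m ∨ ∀ w l r, T = .node w l r → l = .nil) :
    T.NZ s (x a) (x c) := by
  obtain ⟨-, -, q3⟩ := update_tri t (fun _ => (1 : ℚ)) (-2)
  have hq := update_outside (x := fun _ => (1 : ℚ)) (mem_singleton_self a) (-2)
  have hL := lf_negTwo m a
  have q1 : Function.update (fun _ => (1 : ℚ)) a (-2) a = -2 := Function.update_self ..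
  generalize Function.update (fun _ => (1 : ℚ)) a (-2) = q at *
  have hf : cev s x (.X (some a)) ≠ 0 := h.ne _ 0 q hq hL (by simp [q1])
  have hg : cev s x (.X (some c)) ≠ 0 := h.ne _ 0 q hq hL (by simp [q3])
  cases T with
  | nil => simp only [cev_some] at hf hg; exact ⟨hf, hg⟩
  | node w l r =>
    obtain ⟨u, hu⟩ : ∃ u : CPoly, u = .X (some a) + .X (some c) + (w : CPoly) * .X none := ⟨_, rfl⟩
    have eu : cev s x u = x a + x c + w * s := by simp [hu]
    have qu : cev 0 q u = -1 := by simp [hu, q1, q3]; norm_num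
    have hu0 : cev s x u ≠ 0 := h.ne _ 0 q hq hL (by rw [qu]; norm_num)
    have ir := h.nz_strict q hq hL (-1) r (.X (some a)) u (by simp [q1]) (by simp [qu])
    suffices il : l.NZ s (cev s x u) (cev s x (.X (some c))) by
      rw [eu, cev_some] at il ir
      rw [eu] at hu0
      exact ⟨hu0, il, ir⟩
    cases l with
    | nil => exact ⟨hu0, hg⟩
    | node w' l' r' =>
      have hlt : w + w' < m := by
        rcases hl with hl | hl
        · have := BT.left_nonneg (hT.2.2.1).2.2.1
          simp only [BT.left_node] at hl
          omega
        · exact absurd (hl _ _ _ rfl) (by simp)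
      obtain ⟨v, hv⟩ : ∃ v : CPoly, v = u + .X (some c) + (w' : CPoly) * .X none := ⟨_, rfl⟩
      have ev : cev s x v = cev s x u + cev s x (.X (some c)) + w' * s := by simp [hv]
      have qv : cev 0 q v = 0 := by simp [hv, qu, q3]
      have hv0 : cev s x v ≠ 0 := by
        obtain ⟨k1, k2, k3⟩ := update_tri t (fun _ => (1 : ℚ)) (-2 - m)
        refine h.ne _ 1 (Function.update (fun _ => 1) a (-2 - m))
          (update_outside (mem_singleton_self a) _) (by rw [lf_eq _ _ t, k1, k2, k3]; ring) ?_
        simp only [hv, hu, map_add, map_mul, cev_some, cev_none, map_intCast, k1, k3]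
        have : (w + w' : ℚ) < m := by exact_mod_cast hlt
        intro h0
        linarith
      have i1 := h.nz q hq hL 1 l' v (.X (some c)) (by simp [qv]) (by simp [q3])
        (by simp [qv, q3]) hv0 hg
      have i2 := h.nz q hq hL (-1) r' u v (by simp [qu]) (by simp [qv]) (by simp [qu, qv])
        hu0 hv0
      rw [ev] at i1 i2 hv0
      exact ⟨hv0, i1, i2⟩

end Generic

end Tr

/-! ### Euler characteristics -/

namespace Tr

/-- Indicator of the empty tree. -/
def e01 : Tr → ℤ
  | nil => 1
  | node _ _ => 0

/-- The Euler characteristic of a node with set `S` of labels on its path from the root. -/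
def chiS (S : Finset (Fin 3)) (m : ℤ) (ch : Fin 3 → Tr) : ℤ :=
  dd m ch - (∑ x, if x ∈ S then 0 else gap m ch x) + ∑ a, if S ⊆ {a} then e01 (ch a) else 0

theorem card_cases (S : Finset (Fin 3)) : S = ∅ ∨ (∃ a b c, Tri a b c ∧ S = {a}) ∨
    (∃ a b c, Tri a b c ∧ S = {a, b}) ∨ S = univ := by
  unfold Tri; revert S; decide

variable {a b c : Fin 3} {m : ℤ} {ch : Fin 3 → Tr}

theorem chiS_univ : chiS univ m ch = dd m ch := by
  have : ∀ a : Fin 3, ¬ (univ : Finset (Fin 3)) ⊆ {a} := by decide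
  simp [chiS, this]

theorem chiS_two (t : Tri a b c) : chiS {a, b} m ch = dd m ch - gap m ch c := by
  have : ∀ x : Fin 3, ¬ ({a, b} : Finset (Fin 3)) ⊆ {x} := by
    obtain ⟨h, -⟩ := t; revert a b; decide
  simp [chiS, this, t.sum, t.2.1.symm, t.2.2.symm]

theorem chiS_one (t : Tri a b c) :
    chiS {a} m ch = dd m ch - gap m ch b - gap m ch c + e01 (ch a) := by
  simp [chiS, t.sum, t.1, t.1.symm, t.2.1, t.2.1.symm, sub_sub]

theorem chiS_empty (t : Tri a b c) : chiS ∅ m ch =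
    dd m ch - gap m ch a - gap m ch b - gap m ch c + e01 (ch a) + e01 (ch b) + e01 (ch c) := by
  simp [chiS, t.sum]; ring

theorem ln_pos (b : Fin 3) {T : Tr} (h : T.Ok) (h0 : T ≠ nil) : 0 < ln b T := by
  by_contra hc
  exact h0 (eq_nil_of_ln h (not_lt.1 hc))

theorem e01_of_ne {T : Tr} (h0 : T ≠ nil) : e01 T = 0 := by
  cases T with
  | nil => contradiction
  | node m ch => rfl

theorem ln_nil (b : Fin 3) : ln b nil = 0 := rfl
theorem e01_nil : e01 nil = 1 := rfl

section Inequalities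

/-- A node with a single child. -/
theorem single_bounds (h : (node m ch).Ok) (t : Tri a b c) (ha : ch a = nil) (hb : ch b = nil)
    (hl : ¬ Leaf m ch c) : m ≤ dd m ch ∧ m - 1 ≤ dd m ch - gap m ch a ∧
      m - 1 ≤ dd m ch - gap m ch a - gap m ch b + e01 (ch c) := by
  obtain ⟨hm, -, -, -, -, k5, k6, -, k8, k9, -, -, k12⟩ := bounds h t
  have sd := sqa_diag h t
  have ga := gap_eq (m := m) (ch := ch) t
  have gb := gap_eq (m := m) (ch := ch) t.rot
  have hdd := dd_eq (m := m) (ch := ch) t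
  have hc := ln_pos (T := ch c) a (h.2.2 c)
  have hc' := ln_pos (T := ch c) b (h.2.2 c)
  rw [hb, ln_nil] at ga
  rw [ha, ln_nil] at gb
  rw [ha, hb] at hdd
  rw [hb, ln_nil] at k9
  rw [ha, ln_nil] at k8
  simp only [sqa] at hdd
  rw [ga, gb]
  by_cases hn : ch c = nil
  · rw [hn] at hdd ⊢
    simp only [ln_nil, e01_nil, sqa] at hdd ⊢
    refine ⟨?_, ?_, ?_⟩
    · nlinarith
    · nlinarith
    · rcases (by omega : m = 1 ∨ 2 ≤ m) with rfl | h2 <;> nlinarith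
  · have e0 := e01_of_ne hn
    rw [e0]
    generalize ln a (ch c) = p at *
    generalize ln b (ch c) = q at *
    have hp := hc hn
    have hq := hc' hn
    by_cases hpq : p = m ∧ q = m
    · obtain ⟨rfl, rfl⟩ := hpq
      obtain ⟨-, -, sd⟩ := sd rfl rfl
      have sd := sd.resolve_left hl
      refine ⟨?_, ?_, ?_⟩ <;> linarith
    · rcases (by omega : p ≤ m - 1 ∨ q ≤ m - 1) with hlt | hlt
      · refine ⟨?_, ?_, ?_⟩
        · nlinarith
        · rcases eq_or_lt_of_le (by omega : q ≤ m) with rfl | hq'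
          · nlinarith
          · nlinarith [mul_nonneg (by omega : 0 ≤ m - 1 - q) (by omega : 0 ≤ m - 1),
              mul_nonneg hq.le (by omega : 0 ≤ m - p)]
        · nlinarith [mul_nonneg (by omega : 0 ≤ m - 1 - p) (by omega : 0 ≤ q - 1),
              mul_nonneg (by omega : 0 ≤ m - q) (by omega : 0 ≤ m - 2)]
      · refine ⟨?_, ?_, ?_⟩
        · nlinarith
        · nlinarith [mul_nonneg (by omega : 0 ≤ m - 1 - q) (by omega : 0 ≤ m - 1),
              mul_nonneg hq.le (by omega : 0 ≤ m - p)]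
        · nlinarith [mul_nonneg (by omega : 0 ≤ m - 1 - q) (by omega : 0 ≤ p - 1),
              mul_nonneg (by omega : 0 ≤ m - p) (by omega : 0 ≤ m - 2)]

/-- A node without child along `a`. -/
theorem two_bound (h : (node m ch).Ok) (t : Tri a b c) (ha : ch a = nil) (hD : 0 < dd m ch) :
    gap m ch b + gap m ch c ≤ dd m ch + 1 ∧ (gap m ch b + gap m ch c = dd m ch + 1 →
      dd m ch = gap m ch b ∧ gap m ch c = 1 ∨ dd m ch = gap m ch c ∧ gap m ch b = 1) := by
  obtain ⟨hm, -, -, k3, k4, k5, k6, -, k8, k9, -, k11, k12⟩ := bounds h t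
  have hb := (gap_le_dd h hD b).1
  have hc := (gap_le_dd h hD c).1
  have g1 := gap_nonneg h b
  have g2 := gap_nonneg h c
  have gb := gap_eq (m := m) (ch := ch) t.rot
  have gc := gap_eq (m := m) (ch := ch) t.rot.rot
  have hdd := dd_eq (m := m) (ch := ch) t
  rw [ha] at hdd
  rw [ha, ln_nil] at gb gc
  simp only [sqa] at hdd
  generalize gap m ch b = l at *
  generalize gap m ch c = k at *
  generalize dd m ch = D at *
  have e' : ln a (ch c) = m - l := by omega
  have e : ln a (ch b) = m - k := by omega
  rw [e'] at k12 k5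
  rw [e] at k11 k3
  generalize ln c (ch b) = q at *
  generalize ln b (ch c) = q' at *
  have key : k * q + l * (m - q) ≤ D := by nlinarith [mul_nonneg k5 (by omega : 0 ≤ m - q - q')]
  rcases eq_or_lt_of_le g1 with rfl | g1
  · exact ⟨by omega, by omega⟩
  rcases eq_or_lt_of_le g2 with rfl | g2
  · exact ⟨by omega, by omega⟩
  rcases eq_or_lt_of_le k4 with rfl | hq
  · have h1 : k + l ≤ D + 1 := by nlinarith [mul_nonneg (by omega : 0 ≤ l - 1) (by omega : 0 ≤ m - 1)]
    refine ⟨by omega, fun e => ?_⟩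
    rcases eq_or_lt_of_le (by omega : 1 ≤ l) with rfl | h2
    · omega
    rcases eq_or_lt_of_le (by omega : 1 ≤ m) with rfl | h3
    · omega
    nlinarith [mul_pos (by omega : 0 < l - 1) (by omega : 0 < m - 1)]
  rcases eq_or_lt_of_le (by omega : q ≤ m) with rfl | hq'
  · have h1 : k + l ≤ D + 1 := by nlinarith [mul_nonneg (by omega : 0 ≤ k - 1) (by omega : 0 ≤ q - 1)]
    refine ⟨by omega, fun e => ?_⟩
    rcases eq_or_lt_of_le (by omega : 1 ≤ k) with rfl | h2
    · omega
    rcases eq_or_lt_of_le (by omega : 1 ≤ q) with rfl | h3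
    · omega
    nlinarith [mul_pos (by omega : 0 < k - 1) (by omega : 0 < q - 1)]
  · have : k + l ≤ D := by
      nlinarith [mul_nonneg g2.le (by omega : 0 ≤ q - 1), mul_nonneg g1.le (by omega : 0 ≤ m - q - 1)]
    exact ⟨by omega, by omega⟩

/-- A node with a child along `a`. -/
theorem two_bound_of_child (h : (node m ch).Ok) (t : Tri a b c) (ha : ch a ≠ nil)
    (hD : 0 < dd m ch) :
    gap m ch b + gap m ch c ≤ dd m ch ∧ (gap m ch b + gap m ch c = dd m ch →
      dd m ch = gap m ch b ∨ dd m ch = gap m ch c) := by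
  obtain ⟨hm, -, -, k3, k4, k5, k6, -, k8, k9, k10, k11, k12⟩ := bounds h t
  have hb := (gap_le_dd h hD b).1
  have hc := (gap_le_dd h hD c).1
  have g1 := gap_nonneg h b
  have g2 := gap_nonneg h c
  have gb := gap_eq (m := m) (ch := ch) t.rot
  have gc := gap_eq (m := m) (ch := ch) t.rot.rot
  have hdd := dd_eq (m := m) (ch := ch) t
  have p1 := ln_pos b (h.2.2 a) ha
  have p2 := ln_pos c (h.2.2 a) ha
  generalize gap m ch b = l at *
  generalize gap m ch c = k at *
  generalize dd m ch = D at *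
  rcases eq_or_lt_of_le g1 with rfl | g1
  · exact ⟨by omega, by omega⟩
  rcases eq_or_lt_of_le g2 with rfl | g2
  · exact ⟨by omega, by omega⟩
  suffices h : k + l < D from ⟨by omega, by omega⟩
  generalize ln b (ch a) = u at *
  generalize ln c (ch a) = v at *
  have e1 : ln a (ch c) = m - l - v := by omega
  have e2 : ln a (ch b) = m - k - u := by omega
  rw [e1] at k12 k5
  rw [e2] at k11 k3
  generalize ln c (ch b) = q at *
  generalize ln b (ch c) = q' at *
  have key : m ^ 2 - u * v - (m - k - u) * q - (m - l - v) * (m - q) ≤ D := by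
    nlinarith [mul_nonneg k5 (by omega : 0 ≤ m - q - q')]
  have f0 : k + l < m ^ 2 - u * v - (m - l - v) * m := by
    have : 0 ≤ v * (m - u - k) := mul_nonneg p2.le (by omega)
    nlinarith [mul_pos g1 p2, mul_pos g2 p2]
  have fm : k + l < m ^ 2 - u * v - (m - k - u) * m := by
    have : 0 ≤ u * (m - v - l) := mul_nonneg p1.le (by omega)
    nlinarith [mul_pos g1 p1, mul_pos g2 p1]
  have hq : q ≤ m := by omega
  have : m * (k + l) < m * D := by
    rcases eq_or_lt_of_le k4 with rfl | hq0
    · nlinarith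
    · nlinarith [mul_pos hq0 (sub_pos.2 fm), mul_nonneg (by omega : 0 ≤ m - q) (sub_pos.2 f0).le]
  exact lt_of_mul_lt_mul_left this hm.le

theorem root_two (h : (node m ch).Ok) (t : Tri a b c) (ha : ch a = nil) (hb : ch b ≠ nil)
    (hc : ch c ≠ nil) : gap m ch a + gap m ch b + gap m ch c ≤ dd m ch := by
  obtain ⟨hm, -, -, k3, k4, k5, k6, -, k8, k9, -, k11, k12⟩ := bounds h t
  have g := gap_nonneg h a
  have g1 := gap_nonneg h b
  have g2 := gap_nonneg h c
  have ga := gap_eq (m := m) (ch := ch) t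
  have gb := gap_eq (m := m) (ch := ch) t.rot
  have gc := gap_eq (m := m) (ch := ch) t.rot.rot
  have hdd := dd_eq (m := m) (ch := ch) t
  have p1 := ln_pos c (h.2.2 b) hb
  have p2 := ln_pos b (h.2.2 c) hc
  rw [ha] at hdd
  rw [ha, ln_nil] at gb gc
  simp only [sqa] at hdd
  generalize gap m ch a = j at *
  generalize gap m ch b = l at *
  generalize gap m ch c = k at *
  have e1 : ln a (ch c) = m - l := by omega
  have e2 : ln a (ch b) = m - k := by omega
  rw [e1] at k12
  rw [e2] at k11
  generalize ln c (ch b) = q at *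
  generalize ln b (ch c) = q' at *
  obtain rfl : m = j + q + q' := by omega
  nlinarith [mul_nonneg g hm.le, mul_nonneg g1 (by omega : 0 ≤ q - 1),
    mul_nonneg g1 (by omega : 0 ≤ q' - 1), mul_nonneg g2 (by omega : 0 ≤ q - 1),
    mul_nonneg g (by omega : 0 ≤ j + q + q' - 1)]

theorem root_three (h : (node m ch).Ok) (t : Tri a b c) (ha : ch a ≠ nil) (hb : ch b ≠ nil)
    (hc : ch c ≠ nil) : gap m ch a + gap m ch b + gap m ch c < dd m ch := by
  obtain ⟨hm, -, -, k3, k4, k5, k6, -, k8, k9, k10, k11, k12⟩ := bounds h t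
  have g := gap_nonneg h a
  have g1 := gap_nonneg h b
  have g2 := gap_nonneg h c
  have ga := gap_eq (m := m) (ch := ch) t
  have gb := gap_eq (m := m) (ch := ch) t.rot
  have gc := gap_eq (m := m) (ch := ch) t.rot.rot
  have hdd := dd_eq (m := m) (ch := ch) t
  have a1 := ln_pos b (h.2.2 a) ha
  have a2 := ln_pos c (h.2.2 a) ha
  have b1 := ln_pos a (h.2.2 b) hb
  have b2 := ln_pos c (h.2.2 b) hb
  have c1 := ln_pos a (h.2.2 c) hc
  have c2 := ln_pos b (h.2.2 c) hc
  generalize gap m ch a = j at *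
  generalize gap m ch b = l at *
  generalize gap m ch c = k at *
  generalize ln b (ch a) = u at *
  generalize ln a (ch b) = u' at *
  generalize ln c (ch a) = v at *
  generalize ln a (ch c) = v' at *
  generalize ln c (ch b) = w at *
  generalize ln b (ch c) = w' at *
  have eu : m = u + u' + k := by omega
  have ev : m = v + v' + l := by omega
  have ew : m = w + w' + j := by omega
  have hk : (m ^ 2 - u * v - u' * w - v' * w') * m = u * v' * w + u' * v * w'
      + j * (u * v' + u' * v + u' * v') + k * (v * w + v * w' + v' * w)
      + l * (u * w + u * w' + u' * w')
      + k * l * (w + w') + k * j * (v + v') + l * j * (u + u') + j * k * l := by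
    have : (m ^ 2 - u * v - u' * w - v' * w') * m =
      (u + u' + k) * (v + v' + l) * (w + w' + j) - u * v * (w + w' + j)
        - u' * w * (v + v' + l) - v' * w' * (u + u' + k) := by
      rw [← eu, ← ev, ← ew]; ring
    rw [this]; ring
  have q1 : j * (u + u') ≤ j * (u * v' + u' * v + u' * v') :=
    mul_le_mul_of_nonneg_left (by nlinarith) g
  have q2 : k * (v + v') ≤ k * (v * w + v * w' + v' * w) :=
    mul_le_mul_of_nonneg_left (by nlinarith) g2
  have q3 : l * (w + w') ≤ l * (u * w + u * w' + u' * w') :=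
    mul_le_mul_of_nonneg_left (by nlinarith) g1
  have q4 : k * l ≤ k * l * (w + w') := le_mul_of_one_le_right (mul_nonneg g2 g1) (by omega)
  have q5 : k * j ≤ k * j * (v + v') := le_mul_of_one_le_right (mul_nonneg g2 g) (by omega)
  have q6 : l * j ≤ l * j * (u + u') := le_mul_of_one_le_right (mul_nonneg g1 g) (by omega)
  have q7 : 0 ≤ j * k * l := mul_nonneg (mul_nonneg g g2) g1
  have q8 : 0 < u * v' * w := mul_pos (mul_pos a1 c1) b2
  have q9 : 0 < u' * v * w' := mul_pos (mul_pos b1 a2) c2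
  have e : (j + l + k) * m = j * (u + u') + k * j + l * (w + w') + l * j + k * (v + v') + k * l := by
    have : (j + l + k) * m = j * (u + u' + k) + l * (w + w' + j) + k * (v + v' + l) := by
      rw [← eu, ← ev, ← ew]; ring
    rw [this]; ring
  have hlt : (j + l + k) * m < (m ^ 2 - u * v - u' * w - v' * w') * m := by
    rw [hk, e]; linarith
  have := lt_of_mul_lt_mul_right hlt hm.le
  rw [mul_comm w u', mul_comm] at k11
  nlinarith

end Inequalities

end Tr

/-! ### Vanishing residues at nodes of Euler characteristic zero -/

namespace Tr

section Nodes

variable {F : Type} [Field F] {s : F} {x : Fin 3 → F} {S : Finset (Fin 3)}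
  {a b c : Fin 3} {m : ℤ} {ch : Fin 3 → Tr}

theorem Generic.good_of_one (h : Generic {a} m s x) (hOk : (node m ch).Ok) (t : Tri a b c)
    (hb : ln a (ch b) < m ∨ ∀ w l r, bin a c (ch b) = .node w l r → l = .nil)
    (hc : ln a (ch c) < m ∨ ∀ w l r, bin a b (ch c) = .node w l r → l = .nil) :
    Good s x ch := by
  have hB := h.nz_of_singleton t ((hOk.2.2 b).bin t.2.1) (by rwa [left_bin])
  have hC := h.nz_of_singleton t.swap.rot ((hOk.2.2 c).bin t.1) (by rwa [left_bin])
  have key : ∀ {a b c}, Tri a b c → (bin b c (ch a)).NZ s (x b) (x c) →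
      (bin (a + 1) (a + 2) (ch a)).NZ s (x (a + 1)) (x (a + 2)) := by
    intro a b c t h
    rcases t.shift with ⟨rfl, rfl⟩ | ⟨rfl, rfl⟩
    · exact h
    · rw [← flip_bin]; exact h.flip
  intro i
  rcases t.eq_or i with rfl | rfl | rfl
  · exact h.nz_of_mem (Tri.base i) (mem_singleton_self i) _
  · exact key t.swap hB
  · exact key t.rot.rot hC

theorem Generic.good_leaf (h : Generic S m s x) (hS : S.Nonempty) (hOk : (node m ch).Ok)
    (hl : Leaf m ch c) : Good s x ch := by
  obtain ⟨h1, ch', h2, h3⟩ := hl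
  rcases card_cases S with rfl | ⟨a, b, d, t, rfl⟩ | ⟨a, b, d, t, rfl⟩ | rfl
  · simp at hS
  · have key : ∀ b d, Tri a b d →
        ln a (ch b) < m ∨ ∀ w l r, bin a d (ch b) = .node w l r → l = .nil := by
      intro b d t
      by_cases hb : b = c
      · subst hb
        right
        intro w l r e
        rw [h2, bin, h3 a t.1] at e
        exact ((BT.node.injEq ..).mp e).2.1.symm
      · left
        rw [h1 b hb]
        exact hOk.1
    exact h.good_of_one hOk t (key _ _ t) (key _ _ t.swap.rot)
  · exact h.good_of_two t.1 (by simp) (by simp)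
  · exact h.good_of_two (e := 0) (f := 1) (by decide) (by simp) (by simp)

theorem Generic.resid_leaf (h : Generic S m s x) (hS : S.Nonempty) (hOk : (node m ch).Ok)
    (hl : Leaf m ch c) : Good s x ch ∧ resid s x m ch = 0 := by
  have hg := h.good_leaf hS hOk hl
  have t := (Tri.base c).rot
  refine ⟨hg, Tr.resid_leaf hl t hg ?_⟩
  rw [← lf_eq s x t]
  exact h.2.1

theorem Leaf.dd (h : Leaf m ch c) : dd m ch = 0 := (dd_leaf h (Tri.base c).rot).1

theorem Leaf.gap (h : Leaf m ch c) {i : Fin 3} (hi : i ≠ c) : gap m ch i = 0 := by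
  have := dd_leaf h (Tri.base c).rot
  rcases (Tri.base c).rot.eq_or i with rfl | rfl | rfl
  · exact this.2.1
  · exact this.2.2.1
  · exact absurd rfl hi

theorem Leaf.gap_self (h : Leaf m ch c) : Tr.gap m ch c = m :=
  (dd_leaf h (Tri.base c).rot).2.2.2

theorem Leaf.ne_nil (h : Leaf m ch c) : ch c ≠ nil := by
  obtain ⟨-, ch', h, -⟩ := h
  simp [h]

theorem Generic.resid_thin (hs : s + 1 ≠ 0) (h : Generic S m s x) (hOk : (node m ch).Ok)
    (hD : 0 < dd m ch) (hc : c ∉ S) (he : dd m ch = gap m ch c) (hg : Good s x ch) :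
    resid s x m ch = 0 := by
  obtain ⟨a, b, t, ht⟩ := (gap_le_dd hOk hD c).2 he
  exact Tr.resid_thin hs ht t he hg (h.1 c hc) (by rw [← lf_eq s x t]; exact h.2.1)

theorem Generic.resid_wedge (h : Generic S m s x) (hOk : (node m ch).Ok) (hw : Wedge m ch a b c)
    (hS : a ∈ S ∨ c ∈ S) (hg : Good s x ch) : resid s x m ch = 0 := by
  have t := hw.1
  refine Tr.resid_wedge hOk hw hg (by rw [← lf_eq s x t]; exact h.2.1) ?_
  exact h.wedge_ne t.2.1 hS hw.2.2.2.2.2.2.1 hw.2.2.2.2.2.1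

theorem e01_nonneg (T : Tr) : 0 ≤ e01 T := by
  cases T <;> simp [e01]

theorem ne_nil_of_e01 {T : Tr} (h : e01 T = 0) : T ≠ nil := by
  rintro rfl
  simp [e01] at h

theorem dd_eq_zero_cases (h : (node m ch).Ok) (h0 : dd m ch = 0) (hl : ∀ c, c ∉ S → ¬ Leaf m ch c) :
    (∃ c ∈ S, Leaf m ch c) ∨ ∃ a b c, Wedge m ch a b c := by
  rcases dd_eq_zero h h0 with ⟨c, hc⟩ | h
  · exact .inl ⟨c, by_contra fun h => hl c h hc, hc⟩
  · exact .inr h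

theorem chiS_nonneg (h : (node m ch).Ok) (hS : S.Nonempty) (hl : ∀ c, c ∉ S → ¬ Leaf m ch c) :
    0 ≤ chiS S m ch ∧ (chiS S m ch = 0 → ∀ (F : Type) [Field F] (s : F) (x : Fin 3 → F),
      s + 1 ≠ 0 → Generic S m s x → Good s x ch ∧ resid s x m ch = 0) := by
  have hD := dd_nonneg h
  rcases card_cases S with rfl | ⟨a, b, c, t, rfl⟩ | ⟨a, b, c, t, rfl⟩ | rfl
  · simp at hS
  · have good : ∀ {F : Type} [Field F] {s : F} {x : Fin 3 → F}, Generic {a} m s x →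
        (ch a = nil → 0 < gap m ch b ∧ 0 < gap m ch c) → Good s x ch := by
      intro F _ s x hx hg
      have g1 := gap_eq (m := m) (ch := ch) t.rot
      have g2 := gap_eq (m := m) (ch := ch) t.rot.rot
      have n1 := h.2.1 _ _ t.1
      have n2 := h.2.1 _ _ t.2.1
      have h1 : ln a (ch b) < m ∧ ln a (ch c) < m := by
        by_cases ha : ch a = nil
        · rw [ha, ln_nil] at g1 g2
          have := hg ha
          omega
        · have := ln_pos b (h.2.2 a) ha
          have := ln_pos c (h.2.2 a) ha
          omega
      exact hx.good_of_one h t (.inl h1.1) (.inl h1.2)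
    have hb : b ∉ ({a} : Finset (Fin 3)) := by simpa using t.1.symm
    have hc : c ∉ ({a} : Finset (Fin 3)) := by simpa using t.2.1.symm
    rw [chiS_one t]
    rcases hD.eq_or_lt' with hD | hD
    · rcases dd_eq_zero_cases h hD hl with ⟨i, hi, hi'⟩ | ⟨a', b', c', hw⟩
      · obtain rfl := mem_singleton.1 hi
        rw [hD, hi'.gap t.1.symm, hi'.gap t.2.1.symm, e01_of_ne hi'.ne_nil]
        exact ⟨by simp, fun _ F _ s x hs hx => hx.resid_leaf hS h hi'⟩
      · rw [hD, gap_wedge hw, gap_wedge hw]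
        refine ⟨by simpa using e01_nonneg _, fun he F _ s x hs hx => ?_⟩
        have ha := ne_nil_of_e01 (by simpa using he)
        have hg := good hx fun h => absurd h ha
        refine ⟨hg, hx.resid_wedge h hw ?_ hg⟩
        rcases hw.1.eq_or a with rfl | rfl | rfl
        · simp
        · exact absurd hw.2.1 ha
        · simp
    · by_cases ha : ch a = nil
      · obtain ⟨h1, h2⟩ := two_bound h t ha hD
        rw [ha, e01_nil]
        refine ⟨by linarith, fun he F _ s x hs hx => ?_⟩
        have h2 := h2 (by linarith)
        have hg := good hx fun _ => by omega
        refine ⟨hg, ?_⟩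
        rcases h2 with h2 | h2
        · exact hx.resid_thin hs h hD hb h2.1 hg
        · exact hx.resid_thin hs h hD hc h2.1 hg
      · obtain ⟨h1, h2⟩ := two_bound_of_child h t ha hD
        rw [e01_of_ne ha]
        refine ⟨by linarith, fun he F _ s x hs hx => ?_⟩
        have hg := good hx fun h => absurd h ha
        refine ⟨hg, ?_⟩
        rcases h2 (by linarith) with h2 | h2
        · exact hx.resid_thin hs h hD hb h2 hg
        · exact hx.resid_thin hs h hD hc h2 hg
  · have hc : c ∉ ({a, b} : Finset (Fin 3)) := by simpa using ⟨t.2.1.symm, t.2.2.symm⟩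
    have good : ∀ {F : Type} [Field F] {s : F} {x : Fin 3 → F}, Generic {a, b} m s x →
        Good s x ch := fun hx => hx.good_of_two t.1 (by simp) (by simp)
    rw [chiS_two t]
    rcases hD.eq_or_lt' with hD | hD
    · rcases dd_eq_zero_cases h hD hl with ⟨i, hi, hi'⟩ | ⟨a', b', c', hw⟩
      · rw [hD, hi'.gap (by rintro rfl; exact hc hi)]
        exact ⟨by simp, fun _ F _ s x hs hx => hx.resid_leaf hS h hi'⟩
      · rw [hD, gap_wedge hw]
        refine ⟨by simp, fun _ F _ s x hs hx => ⟨good hx, hx.resid_wedge h hw ?_ (good hx)⟩⟩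
        have := hw.1.2.1
        rcases t.eq_or a' with rfl | rfl | rfl
        · simp
        · simp
        · rcases t.eq_or c' with rfl | rfl | rfl
          · simp
          · simp
          · exact absurd rfl this
    · refine ⟨by linarith [(gap_le_dd h hD c).1], fun he F _ s x hs hx => ⟨good hx, ?_⟩⟩
      exact hx.resid_thin hs h hD hc (by linarith) (good hx)
  · have good : ∀ {F : Type} [Field F] {s : F} {x : Fin 3 → F}, Generic univ m s x →
        Good s x ch := fun hx => hx.good_of_two (e := 0) (f := 1) (by decide) (by simp) (by simp)
    rw [chiS_univ]
    refine ⟨hD, fun hD F _ s x hs hx => ?_⟩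
    rcases dd_eq_zero_cases h hD hl with ⟨i, hi, hi'⟩ | ⟨a', b', c', hw⟩
    · exact hx.resid_leaf hS h hi'
    · exact ⟨good hx, hx.resid_wedge h hw (by simp) (good hx)⟩

end Nodes

end Tr

/-! ### The sum of Euler characteristics controls the pole -/

namespace Tr

variable {S : Finset (Fin 3)} {N ν : Fin 3 → ℤ} {m : ℤ} {ch : Fin 3 → Tr} {b : ℤ} {s₀ : ℚ}

/-- Sum of the Euler characteristics of the nodes whose multiplicity is divisible by `b`. -/
def Xs (b : ℤ) : Finset (Fin 3) → (Fin 3 → ℤ) → Tr → ℤ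
  | _, _, nil => 0
  | S, N, node m ch => (if b ∣ lf 1 N m then chiS S m ch else 0)
      + ∑ a, Xs b (insert a S) (Function.update N a (lf 1 N m)) (ch a)

/-- The properties of `s₀` following from its being a rational number with denominator `b ≥ 2`. -/
def Admissible (b : ℤ) (s₀ : ℚ) : Prop :=
  s₀ + 1 ≠ 0 ∧ (∀ N ν : ℤ, N * s₀ + ν = 0 → b ∣ N) ∧ ∀ N : ℤ, b ∣ N → ∃ k : ℤ, N * s₀ = k

/-- The values at `s₀` of linear factors with the given numerical data. -/
def pt (s₀ : ℚ) (N ν : Fin 3 → ℤ) (a : Fin 3) : ℚ := N a * s₀ + ν a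

theorem lf_pt : lf s₀ (pt s₀ N ν) m = (lf 1 N m : ℤ) * s₀ + (∑ a, ν a : ℤ) := by
  simp only [lf, pt, Fin.sum_univ_three]
  push_cast
  ring

theorem update_pt (a : Fin 3) : Function.update (pt s₀ N ν) a (lf s₀ (pt s₀ N ν) m) =
    pt s₀ (Function.update N a (lf 1 N m)) (Function.update ν a (∑ a, ν a)) := by
  funext i
  rcases eq_or_ne i a with rfl | h
  · simp only [pt, Function.update_self]
    exact lf_pt
  · simp [pt, h]

/-- The sides outside `S` are the original ones. -/
def Std (S : Finset (Fin 3)) (N ν : Fin 3 → ℤ) : Prop := ∀ a, a ∉ S → N a = 0 ∧ ν a = 1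

theorem Std.insert (h : Std S N ν) (a : Fin 3) (y z : ℤ) :
    Std (insert a S) (Function.update N a y) (Function.update ν a z) := by
  intro i hi
  rw [mem_insert, not_or] at hi
  rw [Function.update_of_ne hi.1, Function.update_of_ne hi.1]
  exact h i hi.2

theorem regular (hs : Admissible b s₀) (hL : (lf 1 N m : ℤ) * s₀ + (∑ a, ν a : ℤ) ≠ 0)
    (h : ∀ a, Claim s₀ (insert a S)
      (pt s₀ (Function.update N a (lf 1 N m)) (Function.update ν a (∑ a, ν a))) (ch a)) :
    Claim s₀ S (pt s₀ N ν) (node m ch) := by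
  refine claim_regular hs.1 (by rwa [lf_pt]) fun a => ?_
  rw [update_pt]
  exact h a

theorem singular (hs : Admissible b s₀) (hS : S.Nonempty)
    (H : ∀ (F : Type) [Field F] (s : F) (x : Fin 3 → F), s + 1 ≠ 0 → Generic S m s x →
      Good s x ch ∧ resid s x m ch = 0)
    (h : ∀ a, Claim s₀ (insert a S)
      (pt s₀ (Function.update N a (lf 1 N m)) (Function.update ν a (∑ a, ν a))) (ch a)) :
    Claim s₀ S (pt s₀ N ν) (node m ch) := by
  obtain ⟨e, he⟩ := hS
  refine claim_singular hs.1 he H fun a => ?_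
  rw [update_pt]
  exact h a

/-- The Euler characteristic missing at the bottom of a chain of leaves. -/
def defect (S : Finset (Fin 3)) (m : ℤ) : ℤ := if S = univ then m else m - 1

theorem tri_ne_univ {a b c : Fin 3} (t : Tri a b c) :
    ({a} : Finset (Fin 3)) ≠ univ ∧ ({a, b} : Finset (Fin 3)) ≠ univ ∧
      ({c, a, b} : Finset (Fin 3)) = univ := by
  unfold Tri at t; revert a b c; decide

theorem chiS_leaf {c : Fin 3} (h : Leaf m ch c) (hc : c ∉ S) (hS : S.Nonempty) :
    chiS S m ch = -defect (insert c S) m := by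
  rcases card_cases S with rfl | ⟨a, b, d, t, rfl⟩ | ⟨a, b, d, t, rfl⟩ | rfl
  · simp at hS
  · have key : ∀ {b d}, Tri a b d → c = b → chiS {a} m ch = -defect {c, a} m := by
      rintro b d t rfl
      rw [chiS_one t, h.dd, h.gap_self, h.gap t.2.2.symm, h.1 a t.1, e01_nil, defect,
        if_neg (tri_ne_univ t.swap).2.1]
      ring
    have hca : c ≠ a := by simpa using hc
    rcases t.eq_or c with hc | hc | hc
    · exact absurd hc hca
    · exact key t hc
    · exact key t.swap.rot hc
  · obtain rfl : c = d := by
      rcases t.eq_or c with rfl | rfl | rfl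
      · simp at hc
      · simp at hc
      · rfl
    rw [chiS_two t, h.dd, h.gap_self, defect, if_pos (tri_ne_univ t).2.2]
    ring
  · simp at hc

theorem defect_le {e : Fin 3} (h : (node m ch).Ok) (he : e ∈ S) (hn : ∀ f, f ≠ e → ch f = nil)
    (hl : ¬ Leaf m ch e) : defect S m ≤ chiS S m ch := by
  rcases card_cases S with rfl | ⟨a, b, c, t, rfl⟩ | ⟨a, b, c, t, rfl⟩ | rfl
  · simp at he
  · obtain rfl := mem_singleton.1 he
    rw [chiS_one t, defect, if_neg (tri_ne_univ t).1]
    exact (single_bounds h t.rot (hn _ t.1.symm) (hn _ t.2.1.symm) hl).2.2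
  · rw [chiS_two t, defect, if_neg (tri_ne_univ t).2.1]
    rcases mem_insert.1 he with rfl | he
    · exact (single_bounds h t.rot.swap (hn _ t.2.1.symm) (hn _ t.1.symm) hl).2.1
    · obtain rfl := mem_singleton.1 he
      exact (single_bounds h t.rot.rot (hn _ t.2.2.symm) (hn _ t.1) hl).2.1
  · rw [chiS_univ, defect, if_pos rfl]
    have t := (Tri.base e).rot
    exact (single_bounds h t (hn _ t.2.1) (hn _ t.2.2) hl).1

theorem chiS_leaf_mem {e : Fin 3} (h : Leaf m ch e) (he : e ∈ S) : chiS S m ch = 0 := by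
  rcases card_cases S with rfl | ⟨a, b, c, t, rfl⟩ | ⟨a, b, c, t, rfl⟩ | rfl
  · simp at he
  · obtain rfl := mem_singleton.1 he
    rw [chiS_one t, h.dd, h.gap t.1.symm, h.gap t.2.1.symm, e01_of_ne h.ne_nil]; rfl
  · rw [chiS_two t, h.dd, h.gap]; · rfl
    rintro rfl
    simp [t.2.1.symm, t.2.2.symm] at he
  · rw [chiS_univ, h.dd]

/-- The conclusion for an arbitrary subtree. -/
def Bound (b : ℤ) (s₀ : ℚ) (T : Tr) : Prop :=
  ∀ (S : Finset (Fin 3)) (N ν : Fin 3 → ℤ), S.Nonempty → Std S N ν →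
    0 ≤ Xs b S N T ∧ (Xs b S N T = 0 → Claim s₀ S (pt s₀ N ν) T)

/-- The sharper conclusion after a chain of leaves. -/
def ChainBound (b : ℤ) (s₀ : ℚ) (T : Tr) : Prop :=
  ∀ (S : Finset (Fin 3)) (N ν : Fin 3 → ℤ) (m : ℤ) (ch : Fin 3 → Tr) (e : Fin 3) (q c v : ℤ),
    T = node m ch → Std S N ν → (∀ f, f ≠ e → ch f = nil) → e ∈ S → 0 < q → b ∣ c →
    lf 1 N m = (q + 1) * c → N e = q * c → ν e = q * v - (q - 1) → ∑ a, ν a = (q + 1) * v - q →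
    defect S m ≤ Xs b S N T ∧ (Xs b S N T = defect S m → Claim s₀ S (pt s₀ N ν) T)

theorem Xs_nil : Xs b S N nil = 0 := rfl

theorem sum_nonneg_cases {f : Fin 3 → ℤ} (h : ∀ a, 0 ≤ f a) :
    0 ≤ ∑ a, f a ∧ (∑ a, f a = 0 → ∀ a, f a = 0) :=
  ⟨sum_nonneg fun a _ => h a, fun h0 a =>
    (sum_eq_zero_iff_of_nonneg fun a _ => h a).1 h0 a (mem_univ a)⟩

theorem chainBound_node (hs : Admissible b s₀) (hOk : (node m ch).Ok)
    (hB : ∀ a, Bound b s₀ (ch a)) (hC : ∀ a, ChainBound b s₀ (ch a)) :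
    ChainBound b s₀ (node m ch) := by
  rintro S N ν m' ch' e q c v hT hstd hn he hq hbc hN hNe hve hv
  obtain ⟨rfl, rfl⟩ := (node.injEq ..).mp hT
  have hL : (lf 1 N m : ℤ) * s₀ + (∑ a, ν a : ℤ) ≠ 0 := by
    obtain ⟨k, hk⟩ := hs.2.2 c hbc
    rw [hN, hv]
    push_cast
    intro h0
    have h1 : ((q : ℚ) + 1) * (k + v) = q := by rw [← hk]; linarith
    have h2 : (q + 1) * (k + v) = q := by exact_mod_cast h1
    have h3 : q + 1 ∣ q := ⟨_, h2.symm⟩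
    have := Int.le_of_dvd hq h3
    omega
  have hdvd : b ∣ lf 1 N m := by rw [hN]; exact hbc.mul_left _
  have hX : Xs b S N (node m ch) =
      chiS S m ch + Xs b S (Function.update N e (lf 1 N m)) (ch e) := by
    rw [Xs, if_pos hdvd, sum_eq_single e, insert_eq_of_mem he]
    · intro f _ hf
      rw [hn f hf, Xs_nil]
    · simp
  have hreg : Claim s₀ S (pt s₀ (Function.update N e (lf 1 N m))
      (Function.update ν e (∑ a, ν a))) (ch e) → Claim s₀ S (pt s₀ N ν) (node m ch) := by
    intro h
    refine regular hs hL fun a => ?_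
    by_cases ha : a = e
    · subst ha
      rwa [insert_eq_of_mem he]
    · rw [hn a ha]
      exact claim_nil ..
  have hstd' := hstd.insert e (lf 1 N m) (∑ a, ν a)
  rw [insert_eq_of_mem he] at hstd'
  rw [hX]
  by_cases hl : Leaf m ch e
  · rw [chiS_leaf_mem hl he, zero_add]
    obtain ⟨-, ch', h2, h3⟩ := hl
    have t := Tri.base e
    obtain ⟨u1, u2, u3⟩ := update_tri t N (lf 1 N m)
    obtain ⟨w1, w2, w3⟩ := update_tri t ν (∑ a, ν a)
    have := hC e S _ _ m ch' e (q + 1) c v h2 hstd' h3 he (by omega) hbc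
      (by rw [lf_eq _ _ t, u1, u2, u3]
          have := lf_eq 1 N t m
          rw [hN] at this ⊢
          rw [hNe] at this
          linear_combination -this)
      (by rw [Function.update_self, hN]) (by rw [Function.update_self, hv]; ring)
      (by rw [t.sum, w1, w2, w3]
          have := t.sum ν
          rw [hv] at this ⊢
          rw [hve] at this
          linear_combination -this)
    exact ⟨this.1, fun h => hreg (this.2 h)⟩
  · have h1 := defect_le hOk he hn hl
    have h2 := hB e S _ _ ⟨e, he⟩ hstd'
    exact ⟨by linarith, fun h => hreg (h2.2 (by linarith))⟩

theorem bound_node (hs : Admissible b s₀) (hOk : (node m ch).Ok)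
    (hB : ∀ a, Bound b s₀ (ch a)) (hC : ∀ a, ChainBound b s₀ (ch a)) : Bound b s₀ (node m ch) := by
  intro S N ν hS hstd
  have hchild := fun a => hB a _ _ _ (insert_nonempty a S)
    (hstd.insert a (lf 1 N m) (∑ a, ν a))
  obtain ⟨hsum, hsum0⟩ := sum_nonneg_cases fun a => (hchild a).1
  rw [Xs]
  by_cases hdvd : b ∣ lf 1 N m
  · rw [if_pos hdvd]
    by_cases hl : ∀ c, c ∉ S → ¬ Leaf m ch c
    · obtain ⟨h1, h2⟩ := chiS_nonneg hOk hS hl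
      exact ⟨by linarith, fun h => singular hs hS (h2 (by linarith))
        fun a => (hchild a).2 (hsum0 (by linarith) a)⟩
    · push Not at hl
      obtain ⟨e, he, hl⟩ := hl
      have hl' := hl
      obtain ⟨h1, ch', h2, h3⟩ := hl'
      rw [sum_eq_single e (fun f _ hf => by rw [h1 f hf, Xs_nil]) (by simp), chiS_leaf hl he hS]
      have t := Tri.base e
      obtain ⟨u1, u2, u3⟩ := update_tri t N (lf 1 N m)
      obtain ⟨w1, w2, w3⟩ := update_tri t ν (∑ a, ν a)
      obtain ⟨hN, hν⟩ := hstd e he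
      have := hC e _ _ _ m ch' e 1 (lf 1 N m) (∑ a, ν a) h2
        (hstd.insert e (lf 1 N m) (∑ a, ν a)) h3 (mem_insert_self ..) one_pos hdvd
        (by rw [lf_eq _ _ t, u1, u2, u3]
            have := lf_eq 1 N t m
            rw [hN] at this
            linear_combination -this)
        (by rw [Function.update_self, one_mul]) (by rw [Function.update_self]; ring)
        (by rw [t.sum, w1, w2, w3]
            have := t.sum ν
            rw [hν] at this
            linear_combination -this)
      refine ⟨by linarith, fun h => singular hs hS
        (fun F _ s x _ hx => hx.resid_leaf hS hOk hl) fun a => ?_⟩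
      by_cases ha : a = e
      · subst ha
        exact this.2 (by linarith)
      · rw [h1 a ha]
        exact claim_nil ..
  · rw [if_neg hdvd]
    exact ⟨by linarith, fun h => regular hs (fun h0 => hdvd (hs.2.1 _ _ h0))
      fun a => (hchild a).2 (hsum0 (by linarith) a)⟩

theorem bound (hs : Admissible b s₀) {T : Tr} (hT : T.Ok) :
    Bound b s₀ T ∧ ChainBound b s₀ T := by
  induction T with
  | nil => exact ⟨fun S N ν _ _ => ⟨le_rfl, fun _ => claim_nil ..⟩, fun _ _ _ _ _ _ _ _ _ h => by cases h⟩
  | node m ch ih =>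
      have ih := fun a => ih a (hT.2.2 a)
      exact ⟨bound_node hs hT (fun a => (ih a).1) fun a => (ih a).2,
        chainBound_node hs hT (fun a => (ih a).1) fun a => (ih a).2⟩

theorem one_le_root (hs : Admissible b s₀) (hT : (node m ch).Ok) (hb : b ∣ m) :
    1 ≤ Xs b ∅ (fun _ => 0) (node m ch) := by
  have hm := hT.1
  have hL : lf 1 (fun _ => 0) m = m := by simp [lf]
  have hB := fun a => (bound hs (hT.2.2 a)).1
  have hchild := fun a => hB a _ _ _ (insert_nonempty a ∅)
    (Std.insert (fun _ _ => ⟨rfl, rfl⟩ : Std ∅ (fun _ => 0) (fun _ => 1)) a m (∑ _a : Fin 3, 1))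
  have hsum := sum_nonneg fun a (_ : a ∈ univ) => (hchild a).1
  rw [Xs, hL, if_pos hb]
  by_cases hl : ∃ e, Leaf m ch e
  · obtain ⟨e, hl⟩ := hl
    obtain ⟨h1, ch', h2, h3⟩ := id hl
    rw [sum_eq_single e (fun f _ hf => by rw [h1 f hf, Xs_nil]) (by simp)]
    have t := Tri.base e
    obtain ⟨u1, u2, u3⟩ := update_tri t (fun _ => (0 : ℤ)) m
    obtain ⟨w1, w2, w3⟩ := update_tri t (fun _ => (1 : ℤ)) 3
    have := ((bound hs (hT.2.2 e)).2 {e} (Function.update (fun _ => 0) e m)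
      (Function.update (fun _ => 1) e 3) m ch' e 1 m 3 h2
      (Std.insert (fun _ _ => ⟨rfl, rfl⟩ : Std ∅ (fun _ => 0) (fun _ => 1)) e m 3) h3
      (mem_singleton_self e) one_pos hb (by rw [lf_eq _ _ t, u1, u2, u3, Int.cast_id]; ring)
      (by rw [Function.update_self, one_mul]) (by rw [Function.update_self]; ring)
      (by rw [t.sum, w1, w2, w3]; ring)).1
    rw [defect, if_neg (tri_ne_univ t).1] at this
    rw [chiS_empty t, hl.dd, hl.gap_self, hl.gap t.1.symm, hl.gap t.2.1.symm, h1 _ t.1.symm,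
      h1 _ t.2.1.symm, e01_of_ne hl.ne_nil, e01_nil, insert_empty]
    linarith
  · suffices h : 1 ≤ chiS ∅ m ch by linarith
    push Not at hl
    have one : ∀ {i j k}, Tri i j k → ch i = nil → ch j = nil → 1 ≤ chiS ∅ m ch := by
      intro i j k t hi hj
      have h1 := (single_bounds hT t hi hj (hl k)).2.2
      have h2 := gap_eq (m := m) (ch := ch) t.rot.rot
      rw [hi, hj, ln_nil, ln_nil] at h2
      rw [chiS_empty t, hi, hj, e01_nil]
      linarith
    have two : ∀ {i j k}, Tri i j k → ch i = nil → ch j ≠ nil → ch k ≠ nil → 1 ≤ chiS ∅ m ch := by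
      intro i j k t hi hj hk
      have h1 := root_two hT t hi hj hk
      rw [chiS_empty t, hi, e01_nil, e01_of_ne hj, e01_of_ne hk]
      linarith
    have t : Tri 0 1 2 := Tri.base 0
    by_cases hi : ch 0 = nil <;> by_cases hj : ch 1 = nil <;> by_cases hk : ch 2 = nil
    · exact one t hi hj
    · exact one t hi hj
    · exact one t.rot.rot hk hi
    · exact two t hi hj hk
    · exact one t.rot hj hk
    · exact two t.rot hj hk hi
    · exact two t.rot.rot hk hi hj
    · have h1 := root_three hT t hi hj hk
      rw [chiS_empty t, e01_of_ne hi, e01_of_ne hj, e01_of_ne hk]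
      linarith

theorem root_claim (hs : Admissible b s₀) {T : Tr} (hT : T.Ok) (h0 : Xs b ∅ (fun _ => 0) T = 0) :
    Claim s₀ ∅ (fun _ => 1) T := by
  cases T with
  | nil => exact claim_nil ..
  | node m ch =>
      have hb : ¬ b ∣ m := fun hb => by
        have := one_le_root hs hT hb
        omega
      have hL : lf 1 (fun _ => 0) m = m := by simp [lf]
      have hp : (fun _ => 1 : Fin 3 → ℚ) = pt s₀ (fun _ => 0) (fun _ => 1) := by
        funext i; simp [pt]
      have hchild := fun a => (bound hs (hT.2.2 a)).1 _ _ _ (insert_nonempty a ∅)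
        (Std.insert (fun _ _ => ⟨rfl, rfl⟩ : Std ∅ (fun _ => 0) (fun _ => 1)) a m (∑ _a : Fin 3, 1))
      obtain ⟨-, hsum0⟩ := sum_nonneg_cases fun a => (hchild a).1
      rw [Xs, hL, if_neg hb, zero_add] at h0
      rw [hp]
      refine regular hs (fun h => hb ?_) fun a => ?_
      · rw [hL] at h
        exact hs.2.1 _ _ h
      · rw [hL]
        exact (hchild a).2 (hsum0 h0 a)

end Tr

/-! ### The combinatorics of proximity -/

namespace ToricConstellation

variable {r : ℕ} (C : ToricConstellation r)

theorem parent_induction {P : Fin r → Prop} (h0 : ∀ i : Fin r, ¬ 0 < (i : ℕ) → P i)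
    (h : ∀ i : Fin r, 0 < (i : ℕ) → P (C.parent i) → P i) (i : Fin r) : P i := by
  induction i using WellFoundedLT.induction with
  | ind i ih =>
      by_cases hi : 0 < (i : ℕ)
      · exact h i hi (ih _ (C.parent_lt i hi))
      · exact h0 i hi

open Classical in
/-- The child along a label, if it exists. -/
noncomputable def child (i : Fin r) (a : Fin 3) : Option (Fin r) :=
  if h : ∃ j, C.IsChild j i ∧ C.label j = a then some h.choose else none

variable {C}

theorem IsChild.lt {i j : Fin r} (h : C.IsChild j i) : i < j := by
  have := C.parent_lt j h.1
  rwa [h.2] at this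

theorem IsChild.eq {i j k : Fin r} (h : C.IsChild j i) (h' : C.IsChild k i)
    (hl : C.label j = C.label k) : j = k := by
  by_contra hne
  exact C.label_distinct j k h.1 h'.1 hne (h.2.trans h'.2.symm) hl

theorem child_eq_some {i j : Fin r} {a : Fin 3} :
    C.child i a = some j ↔ C.IsChild j i ∧ C.label j = a := by
  unfold child
  split_ifs with h
  · rw [Option.some_inj]
    constructor
    · rintro rfl
      exact h.choose_spec
    · rintro ⟨h1, h2⟩
      exact h.choose_spec.1.eq h1 (h.choose_spec.2.trans h2.symm)
  · simp only [false_iff]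
    exact fun hj => h ⟨j, hj⟩

theorem child_label {i j : Fin r} (h : C.IsChild j i) : C.child i (C.label j) = some j :=
  child_eq_some.2 ⟨h, rfl⟩

theorem child_induction {P : Fin r → Prop}
    (h : ∀ i, (∀ a k, C.child i a = some k → P k) → P i) (i : Fin r) : P i := by
  induction i using WellFoundedGT.induction with
  | ind i ih => exact h i fun a k hk => ih k (child_eq_some.1 hk).1.lt

theorem sum_children {M : Type*} [AddCommMonoid M] (i : Fin r) (Λ : Finset (Fin 3))
    (f : Fin r → M) : ∑ k with C.IsChild k i ∧ C.label k ∈ Λ, f k =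
      ∑ a ∈ Λ, (C.child i a).elim 0 f := by
  rw [← sum_fiberwise_of_maps_to (s := univ.filter fun k => C.IsChild k i ∧ C.label k ∈ Λ)
    (t := Λ) (g := C.label) (fun k hk => (mem_filter.1 hk).2.2)]
  refine sum_congr rfl fun a ha => ?_
  rcases h : C.child i a with _ | k
  · refine sum_eq_zero fun k hk => ?_
    simp only [mem_filter, mem_univ, true_and] at hk
    rw [child_eq_some.2 ⟨hk.1.1, hk.2⟩] at h
    cases h
  · obtain ⟨h1, h2⟩ := child_eq_some.1 h
    refine sum_eq_single_of_mem k (by simp [h1, h2, ha]) fun j hj hjk => absurd ?_ hjk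
    simp only [mem_filter, mem_univ, true_and] at hj
    exact hj.1.1.eq h1 (hj.2.trans h2.symm)

variable (C)

/-- `Reach C Λ i j` : the node `j` is reached from `i` by edges with labels in `Λ`. -/
def Reach (Λ : Finset (Fin 3)) : Fin r → Fin r → Prop :=
  Relation.ReflTransGen fun i j => C.IsChild j i ∧ C.label j ∈ Λ

open Classical in
/-- The set of nodes reached by edges with labels in `Λ`. -/
noncomputable def reach (Λ : Finset (Fin 3)) (i : Fin r) : Finset (Fin r) :=
  univ.filter (C.Reach Λ i)

variable {C} {Λ : Finset (Fin 3)} {i j k : Fin r} {a b x y z : Fin 3}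

@[simp] theorem mem_reach : j ∈ C.reach Λ i ↔ C.Reach Λ i j := by simp [reach]

theorem Reach.le (h : C.Reach Λ i j) : i ≤ j := by
  induction h with
  | refl => exact le_rfl
  | tail _ h ih => exact ih.trans h.1.lt.le

theorem Reach.last (h : C.Reach Λ i j) (hij : i ≠ j) :
    0 < (j : ℕ) ∧ C.Reach Λ i (C.parent j) ∧ C.label j ∈ Λ := by
  rcases Relation.ReflTransGen.cases_tail h with h | ⟨k, h1, h2⟩
  · exact absurd h.symm hij
  · obtain ⟨h3, rfl⟩ := h2.1
    exact ⟨h3, h1, h2.2⟩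

theorem Reach.step (h : C.Reach Λ i (C.parent j)) (hj : 0 < (j : ℕ)) (hl : C.label j ∈ Λ) :
    C.Reach Λ i j :=
  Relation.ReflTransGen.tail h ⟨⟨hj, rfl⟩, hl⟩

theorem reach_disjoint {l : Fin r} (hj : C.IsChild j i) (hk : C.IsChild k i) (h : C.Reach Λ j l)
    (h' : C.Reach Λ k l) : j = k := by
  have aux : ∀ {j k}, C.IsChild j i → C.IsChild k i → C.Reach Λ j k → j = k := by
    intro j k hj hk h
    by_contra hne
    have := (h.last hne).2.1.le
    rw [hk.2] at this
    exact absurd hj.lt this.not_gt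
  induction h with
  | refl => exact (aux hk hj h').symm
  | @tail l l' h1 h2 ih =>
      by_cases hkl : k = l'
      · subst hkl
        exact aux hj hk (h1.tail h2)
      · have := (h'.last hkl).2.1
        rw [h2.1.2] at this
        exact ih this

theorem sum_reach {M : Type*} [AddCommMonoid M] (f : Fin r → M) :
    ∑ j ∈ C.reach Λ i, f j =
      f i + ∑ a ∈ Λ, (C.child i a).elim 0 fun k => ∑ j ∈ C.reach Λ k, f j := by
  classical
  rw [← sum_children i Λ, ← sum_biUnion, ← sum_insert]
  · refine sum_congr ?_ fun _ _ => rfl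
    ext j
    simp only [mem_reach, mem_insert, mem_biUnion, mem_filter, mem_univ, true_and]
    rw [Reach, Relation.ReflTransGen.cases_head_iff, eq_comm]
  · simp only [mem_biUnion, mem_filter, mem_univ, true_and, mem_reach, not_exists, not_and]
    exact fun k hk h => absurd hk.1.lt h.le.not_gt
  · intro j hj k hk hne
    simp only [coe_filter, Set.mem_ofPred_eq, mem_univ, true_and] at hj hk
    refine Finset.disjoint_left.2 fun l h1 h2 => hne ?_
    exact reach_disjoint hj.1 hk.1 (mem_reach.1 h1) (mem_reach.1 h2)

theorem reach_univ (hi : ¬ 0 < (i : ℕ)) : C.reach univ i = univ := by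
  refine eq_univ_of_forall fun j => mem_reach.2 ?_
  induction j using C.parent_induction with
  | h0 j hj =>
      obtain rfl : i = j := Fin.ext (by omega)
      exact .refl
  | h j hj ih => exact ih.step hj (mem_univ _)

/-! ### The sides of a cone -/

variable (C)

/-- The node whose vector is the given entry of the cone (`none` for a standard basis vector). -/
def src (j : Fin r) : Fin 3 → Option (Fin r) :=
  if h : 0 < (j : ℕ) then Function.update (src (C.parent j)) (C.label j) (some (C.parent j))
  else fun _ => none
termination_by (j : ℕ)
decreasing_by exact C.parent_lt j h

variable {C}

theorem src_root (h : ¬ 0 < (j : ℕ)) : C.src j = fun _ => none := by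
  rw [src, dif_neg h]

theorem src_child (h : 0 < (j : ℕ)) :
    C.src j = Function.update (C.src (C.parent j)) (C.label j) (some (C.parent j)) := by
  rw [src, dif_pos h]

theorem src_of_child (h : C.child i a = some k) :
    C.src k = Function.update (C.src i) a (some i) := by
  obtain ⟨⟨h1, rfl⟩, rfl⟩ := child_eq_some.1 h
  exact src_child h1

theorem cone_eq (j : Fin r) (a : Fin 3) :
    C.cone j a = (C.src j a).elim (Pi.single a 1) C.v := by
  induction j using C.parent_induction with
  | h0 j hj => rw [cone, dif_neg hj, src_root hj]; rfl
  | h j hj ih =>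
      rw [cone, dif_pos hj, src_child hj]
      rcases eq_or_ne a (C.label j) with rfl | ha
      · rw [Function.update_self, Function.update_self]; rfl
      · rw [Function.update_of_ne ha, Function.update_of_ne ha, ih]

theorem src_lt (h : C.src j a = some i) : i < j := by
  induction j using C.parent_induction with
  | h0 j hj => simp [src_root hj] at h
  | h j hj ih =>
      have hp : C.parent j < j := C.parent_lt j hj
      rw [src_child hj] at h
      rcases eq_or_ne a (C.label j) with rfl | ha
      · rw [Function.update_self, Option.some_inj] at h
        exact h ▸ hp
      · rw [Function.update_of_ne ha] at h
        exact (ih h).trans hp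

theorem exists_dual (j : Fin r) : ∃ f : Fin 3 → ((Fin 3 → ℤ) →+ ℤ),
    ∀ a b, f a (C.cone j b) = if a = b then 1 else 0 := by
  induction j using C.parent_induction with
  | h0 j hj =>
      refine ⟨fun a => Pi.evalAddMonoidHom _ a, fun a b => ?_⟩
      rw [cone, dif_neg hj]
      simp [Pi.single_apply]
  | h j hj ih =>
      obtain ⟨f, hf⟩ := ih
      have hsum : ∀ a, f a (∑ b, C.cone (C.parent j) b) = 1 := fun a => by
        rw [map_sum]; simp [hf]
      rw [cone, dif_pos hj]
      refine ⟨fun x => if x = C.label j then f x else f x - f (C.label j), fun x y => ?_⟩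
      by_cases hy : y = C.label j
      · subst hy
        rw [Function.update_self]
        by_cases hx : x = C.label j
        · simp only [hx, if_true]
          exact hsum _
        · simp only [hx, if_false, AddMonoidHom.sub_apply, hsum, sub_self]
      · rw [Function.update_of_ne hy]
        by_cases hx : x = C.label j
        · simp only [hx, if_true, hf, Ne.symm hy, if_false]
        · simp only [hx, if_false, AddMonoidHom.sub_apply, hf, Ne.symm hy, sub_zero]

theorem v_ne_single (j : Fin r) (a : Fin 3) : C.v j ≠ Pi.single a 1 := by
  have key : ∀ b, 1 ≤ ∑ x, C.cone j b x := by
    induction j using C.parent_induction with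
    | h0 j hj => intro b; rw [cone, dif_neg hj]; simp
    | h j hj ih =>
        intro b
        rw [cone, dif_pos hj]
        rcases eq_or_ne b (C.label j) with rfl | hb
        · rw [Function.update_self]
          simp only [Finset.sum_apply]
          rw [sum_comm]
          have := ih 0
          have := ih 1
          have := ih 2
          rw [Fin.sum_univ_three]
          omega
        · rw [Function.update_of_ne hb]
          exact ih b
  intro h
  have h1 : ∑ x, C.v j x = 1 := by rw [h]; simp
  have h2 : ∑ x, C.v j x = ∑ b, ∑ x, C.cone j b x := by
    simp only [v, Finset.sum_apply]
    rw [sum_comm]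
  have := key 0
  have := key 1
  have := key 2
  rw [Fin.sum_univ_three (fun b => ∑ x, C.cone j b x)] at h2
  omega

theorem functional_nonneg (φ : (Fin 3 → ℤ) →+ ℤ) (h : C.Reach Λ i j)
    (h0 : ∀ a, 0 ≤ φ (C.cone i a)) : (∀ a, 0 ≤ φ (C.cone j a)) ∧ φ (C.v i) ≤ φ (C.v j) := by
  induction h with
  | refl => exact ⟨h0, le_rfl⟩
  | @tail k l _ h2 ih =>
      obtain ⟨⟨hl, rfl⟩, -⟩ := h2
      obtain ⟨h3, h4⟩ := ih
      have h5 : 0 ≤ φ (C.v (C.parent l)) := by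
        rw [v, map_sum]
        exact sum_nonneg fun a _ => h3 a
      have e : ∀ a, C.cone l a = if a = C.label l then C.v (C.parent l)
          else C.cone (C.parent l) a := by
        intro a
        rw [cone, dif_pos hl, Function.update_apply]; rfl
      have h6 : ∀ a, 0 ≤ φ (C.cone l a) := by
        intro a
        rw [e]
        split_ifs
        · exact h5
        · exact h3 a
      refine ⟨h6, h4.trans ?_⟩
      rw [show C.v l = ∑ a, C.cone l a from rfl, map_sum]
      refine le_trans (le_of_eq ?_) (single_le_sum (fun a _ => h6 a) (mem_univ (C.label l)))
      rw [e, if_pos rfl]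

theorem child_separated (h : C.child i a = some k) {b : Fin 3} (hb : b ≠ a)
    (f : Fin 3 → ((Fin 3 → ℤ) →+ ℤ)) (hf : ∀ a b, f a (C.cone i b) = if a = b then 1 else 0)
    (hj : C.Reach Λ k j) : 0 < (f b - f a) (C.v j) := by
  have e : ∀ x, C.cone k x = if x = a then C.v i else C.cone i x := by
    obtain ⟨⟨h1, rfl⟩, rfl⟩ := child_eq_some.1 h
    intro x
    rw [cone, dif_pos h1, Function.update_apply]; rfl
  have hv : (f b - f a) (C.v i) = 0 := by
    simp only [v, AddMonoidHom.sub_apply, map_sum]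
    simp [hf]
  have h0 : ∀ x, (f b - f a) (C.cone k x) = if x = b then 1 else 0 := by
    intro x
    rw [e]
    split_ifs with h1 h2 h2
    · exact absurd (h2.symm.trans h1) hb
    · exact hv
    · subst h2
      simp [hf, hb.symm]
    · simp [hf, Ne.symm h1, Ne.symm h2]
  refine lt_of_lt_of_le ?_ (functional_nonneg (f b - f a) hj fun x => ?_).2
  · rw [v, map_sum]
    simp [h0]
  · rw [h0]
    split_ifs <;> simp

theorem v_injective : Function.Injective C.v := by
  have key : ∀ i : Fin r, ∀ j k, C.Reach univ i j → C.Reach univ i k → C.v j = C.v k → j = k := by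
    intro i
    induction i using C.child_induction with
    | h i ih =>
        obtain ⟨f, hf⟩ := C.exists_dual i
        have hv : ∀ a b, (f b - f a) (C.v i) = 0 := by
          intro a b
          simp only [v, AddMonoidHom.sub_apply, map_sum]
          simp [hf]
        have hself : ∀ a k j, C.child i a = some k → C.Reach univ k j → C.v i ≠ C.v j := by
          intro a k j hk hj e
          have := child_separated hk (b := a + 1) (by clear hk; revert a; decide) f hf hj
          rw [← e, hv] at this
          exact lt_irrefl _ this
        intro j k hj hk e
        rcases Relation.ReflTransGen.cases_head hj with rfl | ⟨j', hj1, hj2⟩ <;>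
          rcases Relation.ReflTransGen.cases_head hk with rfl | ⟨k', hk1, hk2⟩
        · rfl
        · exact absurd e (hself _ k' k (child_label hk1.1) hk2)
        · exact absurd e.symm (hself _ j' j (child_label hj1.1) hj2)
        · have cj := child_label hj1.1
          have ck := child_label hk1.1
          by_cases hl : C.label j' = C.label k'
          · obtain rfl := hj1.1.eq hk1.1 hl
            exact ih _ _ cj j k hj2 hk2 e
          · have h1 := child_separated cj (Ne.symm hl) f hf hj2
            have h2 := child_separated ck hl f hf hk2
            rw [e] at h1
            simp only [AddMonoidHom.sub_apply] at h1 h2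
            omega
  intro j k e
  have hr : 0 < r := by have := j.2; omega
  have h := reach_univ (C := C) (i := ⟨0, hr⟩) (by simp)
  exact key ⟨0, hr⟩ j k (mem_reach.1 (h ▸ mem_univ _)) (mem_reach.1 (h ▸ mem_univ _)) e

theorem src_injective (h : C.src j a = some i) (h' : C.src j b = some i) : a = b := by
  obtain ⟨f, hf⟩ := C.exists_dual j
  have h1 := hf a a
  have h2 := hf a b
  rw [cone_eq, h] at h1
  rw [cone_eq, h'] at h2
  rw [Option.elim_some] at h1 h2
  by_contra hne
  rw [h1] at h2
  simp [hne] at h2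

theorem prox_iff : C.Prox j i ↔ ∃ a, C.src j a = some i := by
  constructor
  · rintro ⟨-, a, h⟩
    refine ⟨a, ?_⟩
    rw [cone_eq] at h
    rcases h' : C.src j a with _ | k
    · rw [h'] at h
      exact absurd h.symm (v_ne_single _ _)
    · rw [h'] at h
      exact congr_arg some (v_injective h)
  · rintro ⟨a, h⟩
    refine ⟨(src_lt h).ne', a, ?_⟩
    rw [cone_eq, h]; rfl

theorem Reach.src_eq (h : C.Reach Λ i j) (hx : x ∉ Λ) : C.src j x = C.src i x := by
  induction h with
  | refl => rfl
  | @tail k l _ h2 ih =>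
      obtain ⟨⟨h1, rfl⟩, h2⟩ := h2
      rw [src_child h1, Function.update_of_ne (by rintro rfl; exact hx h2), ih]

theorem Reach.src_cases (h : C.Reach Λ i j) (x : Fin 3) :
    C.src j x = C.src i x ∨ ∃ k, i ≤ k ∧ C.src j x = some k := by
  induction h with
  | refl => exact .inl rfl
  | @tail k l h1 h2 ih =>
      obtain ⟨⟨h3, rfl⟩, h2⟩ := h2
      rw [src_child h3]
      rcases eq_or_ne x (C.label l) with rfl | hx
      · rw [Function.update_self]
        exact .inr ⟨_, Reach.le h1, rfl⟩
      · rw [Function.update_of_ne hx]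
        exact ih

theorem src_eq_some : C.src j x = some i ↔ ∃ k, C.child i x = some k ∧ C.Reach {x}ᶜ k j := by
  constructor
  · induction j using C.parent_induction with
    | h0 j hj => simp [src_root hj]
    | h j hj ih =>
        rw [src_child hj]
        rcases eq_or_ne x (C.label j) with rfl | hx
        · rw [Function.update_self, Option.some_inj]
          rintro rfl
          exact ⟨j, child_label ⟨hj, rfl⟩, .refl⟩
        · rw [Function.update_of_ne hx]
          intro h
          obtain ⟨k, h1, h2⟩ := ih h
          exact ⟨k, h1, h2.step hj (by simpa using hx.symm)⟩
  · rintro ⟨k, h1, h2⟩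
    rw [h2.src_eq (by simp), src_of_child h1, Function.update_self]

theorem inChain_iff :
    C.inChain i a b j = true ↔ ∃ k, C.child i a = some k ∧ C.Reach {b} k j := by
  constructor
  · induction j using C.parent_induction with
    | h0 j hj => rw [inChain, dif_neg hj]; simp
    | h j hj ih =>
        rw [inChain, dif_pos hj]
        simp only [Bool.or_eq_true, Bool.and_eq_true, decide_eq_true_eq]
        rintro (⟨rfl, rfl⟩ | ⟨h1, h2⟩)
        · exact ⟨j, child_label ⟨hj, rfl⟩, .refl⟩
        · obtain ⟨k, h3, h4⟩ := ih h2
          exact ⟨k, h3, h4.step hj (by simpa using h1)⟩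
  · rintro ⟨k, h1, h2⟩
    induction h2 with
    | refl =>
        obtain ⟨⟨h2, h3⟩, h4⟩ := child_eq_some.1 h1
        rw [inChain, dif_pos h2]
        simp [h3, h4]
    | tail h3 h4 ih =>
        obtain ⟨⟨h5, rfl⟩, h6⟩ := h4
        rw [inChain, dif_pos h5]
        simp [ih, mem_singleton.1 h6]

end ToricConstellation

/-! ### The weighted tree of a cluster -/

namespace ToricConstellation

variable {r : ℕ} {C : ToricConstellation r} {Λ Λ' : Finset (Fin 3)} {i j k : Fin r}

theorem Reach.mono (hΛ : Λ ⊆ Λ') (h : C.Reach Λ i j) : C.Reach Λ' i j :=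
  Relation.ReflTransGen.mono (fun _ _ h => ⟨h.1, hΛ h.2⟩) _ _ h

theorem ite_prox {G : Type*} [AddCommMonoid G] (c : G) :
    (if C.Prox j i then c else 0) = ∑ x, if C.src j x = some i then c else 0 := by
  split_ifs with h
  · obtain ⟨x, hx⟩ := prox_iff.1 h
    rw [sum_eq_single_of_mem x (mem_univ x), if_pos hx]
    exact fun y _ hy => if_neg fun h => hy (src_injective h hx)
  · exact (sum_eq_zero fun x _ => if_neg fun hx => h (prox_iff.2 ⟨x, hx⟩)).symm

theorem sum_src_eq {G : Type*} [AddCommMonoid G] (x : Fin 3) (F : Fin r → G) :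
    (∑ j, if C.src j x = some i then F j else 0) =
      (C.child i x).elim 0 fun k => ∑ j ∈ C.reach {x}ᶜ k, F j := by
  rw [← sum_filter]
  rcases h : C.child i x with _ | k
  · refine sum_eq_zero fun j hj => ?_
    obtain ⟨k, hk, -⟩ := src_eq_some.1 (mem_filter.1 hj).2
    rw [h] at hk
    cases hk
  · refine sum_congr ?_ fun _ _ => rfl
    ext j
    simp [src_eq_some, h]

end ToricConstellation

namespace ToricCluster

open ToricConstellation

variable {r : ℕ} (A : ToricCluster r)

/-- The weighted tree of the nodes above a given one. -/
noncomputable def tree (i : Fin r) : Tr :=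
  Tr.node (A.m i) fun a => match h : A.child i a with
    | none => .nil
    | some k => tree k
termination_by r - i
decreasing_by
  have := (child_eq_some.1 h).1.lt
  omega

/-- The weighted trees of the children of a node. -/
noncomputable def chs (i : Fin r) (a : Fin 3) : Tr := (A.child i a).elim .nil A.tree

variable {A} {i j k : Fin r} {a b x y z : Fin 3}

theorem tree_eq : A.tree i = .node (A.m i) (A.chs i) := by
  rw [tree]
  congr 1
  funext a
  unfold chs
  split <;> simp [*]

theorem chs_none (h : A.child i a = none) : A.chs i a = .nil := by rw [chs, h]; rfl

theorem chs_some (h : A.child i a = some k) : A.chs i a = A.tree k := by rw [chs, h]; rfl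

theorem ln_tree (b : Fin 3) (k : Fin r) : Tr.ln b (A.tree k) = ∑ j ∈ A.reach {b} k, A.m j := by
  induction k using A.child_induction with
  | h k ih =>
      rw [tree_eq, Tr.ln, sum_reach, sum_singleton]
      rcases h : A.child k b with _ | l
      · rw [chs_none h]; rfl
      · rw [chs_some h, ih _ _ h]; rfl

theorem sum_compl_singleton {G : Type*} [AddCommMonoid G] (a : Fin 3) (f : Fin 3 → G) :
    ∑ b ∈ {a}ᶜ, f b = ∑ b, if b = a then 0 else f b := by
  rw [← sum_filter_add_sum_filter_not univ (fun b => b = a)]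
  rw [sum_eq_zero (s := univ.filter fun b => b = a) fun b hb => if_pos (mem_filter.1 hb).2, zero_add]
  exact sum_congr (by ext; simp) fun b hb => (if_neg (by simpa using hb)).symm

theorem sqa_tree (a : Fin 3) (k : Fin r) :
    Tr.sqa a (A.tree k) = ∑ j ∈ A.reach {a}ᶜ k, A.m j ^ 2 := by
  induction k using A.child_induction with
  | h k ih =>
      rw [tree_eq, Tr.sqa, sum_reach, ← sum_compl_singleton]
      congr 1
      refine sum_congr rfl fun b _ => ?_
      rcases h : A.child k b with _ | l
      · rw [chs_none h]; rfl
      · rw [chs_some h, ih _ _ h]; rfl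

theorem M_eq : A.M i a b = Tr.ln b (A.chs i a) := by
  unfold M
  rcases h : A.child i a with _ | k
  · rw [chs_none h]
    refine sum_eq_zero fun j hj => ?_
    obtain ⟨k, hk, -⟩ := inChain_iff.1 (mem_filter.1 hj).2
    rw [h] at hk
    cases hk
  · rw [chs_some h, ln_tree]
    refine sum_congr ?_ fun _ _ => rfl
    ext j
    simp [inChain_iff, h]

theorem Idealistic.ok (hA : A.Idealistic) (k : Fin r) : (A.tree k).Ok := by
  induction k using A.child_induction with
  | h k ih =>
      rw [tree_eq]
      refine ⟨A.m_pos k, fun a b hab => ?_, fun a => ?_⟩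
      · have := hA k a b hab
        rwa [M_eq, M_eq] at this
      · rcases h : A.child k a with _ | l
        · rw [chs_none h]; trivial
        · rw [chs_some h]; exact ih _ _ h

theorem sum_prox {G : Type*} [AddCommMonoid G] (F : Fin r → G) : ∑ j ∈ A.proxSet i, F j =
    ∑ x, (A.child i x).elim 0 fun k => ∑ j ∈ A.reach {x}ᶜ k, F j := by
  rw [proxSet, sum_filter]
  simp_rw [ite_prox]
  rw [sum_comm]
  exact sum_congr rfl fun x _ => sum_src_eq x F

theorem sum_Bset {G : Type*} [AddCommMonoid G] (F : Fin r → G) : ∑ i ∈ A.Bset j, F i =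
    ∑ x, (A.src j x).elim 0 F := by
  rw [Bset, sum_filter]
  simp_rw [ite_prox]
  rw [sum_comm]
  refine sum_congr rfl fun x _ => ?_
  rcases h : A.src j x with _ | k
  · simp
  · simp

theorem dd_chs : Tr.dd (A.m i) (A.chs i) = A.m i ^ 2 - ∑ j ∈ A.proxSet i, A.m j ^ 2 := by
  rw [Tr.dd, sum_prox]
  congr 1
  refine sum_congr rfl fun a _ => ?_
  rcases h : A.child i a with _ | k
  · rw [chs_none h]; rfl
  · rw [chs_some h, sqa_tree]; rfl

variable (A) in
/-- The gap along a side. -/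
noncomputable def gapAt (i : Fin r) (x : Fin 3) : ℤ := Tr.gap (A.m i) (A.chs i) x

theorem gapAt_eq (t : Tri x y z) : A.gapAt i x = A.m i - (A.M i y z + A.M i z y) := by
  rw [gapAt, Tr.gap_eq t, M_eq, M_eq]
  ring

theorem linProx_iff (t : Tri x y z) (h : A.src j x = some i) :
    A.Prox k i ∧ A.LinProx k j ↔ A.inChain j y z k = true ∨ A.inChain j z y k = true := by
  have back : ∀ {y z}, Tri x y z → A.inChain j y z k = true → A.Prox k i ∧ A.LinProx k j := by
    intro y z t hk
    refine ⟨prox_iff.2 ⟨x, ?_⟩, y, z, t.2.2, hk⟩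
    obtain ⟨c, h1, h2⟩ := inChain_iff.1 hk
    rw [h2.src_eq (by simpa using t.2.1), src_of_child h1, Function.update_of_ne t.1, h]
  refine ⟨?_, fun hk => hk.elim (back t) (back t.rot.swap.rot.rot)⟩
  rintro ⟨hp, a, b, hab, hk⟩
  obtain ⟨x', hx'⟩ := prox_iff.1 hp
  obtain ⟨c, h1, h2⟩ := inChain_iff.1 hk
  have hij := src_lt h
  have hjc := (child_eq_some.1 h1).1.lt
  have hsrc : ∀ w, w ≠ a → w ≠ b → A.src k w = A.src j w := fun w ha hb => by
    rw [h2.src_eq (by simpa using hb), src_of_child h1, Function.update_of_ne ha]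
  have hxa : x' ≠ a := by
    rintro rfl
    rw [h2.src_eq (by simpa using hab), src_of_child h1, Function.update_self,
      Option.some_inj] at hx'
    exact hij.ne' hx'
  by_cases hxb : x' = b
  · subst hxb
    have hck : c = k := by
      by_contra hne
      obtain ⟨h3, h4, h5⟩ := h2.last hne
      rw [src_child h3, ← mem_singleton.1 h5, Function.update_self, Option.some_inj] at hx'
      have := h4.le
      rw [hx'] at this
      exact absurd (hij.trans hjc) this.not_gt
    subst hck
    rw [src_of_child h1, Function.update_of_ne hxa] at hx'
    obtain rfl := src_injective h hx'
    rcases t.eq_or a with rfl | rfl | rfl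
    · exact absurd rfl hxa
    · exact .inl (inChain_iff.2 ⟨c, h1, .refl⟩)
    · exact .inr (inChain_iff.2 ⟨c, h1, .refl⟩)
  · rw [hsrc x' hxa hxb] at hx'
    obtain rfl := src_injective h hx'
    rcases t.eq_or a with rfl | rfl | rfl <;> rcases t.eq_or b with rfl | rfl | rfl
    all_goals first
      | exact absurd rfl hxa
      | exact absurd rfl hxb
      | exact absurd rfl hab
      | exact .inl hk
      | exact .inr hk

theorem chi0pair_eq (h : A.src j x = some i) : A.chi0pair i j = A.gapAt j x := by
  have t := Tri.base x
  rw [chi0pair, gapAt_eq t, M, M, ← sum_union]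
  · congr 1
    refine sum_congr ?_ fun _ _ => rfl
    ext k
    simp only [proxSet, mem_filter, mem_univ, true_and, mem_union]
    exact linProx_iff t h
  · refine Finset.disjoint_left.2 fun k h1 h2 => ?_
    simp only [mem_filter, mem_univ, true_and] at h1 h2
    obtain ⟨c, h3, h4⟩ := inChain_iff.1 h1
    obtain ⟨c', h5, h6⟩ := inChain_iff.1 h2
    have e := reach_disjoint (child_eq_some.1 h3).1 (child_eq_some.1 h5).1
      (h4.mono (subset_univ _)) (h6.mono (subset_univ _))
    have := (child_eq_some.1 h3).2
    rw [e, (child_eq_some.1 h5).2] at this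
    exact t.2.2 this.symm

theorem sum_reach_gap (t : Tri x y z) (k : Fin r) : ∑ j ∈ A.reach {x}ᶜ k, (A.m j + A.gapAt j x) =
    Tr.ln y (A.tree k) + Tr.ln z (A.tree k) := by
  induction k using A.child_induction with
  | h k ih =>
      have key : ∀ a, ((A.child k a).elim 0 fun l => ∑ j ∈ A.reach {x}ᶜ l, (A.m j + A.gapAt j x)) =
          Tr.ln y (A.chs k a) + Tr.ln z (A.chs k a) := by
        intro a
        rcases h : A.child k a with _ | l
        · rw [chs_none h]; rfl
        · rw [chs_some h]; exact ih _ _ h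
      rw [sum_reach, sum_compl_singleton, t.sum, key, key, key, if_pos rfl, if_neg t.1.symm,
        if_neg t.2.1.symm, tree_eq, Tr.ln, Tr.ln, gapAt, Tr.gap_eq t]
      ring

variable (A) in
/-- The sides of the cone of a node which are not coordinate vectors. -/
noncomputable def sides (i : Fin r) : Finset (Fin 3) := univ.filter fun a => (A.src i a).isSome

theorem mem_sides : x ∈ A.sides i ↔ ∃ k, A.src i x = some k := by
  simp [sides, Option.isSome_iff_exists]

theorem sides_child (h : A.child i a = some k) : A.sides k = insert a (A.sides i) := by
  ext x
  rw [mem_insert, mem_sides, mem_sides, src_of_child h]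
  rcases eq_or_ne x a with rfl | hx
  · simp
  · simp [hx]

theorem elim_src {G : Type*} (c : G) (f : Fin r → G) (i : Fin r) (x : Fin 3) (g : G)
    (h : ∀ k, A.src i x = some k → f k = g) :
    (A.src i x).elim c f = if x ∈ A.sides i then g else c := by
  rcases e : A.src i x with _ | k
  · rw [if_neg (by simp [mem_sides, e])]; rfl
  · rw [if_pos (mem_sides.2 ⟨k, e⟩)]; exact h k e

theorem card_Bset : (A.Bset i).card = (A.sides i).card := by
  rw [card_eq_sum_ones, sum_Bset, card_eq_sum_ones, ← univ_inter (A.sides i), ← sum_ite_mem]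
  exact sum_congr rfl fun x _ => elim_src _ _ _ _ _ fun _ _ => rfl

theorem common_prox_iff (h : A.child i a = some k) :
    (∃ l, A.Prox i l ∧ A.Prox k l) ↔ ¬ A.sides i ⊆ {a} := by
  constructor
  · rintro ⟨l, h1, h2⟩ hs
    obtain ⟨x, hx⟩ := prox_iff.1 h1
    obtain ⟨y, hy⟩ := prox_iff.1 h2
    obtain rfl := mem_singleton.1 (hs (mem_sides.2 ⟨l, hx⟩))
    rw [src_of_child h] at hy
    rcases eq_or_ne y x with rfl | hyx
    · rw [Function.update_self, Option.some_inj] at hy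
      exact (src_lt hx).ne' hy
    · rw [Function.update_of_ne hyx] at hy
      exact hyx (src_injective hy hx)
  · intro hs
    obtain ⟨x, hx, hxa⟩ := not_subset.1 hs
    obtain ⟨l, hl⟩ := mem_sides.1 hx
    refine ⟨l, prox_iff.2 ⟨x, hl⟩, prox_iff.2 ⟨x, ?_⟩⟩
    rw [src_of_child h, Function.update_of_ne (by simpa using hxa), hl]

/-- Counting children. -/
theorem card_children (P : Fin r → Prop) [DecidablePred P] (g : Fin 3 → ℤ)
    (h : ∀ a k, A.child i a = some k → (if P k then 1 else 0) = g a) :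
    ((univ.filter fun k => A.IsChild k i ∧ P k).card : ℤ) = ∑ a, (1 - Tr.e01 (A.chs i a)) * g a := by
  have e := sum_children (C := A.toToricConstellation) i univ (fun k => if P k then (1 : ℤ) else 0)
  rw [← filter_filter, card_filter]
  push_cast
  simp only [mem_univ, and_true] at e
  rw [e]
  refine sum_congr rfl fun a _ => ?_
  rcases hc : A.child i a with _ | k
  · rw [chs_none hc]; simp [Tr.e01]
  · rw [chs_some hc, tree_eq]
    simp [Tr.e01, h a k hc]

theorem T_eq : A.T i = ∑ a, if A.sides i ⊆ {a} then Tr.e01 (A.chs i a) else 0 := by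
  have h : ((A.Aset i).card : ℤ) =
      ∑ a, (1 - Tr.e01 (A.chs i a)) * if A.sides i ⊆ {a} then 1 else 0 := by
    unfold Aset
    exact card_children _ _ fun a k hk => if_congr (by rw [common_prox_iff hk, not_not]) rfl rfl
  rw [T, h, card_Bset]
  generalize A.sides i = S
  generalize A.chs i = ch
  have key : (3 : ℤ) - 2 * (S.card : ℤ) + (S.card.choose 2 : ℕ) =
      ∑ a : Fin 3, if S ⊆ {a} then 1 else 0 := by
    revert S; decide
  have : ∀ a, (1 - Tr.e01 (ch a)) * (if S ⊆ {a} then 1 else 0) =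
      (if S ⊆ {a} then 1 else 0) - if S ⊆ {a} then Tr.e01 (ch a) else 0 := by
    intro a; split_ifs <;> ring
  rw [sum_congr rfl fun a _ => this a, sum_sub_distrib, ← key]
  ring

theorem chi0_eq : A.chi0 i = -(Tr.dd (A.m i) (A.chs i) -
    ∑ x, if x ∈ A.sides i then 0 else A.gapAt i x) := by
  have h1 : ∑ j ∈ A.proxSet i, A.chi0pair i j + ∑ j ∈ A.proxSet i, A.m j =
      3 * A.m i - ∑ x, A.gapAt i x := by
    rw [← sum_add_distrib, proxSet, sum_filter]
    simp_rw [ite_prox]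
    rw [sum_comm]
    have : ∀ x, (∑ j, if A.src j x = some i then A.chi0pair i j + A.m j else 0) =
        Tr.ln (x + 1) (A.chs i x) + Tr.ln (x + 2) (A.chs i x) := by
      intro x
      rw [sum_congr rfl fun j _ => show _ = if A.src j x = some i then A.m j + A.gapAt j x else 0 by
        split_ifs with h
        · rw [chi0pair_eq h, add_comm]
        · rfl, sum_src_eq x fun j => A.m j + A.gapAt j x]
      rcases h : A.child i x with _ | k
      · rw [chs_none h]; rfl
      · rw [chs_some h]; exact sum_reach_gap (Tri.base x) k
    rw [sum_congr rfl fun x _ => this x]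
    simp only [Fin.sum_univ_three, gapAt, Tr.gap]
    simp only [show (2 : Fin 3) + 1 = 0 from rfl, show (1 : Fin 3) + 1 = 2 from rfl,
      show (2 : Fin 3) + 2 = 1 from rfl, show (1 : Fin 3) + 2 = 0 from rfl, zero_add]
    ring
  have h2 : ∑ j ∈ A.Bset i, A.chi0pair j i = ∑ x, if x ∈ A.sides i then A.gapAt i x else 0 := by
    rw [sum_Bset]
    exact sum_congr rfl fun x _ => elim_src _ _ _ _ _ fun k hk => chi0pair_eq hk
  have h3 : (∑ x, if x ∈ A.sides i then A.gapAt i x else 0) +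
      ∑ x, (if x ∈ A.sides i then 0 else A.gapAt i x) = ∑ x, A.gapAt i x := by
    rw [← sum_add_distrib]
    exact sum_congr rfl fun x _ => by split_ifs <;> simp
  have h4 : ∑ j ∈ A.proxSet i, A.m j * (A.m j - 1) =
      ∑ j ∈ A.proxSet i, A.m j ^ 2 - ∑ j ∈ A.proxSet i, A.m j := by
    rw [← sum_sub_distrib]
    exact sum_congr rfl fun x _ => by ring
  rw [chi0, dd_chs, h4]
  change _ - ∑ j ∈ A.proxSet i, A.chi0pair i j - ∑ j ∈ A.Bset i, A.chi0pair j i = _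
  linear_combination -h1 - h2 - h3

theorem chi_eq : A.chi i = Tr.chiS (A.sides i) (A.m i) (A.chs i) := by
  rw [Tr.chiS, ← T_eq]
  have h : A.chi i = A.T i - A.chi0 i := by
    rw [chi, T, chi0]; ring
  rw [h, chi0_eq]
  simp only [gapAt]
  ring

theorem anteSet_eq : A.anteSet i = A.Bset i := by
  ext j
  simp only [anteSet, Bset, mem_filter, mem_univ, true_and, and_iff_right_iff_imp]
  intro h
  obtain ⟨x, hx⟩ := prox_iff.1 h
  exact src_lt hx

variable (A) in
/-- The numerical data `N` of the sides of a cone. -/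
noncomputable def NN (i : Fin r) (x : Fin 3) : ℤ := (A.src i x).elim 0 A.N

variable (A) in
/-- The numerical data `ν` of the sides of a cone. -/
noncomputable def nus (i : Fin r) (x : Fin 3) : ℤ := (A.src i x).elim 1 A.nu

theorem N_eq : A.N i = ∑ x, A.NN i x + A.m i := by
  rw [N, sum_attach (A.anteSet i) A.N, anteSet_eq, sum_Bset, add_comm]
  rfl

theorem nu_eq : A.nu i = ∑ x, A.nus i x := by
  rw [nu, sum_attach (A.anteSet i) fun j => A.nu j - 1, anteSet_eq, sum_Bset]
  have : ∀ x, A.nus i x = 1 + (A.src i x).elim 0 fun j => A.nu j - 1 := by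
    intro x
    unfold nus
    rcases A.src i x with _ | k <;> simp
  rw [sum_congr rfl fun x _ => this x, sum_add_distrib]
  simp

theorem nu_pos (i : Fin r) : 0 < A.nu i := by
  induction i using WellFoundedLT.induction with
  | ind i ih =>
      rw [nu_eq]
      refine sum_pos (fun x _ => ?_) univ_nonempty
      unfold nus
      rcases h : A.src i x with _ | k
      · exact one_pos
      · exact ih k (src_lt h)

theorem elim_child {G : Type*} (c : G) (f : Fin r → G) (h : A.child i a = some k) :
    (fun x => (A.src k x).elim c f) =
      Function.update (fun x => (A.src i x).elim c f) a (f i) := by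
  funext x
  rw [src_of_child h]
  rcases eq_or_ne x a with rfl | hx
  · simp
  · simp [hx]

theorem Xs_tree (b : ℤ) (k : Fin r) : Tr.Xs b (A.sides k) (A.NN k) (A.tree k) =
    ∑ j ∈ A.reach univ k, if b ∣ A.N j then A.chi j else 0 := by
  induction k using A.child_induction with
  | h k ih =>
      have hN : lf 1 (A.NN k) (A.m k) = A.N k := by
        rw [N_eq, lf]; simp
      rw [tree_eq, Tr.Xs, sum_reach, ← chi_eq, hN]
      congr 1
      refine sum_congr rfl fun a _ => ?_
      rcases h : A.child k a with _ | l
      · rw [chs_none h]; rfl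
      · rw [chs_some h, ← sides_child h]
        have := ih _ _ h
        rw [show A.NN l = Function.update (A.NN k) a (A.N k) from elim_child 0 A.N h] at this
        exact this

end ToricCluster

/-! ### The zeta function of a cluster as a sum over its tree -/

theorem node_term_eq {F : Type} [Field F] {s L D : F} {g e l : Fin 3 → F} {S : Finset (Fin 3)}
    (hs : s + 1 ≠ 0) (hL : L ≠ 0) (hl : ∀ x, l x ≠ 0) (h1 : ∀ x, x ∉ S → l x = 1) :
    ((D - ∑ x, if x ∈ S then 0 else g x) + ∑ a, if S ⊆ {a} then e a else 0) / L
      + -(D - ∑ x, if x ∈ S then 0 else g x) / ((s + 1) * L)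
      + (∑ x, if x ∈ S then
          (-g x + e (x + 1) * (if x + 2 ∈ S then 0 else 1)
            + e (x + 2) * (if x + 1 ∈ S then 0 else 1)) / (l x * L)
          + g x / ((s + 1) * (l x * L)) else 0)
      + (∑ z, if z + 1 ∈ S ∧ z + 2 ∈ S then e z / (l (z + 1) * l (z + 2) * L) else 0)
    = s / (s + 1) * (D - ∑ x, g x / l x) / L + ∑ z, e z / (l (z + 1) * l (z + 2) * L) := by
  have hS : ∀ a, S ⊆ {a} ↔ a + 1 ∉ S ∧ a + 2 ∉ S := by
    clear h1; revert S; decide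
  have l0 := hl 0
  have l1 := hl 1
  have l2 := hl 2
  simp only [hS, Fin.sum_univ_three, show (2 : Fin 3) + 1 = 0 from rfl,
    show (1 : Fin 3) + 1 = 2 from rfl, show (2 : Fin 3) + 2 = 1 from rfl,
    show (1 : Fin 3) + 2 = 0 from rfl, zero_add]
  by_cases h0 : (0 : Fin 3) ∈ S <;> by_cases h1' : (1 : Fin 3) ∈ S <;>
    by_cases h2 : (2 : Fin 3) ∈ S <;>
    simp only [h0, h1', h2, h1, not_true_eq_false, not_false_eq_true, if_true, if_false, and_true,
      and_false] <;> field_simp <;> ring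

namespace ToricCluster

open ToricConstellation

variable {r : ℕ} {A : ToricCluster r} {i j k l : Fin r} {a b x y z : Fin 3}

theorem prox_child_iff (h : A.src k x = some i) (hc : A.child k a = some l) :
    A.Prox l i ↔ a ≠ x := by
  rw [prox_iff, src_of_child hc]
  constructor
  · rintro ⟨w, hw⟩ rfl
    rcases eq_or_ne w a with rfl | hwa
    · rw [Function.update_self, Option.some_inj] at hw
      exact (src_lt h).ne' hw
    · rw [Function.update_of_ne hwa] at hw
      exact hwa (src_injective hw h)
  · intro hax
    exact ⟨x, by rw [Function.update_of_ne hax.symm, h]⟩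

theorem exists_prox_child_iff (h : A.src k x = some i) (hc : A.child k a = some l) :
    (∃ l', l' ≠ i ∧ A.Prox l l' ∧ A.Prox k l') ↔ ¬ A.sides k ⊆ {a, x} := by
  rw [not_subset]
  constructor
  · rintro ⟨l', h1, h2, h3⟩
    obtain ⟨w, hw⟩ := prox_iff.1 h3
    refine ⟨w, mem_sides.2 ⟨l', hw⟩, ?_⟩
    rw [mem_insert, mem_singleton, not_or]
    refine ⟨((prox_child_iff hw hc).1 h2).symm, ?_⟩
    rintro rfl
    rw [h, Option.some_inj] at hw
    exact h1 hw.symm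
  · rintro ⟨w, h1, h2⟩
    rw [mem_insert, mem_singleton, not_or] at h2
    obtain ⟨l', hl'⟩ := mem_sides.1 h1
    refine ⟨l', ?_, (prox_child_iff hl' hc).2 (Ne.symm h2.1), prox_iff.2 ⟨w, hl'⟩⟩
    rintro rfl
    exact h2.2 (src_injective hl' h)

theorem chipair_eq (t : Tri x y z) (h : A.src k x = some i) : A.chipair i k = -A.gapAt k x
    + Tr.e01 (A.chs k y) * (if z ∈ A.sides k then 0 else 1)
    + Tr.e01 (A.chs k z) * (if y ∈ A.sides k then 0 else 1) := by
  have hA : ((A.Apair i k).card : ℤ) = ∑ a, (1 - Tr.e01 (A.chs k a)) * if a ≠ x then 1 else 0 := by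
    unfold Apair
    exact card_children _ _ fun a l hl => if_congr (prox_child_iff h hl) rfl rfl
  have hC : ((A.Cpair i k).card : ℤ) =
      ∑ a, (1 - Tr.e01 (A.chs k a)) * if a ≠ x ∧ ¬ A.sides k ⊆ {a, x} then 1 else 0 := by
    unfold Cpair
    exact card_children _ _ fun a l hl =>
      if_congr (and_congr (prox_child_iff h hl) (exists_prox_child_iff h hl)) rfl rfl
  have hx : x ∈ A.sides k := mem_sides.2 ⟨i, h⟩
  have hB : ((A.Bpair i k).card : ℤ) = (A.sides k).card - 1 := by
    have e : A.Bpair i k = (A.Bset k).erase i := by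
      ext l
      simp [Bpair, Bset]
    have hi : i ∈ A.Bset k := by
      simpa [Bset] using prox_iff.2 ⟨x, h⟩
    rw [e, card_erase_of_mem hi, card_Bset, Nat.cast_sub]
    · simp
    · exact card_pos.2 ⟨x, hx⟩
  rw [chipair, chi0pair_eq h, hA, hB, hC, t.sum, t.sum]
  generalize A.sides k = S at *
  have key : (S.card : ℤ) = 1 + (if y ∈ S then 1 else 0) + if z ∈ S then 1 else 0 := by
    clear * - t hx
    revert t hx; unfold Tri; revert x y z S; decide
  have ky : S ⊆ {y, x} ↔ z ∉ S := by
    clear * - t hx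
    revert t hx; unfold Tri; revert x y z S; decide
  have kz : S ⊆ {z, x} ↔ y ∉ S := by
    clear * - t hx
    revert t hx; unfold Tri; revert x y z S; decide
  rw [key]
  simp only [ky, kz, ne_eq, not_true_eq_false, false_and, if_false, t.1.symm, t.2.1.symm,
    not_false_eq_true, true_and, if_true, not_not]
  split_ifs <;> ring

theorem chitriple_eq (t : Tri x y z) (hx : A.src k x = some i) (hy : A.src k y = some j) :
    A.chitriple i j k = Tr.e01 (A.chs k z) := by
  have key : ∀ l, A.Prox l i ∧ A.Prox l j ∧ A.Prox l k ↔ A.child k z = some l := by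
    intro l
    constructor
    · rintro ⟨h1, h2, h3⟩
      obtain ⟨z', hz'⟩ := prox_iff.1 h3
      obtain ⟨c, hc, hr⟩ := src_eq_some.1 hz'
      have hkc := (child_eq_some.1 hc).1.lt
      have aux : ∀ {x i}, A.src k x = some i → A.Prox l i →
          x ≠ z' ∧ A.src l x = some i := by
        intro x i hx h1
        have hik := src_lt hx
        obtain ⟨w, hw⟩ := prox_iff.1 h1
        rcases hr.src_cases w with e | ⟨k', hk', e⟩
        · rw [hw, src_of_child hc] at e
          rcases eq_or_ne w z' with rfl | hwz
          · rw [Function.update_self, Option.some_inj] at e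
            exact absurd e hik.ne
          · rw [Function.update_of_ne hwz] at e
            obtain rfl := src_injective hx e.symm
            exact ⟨hwz, hw⟩
        · rw [hw, Option.some_inj] at e
          subst e
          exact absurd (hik.trans hkc) hk'.not_gt
      obtain ⟨hxz, hlx⟩ := aux hx h1
      obtain ⟨hyz, hly⟩ := aux hy h2
      have hz : z' = z := by
        rcases t.eq_or z' with rfl | rfl | rfl
        · exact absurd rfl hxz
        · exact absurd rfl hyz
        · rfl
      subst hz
      rw [hc, Option.some_inj]
      by_contra hne
      obtain ⟨h4, h5, h6⟩ := hr.last hne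
      have aux2 : ∀ {x i}, A.src k x = some i → A.src l x = some i → A.label l ≠ x := by
        rintro x i h7 h8 rfl
        rw [src_child h4, Function.update_self, Option.some_inj] at h8
        have := h5.le
        rw [h8] at this
        exact absurd ((src_lt h7).trans hkc) this.not_gt
      rcases t.eq_or (A.label l) with e | e | e
      · exact aux2 hx hlx e
      · exact aux2 hy hly e
      · exact absurd e (by simpa using h6)
    · intro h
      exact ⟨(prox_child_iff hx h).2 t.2.1.symm, (prox_child_iff hy h).2 t.2.2.symm,
        prox_iff.2 ⟨z, by rw [src_of_child h, Function.update_self]⟩⟩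
  rw [chitriple]
  simp only [key]
  rcases h : A.child k z with _ | c
  · rw [chs_none h]; simp [Tr.e01]
  · rw [chs_some h, tree_eq]
    simp [Tr.e01, filter_eq]

variable (A) in
/-- The linear factors of the sides of a cone. -/
noncomputable def lins (k : Fin r) (x : Fin 3) : RatFunc ℚ := (A.src k x).elim 1 A.lin

theorem lin_eq : A.lin k = lf RatFunc.X (A.lins k) (A.m k) := by
  have : ∀ x, A.lins k x = (A.NN k x : RatFunc ℚ) * RatFunc.X + (A.nus k x : RatFunc ℚ) := by
    intro x
    unfold lins NN nus
    rcases A.src k x with _ | i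
    · simp
    · rfl
  rw [lin, N_eq, nu_eq, lf]
  simp only [this, sum_add_distrib, ← sum_mul]
  push_cast
  ring

theorem lin_ne_zero (k : Fin r) : A.lin k ≠ 0 := by
  have h : A.lin k = algebraMap (Polynomial ℚ) (RatFunc ℚ)
      (Polynomial.C (A.N k : ℚ) * Polynomial.X + Polynomial.C (A.nu k : ℚ)) := by
    simp [lin]
  rw [h]
  intro h0
  have h1 := (map_eq_zero_iff _ (RatFunc.algebraMap_injective ℚ)).1 h0
  have h2 := congr_arg (fun p => Polynomial.coeff p 0) h1
  simp only [Polynomial.coeff_add, Polynomial.coeff_C_mul, Polynomial.coeff_X_zero, mul_zero,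
    Polynomial.coeff_C_zero, zero_add, Polynomial.coeff_zero, Int.cast_eq_zero] at h2
  exact (nu_pos k).ne' h2

theorem lins_ne_zero (k : Fin r) (x : Fin 3) : A.lins k x ≠ 0 := by
  unfold lins
  rcases A.src k x with _ | i
  · exact one_ne_zero
  · exact lin_ne_zero i

theorem X_add_one_ne_zero : (RatFunc.X + 1 : RatFunc ℚ) ≠ 0 := by
  have h : (RatFunc.X + 1 : RatFunc ℚ) =
      algebraMap (Polynomial ℚ) (RatFunc ℚ) (Polynomial.X + Polynomial.C 1) := by simp
  rw [h]
  exact fun h0 => Polynomial.X_add_C_ne_zero 1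
    ((map_eq_zero_iff _ (RatFunc.algebraMap_injective ℚ)).1 h0)

theorem sum_pairs {G : Type*} [AddCommMonoid G] (F : Fin r → Fin r → G) :
    ∑ p ∈ (univ ×ˢ univ).filter (fun p : Fin r × Fin r => A.Prox p.2 p.1), F p.1 p.2 =
      ∑ k, ∑ x, (A.src k x).elim 0 fun i => F i k := by
  rw [sum_filter, sum_product, sum_comm]
  refine sum_congr rfl fun k _ => ?_
  rw [← sum_Bset (A := A), Bset, sum_filter]

theorem sum_triples {G : Type*} [AddCommMonoid G] (F : Fin r → Fin r → Fin r → G) :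
    ∑ t ∈ (univ : Finset (Fin r × Fin r × Fin r)).filter
        (fun t => t.1 < t.2.1 ∧ t.2.1 < t.2.2 ∧ A.Prox t.2.2 t.1 ∧ A.Prox t.2.2 t.2.1),
      F t.1 t.2.1 t.2.2 =
    ∑ k, ∑ x, (A.src k x).elim 0 fun i => ∑ y, (A.src k y).elim 0 fun j =>
      if i < j then F i j k else 0 := by
  rw [sum_filter, Fintype.sum_prod_type]
  simp only [Fintype.sum_prod_type_right]
  rw [sum_comm]
  refine sum_congr rfl fun k _ => ?_
  rw [← sum_Bset (A := A) (j := k), Bset, sum_filter]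
  refine sum_congr rfl fun i _ => ?_
  rw [← sum_Bset (A := A) (j := k), Bset, sum_filter]
  split_ifs with h
  · refine sum_congr rfl fun j _ => ?_
    by_cases h2 : A.Prox k j
    · obtain ⟨y, hy⟩ := prox_iff.1 h2
      simp [h, h2, src_lt hy]
    · simp [h2]
  · exact sum_eq_zero fun j _ => if_neg fun h2 => h h2.2.2.1

variable (A) in
/-- The terms of the zeta function whose largest index is the given one. -/
noncomputable def own (k : Fin r) : RatFunc ℚ :=
  ((A.chi k : RatFunc ℚ) / A.lin k + (A.chi0 k : RatFunc ℚ) / ((RatFunc.X + 1) * A.lin k))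
  + (∑ x, (A.src k x).elim 0 fun i => (A.chipair i k : RatFunc ℚ) / (A.lin i * A.lin k)
      + (A.chi0pair i k : RatFunc ℚ) / ((RatFunc.X + 1) * (A.lin i * A.lin k)))
  + ∑ x, (A.src k x).elim 0 fun i => ∑ y, (A.src k y).elim 0 fun j =>
      if i < j then (A.chitriple i j k : RatFunc ℚ) / (A.lin i * A.lin j * A.lin k) else 0

theorem Zeta_eq_sum_own : A.Zeta = ∑ k, A.own k := by
  have h2 := sum_pairs (A := A) fun i k => (A.chipair i k : RatFunc ℚ) / (A.lin i * A.lin k)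
    + (A.chi0pair i k : RatFunc ℚ) / ((RatFunc.X + 1) * (A.lin i * A.lin k))
  have h3 := sum_triples (A := A) fun i j k =>
    (A.chitriple i j k : RatFunc ℚ) / (A.lin i * A.lin j * A.lin k)
  unfold Zeta own
  rw [h2, h3, ← sum_add_distrib, ← sum_add_distrib]

theorem lins_of_src (h : A.src k x = some i) : A.lins k x = A.lin i := by rw [lins, h]; rfl

theorem own_triples (k : Fin r) : (∑ x, (A.src k x).elim 0 fun i => ∑ y, (A.src k y).elim 0 fun j =>
      if i < j then (A.chitriple i j k : RatFunc ℚ) / (A.lin i * A.lin j * A.lin k) else 0) =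
    ∑ z, if z + 1 ∈ A.sides k ∧ z + 2 ∈ A.sides k then
      (Tr.e01 (A.chs k z) : RatFunc ℚ) / (A.lins k (z + 1) * A.lins k (z + 2) * A.lin k) else 0 := by
  set H : Fin 3 → Fin 3 → RatFunc ℚ := fun x y => (A.src k x).elim 0 fun i =>
    (A.src k y).elim 0 fun j =>
      if i < j then (A.chitriple i j k : RatFunc ℚ) / (A.lin i * A.lin j * A.lin k) else 0 with hH
  have h0 : ∀ x, H x x = 0 := by
    intro x
    rcases h : A.src k x with _ | i <;> simp [hH, h]
  have h1 : ∀ x y z, Tri x y z → H x y + H y x = if x ∈ A.sides k ∧ y ∈ A.sides k then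
      (Tr.e01 (A.chs k z) : RatFunc ℚ) / (A.lins k x * A.lins k y * A.lin k) else 0 := by
    intro x y z t
    rcases hx : A.src k x with _ | i
    · have : x ∉ A.sides k := by simp [mem_sides, hx]
      rcases hy : A.src k y with _ | j <;> simp [hH, hx, hy, this]
    · rcases hy : A.src k y with _ | j
      · have : y ∉ A.sides k := by simp [mem_sides, hy]
        simp [hH, hx, hy, this]
      · rw [if_pos ⟨mem_sides.2 ⟨i, hx⟩, mem_sides.2 ⟨j, hy⟩⟩, lins_of_src hx, lins_of_src hy]
        simp only [hH, hx, hy, Option.elim_some]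
        rcases lt_trichotomy i j with h | rfl | h
        · rw [if_pos h, if_neg h.not_gt, chitriple_eq t hx hy, add_zero]
        · exact absurd (src_injective hx hy) t.1
        · rw [if_pos h, if_neg h.not_gt, chitriple_eq t.swap hy hx, zero_add, mul_comm (A.lin j)]
  have h2 : ∀ x, ((A.src k x).elim 0 fun i => ∑ y, (A.src k y).elim 0 fun j =>
      if i < j then (A.chitriple i j k : RatFunc ℚ) / (A.lin i * A.lin j * A.lin k) else 0) =
      ∑ y, H x y := by
    intro x
    rcases h : A.src k x with _ | i <;> simp [hH, h]
  rw [sum_congr rfl fun x _ => h2 x, sum_congr rfl fun z _ =>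
    (h1 (z + 1) (z + 2) z (Tri.base z).rot).symm]
  simp only [Fin.sum_univ_three, h0, show (2 : Fin 3) + 1 = 0 from rfl,
    show (1 : Fin 3) + 1 = 2 from rfl, show (2 : Fin 3) + 2 = 1 from rfl,
    show (1 : Fin 3) + 2 = 0 from rfl, zero_add]
  ring

theorem own_eq (k : Fin r) : A.own k = RatFunc.X / (RatFunc.X + 1) *
      (((Tr.dd (A.m k) (A.chs k) : ℤ) : RatFunc ℚ) - ∑ x, (A.gapAt k x : RatFunc ℚ) / A.lins k x) / A.lin k
    + ∑ z, (Tr.e01 (A.chs k z) : RatFunc ℚ) /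
      (A.lins k (z + 1) * A.lins k (z + 2) * A.lin k) := by
  rw [← node_term_eq (S := A.sides k) X_add_one_ne_zero (lin_ne_zero k) (lins_ne_zero k), own,
    own_triples, chi_eq, chi0_eq, Tr.chiS]
  · congr 1
    congr 1
    · push_cast [gapAt]
      rfl
    · refine sum_congr rfl fun x _ => elim_src _ _ _ _ _ fun i hi => ?_
      rw [chipair_eq (Tri.base x) hi, chi0pair_eq hi, lins_of_src hi]
      push_cast
      rfl
  · intro x hx
    rcases h : A.src k x with _ | i
    · rw [lins, h]; rfl
    · exact absurd (mem_sides.2 ⟨i, h⟩) hx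

theorem lins_child (h : A.child k a = some l) :
    A.lins l = Function.update (A.lins k) a (A.lin k) := elim_child 1 A.lin h

theorem Zt_tree (k : Fin r) :
    Tr.Zt RatFunc.X (A.lins k) (A.tree k) = ∑ j ∈ A.reach univ k, A.own j := by
  induction k using A.child_induction with
  | h k ih =>
      rw [tree_eq, Tr.Zt, sum_reach, own_eq, ← lin_eq, add_assoc, ← sum_add_distrib]
      congr 1
      refine sum_congr rfl fun a _ => ?_
      rcases h : A.child k a with _ | l
      · rw [chs_none h, Tr.Zt, (Tri.base a).prod, Function.update_self,
          Function.update_of_ne (Tri.base a).1.symm, Function.update_of_ne (Tri.base a).2.1.symm,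
          Tr.e01, Option.elim_none, add_zero, Int.cast_one]
        congr 1
        ring
      · rw [chs_some h, ← lins_child h, ih _ _ h, tree_eq, Tr.e01]
        simp

theorem NZt_tree (k : Fin r) : Tr.NZt RatFunc.X (A.lins k) (A.tree k) := by
  induction k using A.child_induction with
  | h k ih =>
      rw [tree_eq, Tr.NZt, ← lin_eq]
      intro a
      rcases h : A.child k a with _ | l
      · rw [chs_none h]
        intro x
        rcases eq_or_ne x a with rfl | hx
        · rw [Function.update_self]; exact lin_ne_zero k
        · rw [Function.update_of_ne hx]; exact lins_ne_zero k x
      · rw [chs_some h, ← lins_child h]; exact ih _ _ h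

end ToricCluster

/-! ### Poles of the zeta function -/

theorem map_cev {K L : Type} [CommRing K] [CommRing L] (φ : K →+* L) (s : K) (x : Fin 3 → K)
    (f : CPoly) : φ (cev s x f) = cev (φ s) (fun i => φ (x i)) f := by
  have : φ.comp (cev s x) = cev (φ s) (fun i => φ (x i)) := by
    ext o
    · simp
    · rcases o with _ | o <;> simp
  exact RingHom.congr_fun this f

theorem Tr.admissible_of_coprime {a b : ℕ} (hab : Nat.Coprime a b) (hb : 2 ≤ b) :
    Tr.Admissible b (-(a : ℚ) / (b : ℚ)) := by
  have hb0 : (b : ℚ) ≠ 0 := by positivity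
  refine ⟨fun h => ?_, fun N ν h => ?_, ?_⟩
  · field_simp at h
    have : a = b := by
      have : (a : ℚ) = b := by linarith
      exact_mod_cast this
    subst this
    rw [Nat.coprime_self] at hab
    omega
  · field_simp at h
    have h1 : N * a = b * ν := by
      have : (N : ℚ) * a = b * ν := by linarith
      exact_mod_cast this
    exact IsCoprime.dvd_of_dvd_mul_right (Nat.isCoprime_iff_coprime.2 hab.symm) ⟨ν, h1⟩
  · rintro N ⟨c, rfl⟩
    refine ⟨-a * c, ?_⟩
    push_cast
    field_simp

namespace ToricCluster

open ToricConstellation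

variable {r : ℕ} {A : ToricCluster r}

/-- The values of the linear factors where all divisors with `b ∣ N` contribute zero are not
poles. -/
theorem denom_eval_ne_zero (hA : A.Idealistic) {b : ℤ} {s₀ : ℚ} (hs : Tr.Admissible b s₀)
    (h0 : ∑ i ∈ univ.filter (fun i => b ∣ A.N i), A.chi i = 0) : A.Zeta.denom.eval s₀ ≠ 0 := by
  rcases Nat.eq_zero_or_pos r with rfl | hr
  · have : A.Zeta = 0 := by
      rw [Zeta_eq_sum_own]; simp
    simp [this]
  have hroot : ¬ 0 < ((⟨0, hr⟩ : Fin r) : ℕ) := lt_irrefl 0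
  set o : Fin r := ⟨0, hr⟩
  have hsrc := A.src_root hroot
  have hX := Xs_tree (A := A) b o
  have hZ := Zt_tree (A := A) o
  have hN := NZt_tree (A := A) o
  rw [reach_univ hroot, ← sum_filter, h0, show A.sides o = ∅ by ext x; simp [mem_sides, hsrc],
    show A.NN o = fun _ => 0 by funext x; simp [NN, hsrc]] at hX
  rw [reach_univ hroot, ← Zeta_eq_sum_own] at hZ
  have hl : A.lins o = fun _ => 1 := by funext x; simp [lins, hsrc]
  rw [hl] at hZ hN
  obtain ⟨n, d, hd, h1, -⟩ := Tr.root_claim hs (hA.ok o) hX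
  have h2 := h1 _ RatFunc.X (fun _ => 1) X_add_one_ne_zero (fun _ _ => rfl) hN
  have e : ∀ f : CPoly, cev (RatFunc.X : RatFunc ℚ) (fun _ => 1) f =
      algebraMap (Polynomial ℚ) (RatFunc ℚ) (cev Polynomial.X (fun _ => 1) f) := by
    intro f
    rw [map_cev]
    simp
  have e' : ∀ f : CPoly, (cev (Polynomial.X : Polynomial ℚ) (fun _ => 1) f).eval s₀ =
      cev s₀ (fun _ => 1) f := by
    intro f
    rw [← Polynomial.coe_evalRingHom, map_cev]
    simp
  rw [prod_const_one, one_mul, hZ, e, e] at h2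
  rw [← e'] at hd
  have hq : cev (Polynomial.X : Polynomial ℚ) (fun _ => 1) d ≠ 0 := by
    intro h
    rw [h] at hd
    simp at hd
  obtain ⟨c, hc⟩ := (RatFunc.denom_dvd hq).2 ⟨_, eq_div_of_mul_eq (by
    rwa [Ne, map_eq_zero_iff _ (RatFunc.algebraMap_injective ℚ)]) h2⟩
  rw [hc, Polynomial.eval_mul] at hd
  exact left_ne_zero_of_mul hd

end ToricCluster

open ToricConstellation ToricCluster

theorem stmt14 {r : ℕ} (A : ToricCluster r) (hA : A.Idealistic)
    (a b : ℕ) (ha : 0 < a) (hb : 0 < b) (hab : Nat.Coprime a b) (hb2 : 2 ≤ b)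
    (hpole : (A.Zeta).denom.eval (-(a : ℚ) / (b : ℚ)) = 0) :
    (∑ i ∈ Finset.univ.filter (fun i => (b : ℤ) ∣ A.N i), A.chi i) ≠ 0 := by
  exact fun h0 => denom_eval_ne_zero hA (Tr.admissible_of_coprime hab hb2) h0 hpole
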